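/- For every ε > 0 there exist constants C > 0 and A > 0 such that for every real t with |t| ≥ 1 and every real x ≥ 2, writing s = 1/2 + it, one has | ∑_{1≤h≤x} h^(1/2−s) σ_{2s−1}(h) − ζ(2s) x^(s+1/2)/(s+1/2) − ζ(2−2s) x^(3/2−s)/(3/2−s) | ≤ C (1+|t|)^A x^(27/82+ε), where σ_w(h) = ∑_{d ∣ h} d^w. Equivalently, since ∑_{ab=h} (a/b)^(s−1/2) = h^(1/2−s) σ_{2s−1}(h), this is the Van der Corput-type asymptotic for ∑_{h≤x} ∑_{ab=h} (a/b)^(s−1/2) on the critical line Re s = 1/2. -/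

import Mathlib

open Finset Complex

/-- The additive character `u ↦ exp (2πiu)`. -/
noncomputable def expTwoPi (u : ℝ) : ℂ := Complex.exp ((2 * Real.pi * u : ℝ) * I)

lemma norm_expTwoPi (u : ℝ) : ‖expTwoPi u‖ = 1 := Complex.norm_exp_ofReal_mul_I _

lemma expTwoPi_add (u v : ℝ) : expTwoPi (u + v) = expTwoPi u * expTwoPi v := by
  rw [expTwoPi, expTwoPi, expTwoPi, ← Complex.exp_add]
  push_cast
  ring_nf

lemma expTwoPi_zero : expTwoPi 0 = 1 := by simp [expTwoPi]

lemma expTwoPi_int (n : ℤ) : expTwoPi n = 1 := by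
  rw [expTwoPi, Complex.exp_eq_one_iff]
  exact ⟨n, by push_cast; ring⟩

lemma expTwoPi_neg (u : ℝ) : expTwoPi (-u) = (starRingEnd ℂ) (expTwoPi u) := by
  rw [expTwoPi, expTwoPi, ← Complex.exp_conj, map_mul, conj_ofReal, conj_I]
  push_cast
  ring_nf

lemma expTwoPi_sub (u v : ℝ) :
    expTwoPi (u - v) = expTwoPi u * (starRingEnd ℂ) (expTwoPi v) := by
  rw [sub_eq_add_neg, expTwoPi_add, expTwoPi_neg]

lemma norm_expTwoPi_sub_one (u : ℝ) : ‖expTwoPi u - 1‖ = 2 * |Real.sin (Real.pi * u)| := by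
  rw [expTwoPi, mul_comm, Complex.norm_exp_I_mul_ofReal_sub_one, norm_mul]
  simp only [Real.norm_eq_abs]
  rw [abs_of_pos (by norm_num : (0:ℝ) < 2)]
  congr 3
  ring

lemma norm_expTwoPi_sub (u v : ℝ) :
    ‖expTwoPi u - expTwoPi v‖ = 2 * |Real.sin (Real.pi * (u - v))| := by
  have : expTwoPi u - expTwoPi v = expTwoPi v * (expTwoPi (u - v) - 1) := by
    rw [mul_sub, ← expTwoPi_add]
    simp
  rw [this, norm_mul, norm_expTwoPi, one_mul, norm_expTwoPi_sub_one]

lemma norm_sum_mul_le_of_partial_sums (g z : ℕ → ℂ) (L : ℕ) (B : ℝ)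
    (hB : ∀ m ≤ L + 1, ‖∑ i ∈ range m, z i‖ ≤ B) :
    ‖∑ i ∈ range (L + 1), g i * z i‖ ≤ B * (‖g L‖ + ∑ i ∈ range L, ‖g (i + 1) - g i‖) := by
  have key : ∀ L : ℕ, ∑ i ∈ range (L + 1), g i * z i = g L * ∑ i ∈ range (L + 1), z i
      - ∑ i ∈ range L, (g (i + 1) - g i) * ∑ j ∈ range (i + 1), z j := by
    intro L
    induction L with
    | zero => simp
    | succ L ih =>
      rw [sum_range_succ, ih, sum_range_succ z (L + 1),
        sum_range_succ (fun i => (g (i + 1) - g i) * ∑ j ∈ range (i + 1), z j) L]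
      ring
  rw [key]
  refine (norm_sub_le _ _).trans ?_
  rw [norm_mul, mul_add, mul_sum, mul_comm B]
  refine add_le_add (mul_le_mul_of_nonneg_left (hB _ le_rfl) (norm_nonneg _))
    ((norm_sum_le _ _).trans (sum_le_sum fun i hi => ?_))
  rw [norm_mul, mul_comm B]
  exact mul_le_mul_of_nonneg_left (hB _ (by have := mem_range.1 hi; omega)) (norm_nonneg _)

/-- The Kusmin–Landau inequality for sequences with monotone first differences. -/
lemma norm_sum_expTwoPi_le_of_fwdDiff_mem_Icc (f : ℕ → ℝ) (L : ℕ) (k : ℤ) (δ : ℝ) (hδ : 0 < δ)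
    (hmono : ∀ n, n + 1 < L → f (n + 1) - f n ≤ f (n + 2) - f (n + 1))
    (hlow : ∀ n < L, k + δ ≤ f (n + 1) - f n) (hup : ∀ n < L, f (n + 1) - f n ≤ k + 1 - δ) :
    ‖∑ n ∈ range L, expTwoPi (f n)‖ ≤ 2 / δ := by
  rcases L with _ | L
  · simp; positivity
  set D : ℕ → ℝ := fun n => f (n + 1) - f n - k with hD
  have hDl : ∀ n < L + 1, δ ≤ D n := fun n hn => by have := hlow n hn; simp only [hD]; linarith
  have hDu : ∀ n < L + 1, D n ≤ 1 - δ := fun n hn => by have := hup n hn; simp only [hD]; linarith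
  have heD : ∀ n, expTwoPi (f (n + 1)) = expTwoPi (f n) * expTwoPi (D n) := by
    intro n
    have : f (n + 1) = f n + D n + (k : ℤ) := by simp only [hD]; ring
    rw [this, expTwoPi_add, expTwoPi_int, mul_one, expTwoPi_add]
  have hpi := Real.pi_pos
  have hδ2 : δ ≤ 1 / 2 := by linarith [hDl 0 (by omega), hDu 0 (by omega)]
  have hsin : ∀ n < L + 1, 2 * δ ≤ Real.sin (Real.pi * D n) := by
    intro n hn
    have h1 := hDl n hn
    have h2 := hDu n hn
    rcases le_total (D n) (1 / 2) with h | h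
    · have := Real.mul_le_sin (x := Real.pi * D n) (mul_nonneg hpi.le (by linarith)) (by nlinarith)
      have e : 2 / Real.pi * (Real.pi * D n) = 2 * D n := by field_simp
      linarith
    · have := Real.mul_le_sin (x := Real.pi * (1 - D n)) (by nlinarith) (by nlinarith)
      have e : 2 / Real.pi * (Real.pi * (1 - D n)) = 2 * (1 - D n) := by field_simp
      have e2 : Real.sin (Real.pi * (1 - D n)) = Real.sin (Real.pi * D n) := by
        rw [mul_sub, mul_one, Real.sin_pi_sub]
      linarith
  set c : ℕ → ℂ := fun n => (1 - expTwoPi (D n))⁻¹ with hc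
  have hnorm : ∀ n < L + 1, ‖1 - expTwoPi (D n)‖ = 2 * Real.sin (Real.pi * D n) := by
    intro n hn
    rw [norm_sub_rev, norm_expTwoPi_sub_one, abs_of_nonneg]
    linarith [hsin n hn]
  have hne : ∀ n < L + 1, 1 - expTwoPi (D n) ≠ 0 := by
    intro n hn
    rw [← norm_pos_iff, hnorm n hn]
    linarith [hsin n hn]
  have hsum : ∑ n ∈ range (L + 1), expTwoPi (f n)
      = ∑ n ∈ range (L + 1), c n * (expTwoPi (f n) - expTwoPi (f (n + 1))) := by
    refine sum_congr rfl fun n hn => ?_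
    have := hne n (mem_range.1 hn)
    rw [heD]
    simp only [hc]
    field_simp
  have hcn : ∀ n < L + 1, ‖c n‖ ≤ 1 / (4 * δ) := by
    intro n hn
    simp only [hc]
    rw [norm_inv, hnorm n hn, ← one_div]
    exact one_div_le_one_div_of_le (by positivity) (by linarith [hsin n hn])
  set ct : ℕ → ℝ := fun n => Real.cos (Real.pi * D n) / Real.sin (Real.pi * D n) / 2 with hct
  have hctn : ∀ n < L + 1, |ct n| ≤ 1 / (4 * δ) := by
    intro n hn
    have h1 := hsin n hn
    simp only [hct]
    rw [abs_div, abs_div, abs_of_pos (by linarith : 0 < Real.sin (Real.pi * D n)),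
      abs_of_pos (by norm_num : (0:ℝ) < 2), div_div]
    exact div_le_div₀ zero_le_one (Real.abs_cos_le_one _) (by positivity) (by linarith)
  have hdiff : ∀ n ∈ range L, ‖c (n + 1) - c n‖ = ct n - ct (n + 1) := by
    intro n hn
    have hn' := mem_range.1 hn
    have h1 := hsin n (by omega)
    have h2 := hsin (n + 1) (by omega)
    have e1 : c (n + 1) - c n
        = (expTwoPi (D (n + 1)) - expTwoPi (D n)) /
          ((1 - expTwoPi (D (n + 1))) * (1 - expTwoPi (D n))) := by
      have a1 := hne n (by omega)
      have a2 := hne (n + 1) (by omega)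
      simp only [hc]
      field_simp
      ring
    have hm : D n ≤ D (n + 1) := by
      have := hmono n (by omega)
      simp only [hD]; linarith
    have hsn : 0 ≤ Real.sin (Real.pi * (D (n + 1) - D n)) := by
      apply Real.sin_nonneg_of_nonneg_of_le_pi
      · exact mul_nonneg hpi.le (by linarith)
      · have a := hDl n (by omega)
        have b := hDu (n + 1) (by omega)
        nlinarith
    rw [e1, norm_div, norm_mul, norm_expTwoPi_sub, hnorm _ (by omega), hnorm _ (by omega),
      abs_of_nonneg hsn, mul_sub, Real.sin_sub]
    simp only [hct]
    have : Real.sin (Real.pi * D n) ≠ 0 := by linarith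
    have : Real.sin (Real.pi * D (n + 1)) ≠ 0 := by linarith
    field_simp
  rw [hsum]
  have := norm_sum_mul_le_of_partial_sums c (fun n => expTwoPi (f n) - expTwoPi (f (n + 1))) L 2
    (fun m _ => by
      rw [sum_range_sub']
      refine (norm_sub_le _ _).trans ?_
      rw [norm_expTwoPi, norm_expTwoPi]; norm_num)
  refine this.trans ?_
  rw [sum_congr rfl hdiff, sum_range_sub']
  have a1 := hcn L (by omega)
  have a2 := abs_le.1 (hctn 0 (by omega))
  have a3 := abs_le.1 (hctn L (by omega))
  have e : 2 / δ = 8 * (1 / (4 * δ)) := by field_simp; norm_num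
  have : 0 < 1 / (4 * δ) := by positivity
  rw [e]; linarith

lemma exists_filter_eq_Ico_of_monotoneOn (D : ℕ → ℝ) (L : ℕ)
    (hD : ∀ m n, m ≤ n → n < L → D m ≤ D n) (u v : ℝ) :
    ∃ a b, b ≤ L ∧ (range L).filter (fun n => u ≤ D n ∧ D n ≤ v) = Ico a b := by
  set s := (range L).filter (fun n => u ≤ D n ∧ D n ≤ v) with hs
  rcases s.eq_empty_or_nonempty with h | h
  · exact ⟨0, 0, by omega, by simp [h]⟩
  · have h1 := s.min'_mem h
    have h2 := s.max'_mem h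
    have g1 := h1
    have g2 := h2
    replace g1 := mem_filter.1 g1
    replace g2 := mem_filter.1 g2
    rw [mem_range] at g1 g2
    refine ⟨s.min' h, s.max' h + 1, by omega, ?_⟩
    ext n
    rw [mem_Ico]
    constructor
    · intro hn
      exact ⟨s.min'_le n hn, Nat.lt_succ_of_le (s.le_max' n hn)⟩
    · rintro ⟨ha, hb⟩
      rw [hs, mem_filter, mem_range]
      exact ⟨by omega, g1.2.1.trans (hD _ _ ha (by omega)),
        (hD _ _ (by omega) g2.1).trans g2.2.2⟩

lemma card_le_of_spaced (D : ℕ → ℝ) (L : ℕ) (l : ℝ) (hl : 0 < l)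
    (hD : ∀ m n, m ≤ n → n < L → l * ((n:ℝ) - m) ≤ D n - D m) (u d : ℝ) (hd : 0 ≤ d)
    (s : Finset ℕ)
    (hs : ∀ n ∈ s, n < L ∧ u ≤ D n ∧ D n ≤ u + d) : (s.card : ℝ) ≤ d / l + 1 := by
  rcases s.eq_empty_or_nonempty with h | h
  · simp [h]; positivity
  · obtain ⟨a1, a2, a3⟩ := hs _ (s.min'_mem h)
    obtain ⟨b1, b2, b3⟩ := hs _ (s.max'_mem h)
    have hle : s.min' h ≤ s.max' h := s.min'_le _ (s.max'_mem h)
    have hsub : s ⊆ Icc (s.min' h) (s.max' h) := fun n hn =>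
      mem_Icc.2 ⟨s.min'_le n hn, s.le_max' n hn⟩
    have hc := card_le_card hsub
    rw [Nat.card_Icc] at hc
    have hc' : (s.card : ℝ) ≤ (s.max' h : ℝ) - s.min' h + 1 := by
      have : s.card + s.min' h ≤ s.max' h + 1 := by omega
      have : ((s.card + s.min' h : ℕ) : ℝ) ≤ ((s.max' h + 1 : ℕ) : ℝ) := by exact_mod_cast this
      push_cast at this
      linarith
    have := hD _ _ hle b1
    have : (s.max' h : ℝ) - s.min' h ≤ d / l := by
      rw [le_div_iff₀ hl]; nlinarith
    linarith

/-- Van der Corput's second derivative test, for sequences. -/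
lemma norm_sum_expTwoPi_le_of_second_fwdDiff (f : ℕ → ℝ) (L : ℕ) (l α : ℝ) (hl : 0 < l)
    (hα : 1 ≤ α)
    (hlow : ∀ n, n + 2 < L → l ≤ f (n + 2) - f (n + 1) - (f (n + 1) - f n))
    (hup : ∀ n, n + 2 < L → f (n + 2) - f (n + 1) - (f (n + 1) - f n) ≤ α * l) :
    ‖∑ n ∈ range L, expTwoPi (f n)‖ ≤ 20 * α * (L * √l + 1 / √l) := by
  have hsl : 0 < √l := Real.sqrt_pos.2 hl
  have hsq : √l * √l = l := Real.mul_self_sqrt hl.le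
  have htriv : ∀ s : Finset ℕ, ‖∑ n ∈ s, expTwoPi (f n)‖ ≤ s.card := fun s => by
    refine (norm_sum_le _ _).trans ?_
    simp [norm_expTwoPi]
  by_cases hl4 : 1 / 4 ≤ l
  · have : 1 / 2 ≤ √l := by
      rw [Real.le_sqrt' (by norm_num)]; linarith
    refine (htriv _).trans ?_
    rw [card_range]
    have h0 : (0:ℝ) ≤ L := Nat.cast_nonneg _
    have h1 : (L:ℝ) ≤ 2 * (L * √l) := by nlinarith
    have h2 : 0 < 1 / √l := by positivity
    nlinarith [mul_nonneg h0 hsl.le]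
  have hl4' : √l ≤ 1 / 2 := by
    rw [Real.sqrt_le_left (by norm_num)]; linarith
  rcases L with _ | L
  · simp; positivity
  set D : ℕ → ℝ := fun n => f (n + 1) - f n with hD
  have hsp : ∀ m n, m ≤ n → n < L → l * ((n:ℝ) - m) ≤ D n - D m := by
    intro m n hmn
    induction n, hmn using Nat.le_induction with
    | base => intro _; simp
    | succ n hmn ih =>
      intro hn
      have := ih (by omega)
      have h2 := hlow n (by omega)
      simp only [hD] at this ⊢
      push_cast
      linarith
  have hsp' : ∀ n, n < L → D n - D 0 ≤ α * l * n := by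
    intro n
    induction n with
    | zero => intro _; simp
    | succ n ih =>
      intro hn
      have := ih (by omega)
      have h2 := hup n (by omega)
      simp only [hD] at this ⊢
      push_cast
      linarith
  have hmono : ∀ m n, m ≤ n → n < L → D m ≤ D n := by
    intro m n h1 h2
    have := hsp m n h1 h2
    have h3 : (0:ℝ) ≤ (n:ℝ) - m := by
      have : (m:ℝ) ≤ n := by exact_mod_cast h1
      linarith
    nlinarith [mul_nonneg hl.le h3]
  have hfib : ∀ k : ℤ, ‖∑ n ∈ (range L).filter (fun n => ⌊D n⌋ = k), expTwoPi (f n)‖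
      ≤ 6 / √l := by
    intro k
    set F := (range L).filter (fun n => ⌊D n⌋ = k) with hF
    set p : ℕ → Prop := fun n => k + √l ≤ D n ∧ D n ≤ k + 1 - √l with hp
    have hsplit := sum_filter_add_sum_filter_not F p (fun n => expTwoPi (f n))
    rw [← hsplit]
    have hM : F.filter p = (range L).filter p := by
      ext n
      simp only [hF, mem_filter, hp]
      constructor
      · rintro ⟨⟨a, b⟩, c⟩; exact ⟨a, c⟩
      · rintro ⟨a, c⟩
        refine ⟨⟨a, ?_⟩, c⟩
        rw [Int.floor_eq_iff]
        constructor <;> linarith [c.1, c.2]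
    have h1 : ‖∑ n ∈ F.filter p, expTwoPi (f n)‖ ≤ 2 / √l := by
      rw [hM]
      obtain ⟨a, b, hbL, hab⟩ := exists_filter_eq_Ico_of_monotoneOn D L hmono (k + √l) (k + 1 - √l)
      have hmem : ∀ i < b - a, a + i < L ∧ k + √l ≤ D (a + i) ∧ D (a + i) ≤ k + 1 - √l := by
        intro i hi
        have : a + i ∈ Ico a b := mem_Ico.2 ⟨by omega, by omega⟩
        rw [← hab, mem_filter, mem_range] at this
        exact this
      have hpe : (range L).filter p = Ico a b := hab
      rw [hpe, sum_Ico_eq_sum_range]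
      apply norm_sum_expTwoPi_le_of_fwdDiff_mem_Icc (fun i => f (a + i)) (b - a) k (√l) hsl
      · intro n hn
        exact hmono (a + n) (a + n + 1) (by omega) (by omega)
      · intro n hn
        exact (hmem n hn).2.1
      · intro n hn
        exact (hmem n hn).2.2
    have h2 : ‖∑ n ∈ F.filter (fun n => ¬ p n), expTwoPi (f n)‖ ≤ 4 / √l := by
      refine (htriv _).trans ?_
      have hcov : F.filter (fun n => ¬ p n) ⊆
          (range L).filter (fun n => (k:ℝ) ≤ D n ∧ D n ≤ k + √l) ∪
          (range L).filter (fun n => (k:ℝ) + 1 - √l ≤ D n ∧ D n ≤ k + 1 - √l + √l) := by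
        intro n hn
        simp only [hF, mem_filter, hp, not_and_or, not_le] at hn
        obtain ⟨⟨a, b⟩, c⟩ := hn
        rw [Int.floor_eq_iff] at b
        simp only [mem_union, mem_filter]
        rcases c with c | c
        · exact Or.inl ⟨a, b.1, c.le⟩
        · exact Or.inr ⟨a, c.le, by linarith [b.2]⟩
      have hc1 := card_le_of_spaced D L l hl hsp k (√l) hsl.le
        ((range L).filter (fun n => (k:ℝ) ≤ D n ∧ D n ≤ k + √l))
        (fun n hn => by simpa using hn)
      have hc2 := card_le_of_spaced D L l hl hsp (k + 1 - √l) (√l) hsl.le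
        ((range L).filter (fun n => (k:ℝ) + 1 - √l ≤ D n ∧ D n ≤ k + 1 - √l + √l))
        (fun n hn => by
          rw [mem_filter, mem_range] at hn
          exact hn)
      have hc := (card_le_card hcov).trans (card_union_le _ _)
      have hc' : ((F.filter (fun n => ¬ p n)).card : ℝ) ≤ (√l / l + 1) + (√l / l + 1) := by
        refine le_trans ?_ (add_le_add hc1 hc2)
        exact_mod_cast hc
      refine hc'.trans ?_
      have e : √l / l = 1 / √l := by
        rw [div_eq_div_iff hl.ne' hsl.ne']; linarith
      have : 1 ≤ 1 / √l := by rw [le_div_iff₀ hsl]; linarith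
      rw [e]
      have e4 : 4 / √l = 4 * (1 / √l) := by ring
      linarith
    refine (norm_add_le _ _).trans ?_
    have : 6 / √l = 2 / √l + 4 / √l := by ring
    linarith
  rw [sum_range_succ]
  have hlast : ‖expTwoPi (f L)‖ ≤ 1 := (norm_expTwoPi _).le
  have h1l : 1 ≤ 1 / √l := by rw [le_div_iff₀ hsl]; linarith
  rcases L with _ | L
  · simp only [range_zero, sum_empty, zero_add]
    refine hlast.trans ?_
    have : 0 ≤ ((1:ℕ):ℝ) * √l := by positivity
    nlinarith
  have hmaps : ∀ n ∈ range (L + 1), ⌊D n⌋ ∈ Icc ⌊D 0⌋ ⌊D L⌋ := by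
    intro n hn
    have hn' := mem_range.1 hn
    exact mem_Icc.2 ⟨Int.floor_le_floor (hmono 0 n (by omega) (by omega)),
      Int.floor_le_floor (hmono n L (by omega) (by omega))⟩
  rw [← sum_fiberwise_of_maps_to hmaps]
  have hb : ‖∑ k ∈ Icc ⌊D 0⌋ ⌊D L⌋, ∑ n ∈ (range (L + 1)).filter (fun n => ⌊D n⌋ = k),
      expTwoPi (f n)‖ ≤ (α * l * L + 2) * (6 / √l) := by
    refine (norm_sum_le _ _).trans ((sum_le_sum fun k _ => hfib k).trans ?_)
    rw [sum_const, nsmul_eq_mul]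
    refine mul_le_mul_of_nonneg_right ?_ (by positivity)
    rw [Int.card_Icc]
    have hle : ⌊D 0⌋ ≤ ⌊D L⌋ := Int.floor_le_floor (hmono 0 L (by omega) (by omega))
    have : (((⌊D L⌋ + 1 - ⌊D 0⌋).toNat : ℕ) : ℝ) = (⌊D L⌋:ℝ) + 1 - ⌊D 0⌋ := by
      have h : (((⌊D L⌋ + 1 - ⌊D 0⌋).toNat : ℕ) : ℤ) = ⌊D L⌋ + 1 - ⌊D 0⌋ :=
        Int.toNat_of_nonneg (by omega)
      exact_mod_cast h
    rw [this]
    have a := hsp' L (by omega)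
    linarith [Int.floor_le (D L), Int.lt_floor_add_one (D 0)]
  refine (norm_add_le _ _).trans ((add_le_add hb hlast).trans ?_)
  have e : (α * l * L + 2) * (6 / √l) = 6 * (α * (L * √l)) + 12 * (1 / √l) := by
    have : l / √l = √l := by rw [div_eq_iff hsl.ne', hsq]
    calc (α * l * L + 2) * (6 / √l) = 6 * (α * (L * (l / √l))) + 12 * (1 / √l) := by ring
      _ = _ := by rw [this]
  rw [e]
  push_cast
  have : 0 ≤ α * (L * √l) := by positivity
  nlinarith [mul_pos (lt_of_lt_of_le one_pos hα) hsl, mul_le_mul_of_nonneg_right hα (zero_le_one.trans h1l)]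

lemma sum_range_filter_le_sum_sub (T : ℕ → ℝ) (hT : ∀ h, 0 ≤ T h) (H j : ℕ) (hj : j < H) :
    ∑ k ∈ range H, T (if j ≤ k then k - j else j - k) ≤ 2 * ∑ h ∈ range H, T h := by
  rw [← sum_filter_add_sum_filter_not (range H) (fun k => j ≤ k), two_mul]
  refine add_le_add ?_ ?_
  · rw [sum_congr rfl (g := fun k => T (k - j))
      (fun k hk => by rw [if_pos (mem_filter.1 hk).2])]
    rw [← sum_image (f := T) (g := fun k => k - j) (s := (range H).filter (fun k => j ≤ k))]
    · refine sum_le_sum_of_subset_of_nonneg ?_ (fun _ _ _ => hT _)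
      intro k hk
      simp only [mem_image, mem_filter, mem_range] at hk ⊢
      omega
    · intro a ha b hb hab
      simp only [coe_filter, mem_range, Set.mem_ofPred_eq] at ha hb hab
      omega
  · rw [sum_congr rfl (g := fun k => T (j - k))
      (fun k hk => by rw [if_neg (mem_filter.1 hk).2])]
    rw [← sum_image (f := T) (g := fun k => j - k) (s := (range H).filter (fun k => ¬ j ≤ k))]
    · refine sum_le_sum_of_subset_of_nonneg ?_ (fun _ _ _ => hT _)
      intro k hk
      simp only [mem_image, mem_filter, mem_range] at hk ⊢
      omega
    · intro a ha b hb hab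
      simp only [coe_filter, mem_range, Set.mem_ofPred_eq] at ha hb hab
      omega

/-- The Weyl–van der Corput inequality. -/
lemma sq_norm_sum_le_weyl (z : ℕ → ℂ) (L H : ℕ) (hH : 0 < H) (hHL : H ≤ L) :
    ‖∑ n ∈ range L, z n‖ ^ 2 ≤ 4 * L / H *
      ∑ h ∈ range H, ‖∑ n ∈ range (L - h), z (n + h) * (starRingEnd ℂ) (z n)‖ := by
  set T : ℕ → ℝ := fun h => ‖∑ n ∈ range (L - h), z (n + h) * (starRingEnd ℂ) (z n)‖ with hT
  set v : ℕ → ℕ → ℂ := fun m j => if j ≤ m ∧ m < j + L then z (m - j) else 0 with hv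
  have hS : ∀ j < H, ∑ m ∈ range (L + H), v m j = ∑ n ∈ range L, z n := by
    intro j hj
    have : ∑ m ∈ range (L + H), v m j = ∑ m ∈ Ico j (j + L), z (m - j) := by
      simp only [hv]
      rw [← sum_filter]
      refine sum_congr ?_ (fun _ _ => rfl)
      ext m
      simp only [mem_filter, mem_range, mem_Ico]
      omega
    rw [this, sum_Ico_eq_sum_range]
    simp
  have hpair : ∀ j k, j ≤ k → k < H →
      ‖∑ m ∈ range (L + H), v m j * (starRingEnd ℂ) (v m k)‖ = T (k - j) := by
    intro j k hjk hk
    simp only [hT]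
    congr 1
    have : ∑ m ∈ range (L + H), v m j * (starRingEnd ℂ) (v m k)
        = ∑ m ∈ Ico k (j + L), z (m - j) * (starRingEnd ℂ) (z (m - k)) := by
      rw [← sum_subset (s₁ := Ico k (j + L))]
      · refine sum_congr rfl fun m hm => ?_
        rw [mem_Ico] at hm
        simp only [hv]
        rw [if_pos ⟨by omega, by omega⟩, if_pos ⟨by omega, by omega⟩]
      · intro m hm
        rw [mem_Ico] at hm
        rw [mem_range]; omega
      · intro m _ hm
        rw [mem_Ico] at hm
        simp only [hv]
        by_cases h1 : k ≤ m
        · rw [if_neg (by omega), zero_mul]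
        · rw [if_neg (by omega : ¬ (k ≤ m ∧ m < k + L)), map_zero, mul_zero]
    rw [this, sum_Ico_eq_sum_range]
    have e : j + L - k = L - (k - j) := by omega
    rw [e]
    refine sum_congr rfl fun n _ => ?_
    congr 2
    · omega
    · congr 1; omega
  have hpair' : ∀ j < H, ∀ k < H, ‖∑ m ∈ range (L + H), v m j * (starRingEnd ℂ) (v m k)‖
      = T (if j ≤ k then k - j else j - k) := by
    intro j hj k hk
    split_ifs with h
    · exact hpair j k h hk
    · rw [← hpair k j (by omega) hj, ← RCLike.norm_conj, map_sum]
      congr 1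
      refine sum_congr rfl fun m _ => ?_
      rw [map_mul, Complex.conj_conj, mul_comm]
  set S := ∑ n ∈ range L, z n with hSdef
  have h1 : (H : ℂ) * S = ∑ m ∈ range (L + H), ∑ j ∈ range H, v m j := by
    rw [sum_comm, sum_congr rfl (fun j hj => hS j (mem_range.1 hj))]
    simp
  have h2 : (H * ‖S‖) ^ 2 ≤ (L + H) * ∑ m ∈ range (L + H), ‖∑ j ∈ range H, v m j‖ ^ 2 := by
    have a : (H:ℝ) * ‖S‖ ≤ ∑ m ∈ range (L + H), ‖∑ j ∈ range H, v m j‖ := by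
      have : (H:ℝ) * ‖S‖ = ‖(H : ℂ) * S‖ := by simp
      rw [this, h1]
      exact norm_sum_le _ _
    have b := sq_sum_le_card_mul_sum_sq (s := range (L + H))
      (f := fun m => ‖∑ j ∈ range H, v m j‖)
    rw [card_range] at b
    push_cast at b
    exact (pow_le_pow_left₀ (by positivity) a 2).trans b
  have h3 : ∑ m ∈ range (L + H), ‖∑ j ∈ range H, v m j‖ ^ 2
      ≤ ∑ j ∈ range H, ∑ k ∈ range H, T (if j ≤ k then k - j else j - k) := by
    have e : ((∑ m ∈ range (L + H), ‖∑ j ∈ range H, v m j‖ ^ 2 : ℝ) : ℂ)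
        = ∑ j ∈ range H, ∑ k ∈ range H, ∑ m ∈ range (L + H),
          v m j * (starRingEnd ℂ) (v m k) := by
      push_cast
      rw [sum_congr rfl (fun j _ => sum_comm), sum_comm]
      refine sum_congr rfl fun m _ => ?_
      rw [← Complex.mul_conj', map_sum, sum_mul_sum]
    have e2 : ∑ m ∈ range (L + H), ‖∑ j ∈ range H, v m j‖ ^ 2
        = ‖((∑ m ∈ range (L + H), ‖∑ j ∈ range H, v m j‖ ^ 2 : ℝ) : ℂ)‖ := by
      rw [Complex.norm_real, Real.norm_of_nonneg (sum_nonneg fun _ _ => by positivity)]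
    rw [e2, e]
    refine (norm_sum_le _ _).trans (sum_le_sum fun j hj => (norm_sum_le _ _).trans
      (sum_le_sum fun k hk => ?_))
    rw [hpair' j (mem_range.1 hj) k (mem_range.1 hk)]
  have h4 : ∑ j ∈ range H, ∑ k ∈ range H, T (if j ≤ k then k - j else j - k)
      ≤ H * (2 * ∑ h ∈ range H, T h) := by
    refine (sum_le_sum fun j hj => sum_range_filter_le_sum_sub T (fun h => norm_nonneg _) H j
      (mem_range.1 hj)).trans ?_
    simp
  have hT0 : 0 ≤ ∑ h ∈ range H, T h := sum_nonneg fun h _ => norm_nonneg _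
  have hH' : (0:ℝ) < H := by exact_mod_cast hH
  have hHL' : (H:ℝ) ≤ L := by exact_mod_cast hHL
  have h5 : (H * ‖S‖) ^ 2 ≤ (2 * L) * (H * (2 * ∑ h ∈ range H, T h)) := by
    refine h2.trans ?_
    exact mul_le_mul (by linarith) (h3.trans h4) (sum_nonneg fun _ _ => by positivity)
      (by positivity)
  have h6 : ‖S‖ ^ 2 * H ^ 2 ≤ (4 * L / H * ∑ h ∈ range H, T h) * H ^ 2 := by
    calc ‖S‖ ^ 2 * H ^ 2 = (H * ‖S‖) ^ 2 := by ring
      _ ≤ _ := h5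
      _ = _ := by field_simp; ring
  exact le_of_mul_le_mul_right h6 (by positivity)

lemma fwdDiff_iter_shift_sub (f : ℕ → ℝ) (k h n : ℕ) :
    (fwdDiff 1)^[k] (fun n => f (n + h) - f n) n
      = ∑ j ∈ range h, (fwdDiff 1)^[k + 1] f (n + j) := by
  have h1 : ∀ g : ℕ → ℝ, ∀ n, g (n + h) - g n = ∑ j ∈ range h, fwdDiff 1 g (n + j) := by
    intro g n
    have := sum_range_sub (fun j => g (n + j)) h
    simp only [add_zero] at this
    rw [← this]
    rfl
  have h2 : ∀ k, ∀ n, (fwdDiff 1)^[k] (fun n => f (n + h) - f n) n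
      = (fwdDiff 1)^[k] f (n + h) - (fwdDiff 1)^[k] f n := by
    intro k
    induction k with
    | zero => intro n; rfl
    | succ k ih =>
      intro n
      rw [Function.iterate_succ_apply', Function.iterate_succ_apply']
      simp only [fwdDiff]
      rw [ih, ih, add_right_comm]
      ring
  rw [h2, h1]
  simp only [Function.iterate_succ_apply']

lemma sum_rpow_neg_le (κ : ℝ) (hκ : κ ≤ 1 / 2) (H : ℕ) :
    ∑ h ∈ range H, ((h + 1 : ℕ) : ℝ) ^ (-κ) ≤ 2 * (H:ℝ) ^ (1 - κ) := by
  rcases Nat.eq_zero_or_pos H with rfl | hH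
  · simp; positivity
  have hs : ∀ H : ℕ, ∑ h ∈ range H, ((h + 1 : ℕ) : ℝ) ^ (-(1/2 : ℝ)) ≤ 2 * √H := by
    intro H
    induction H with
    | zero => simp
    | succ H ih =>
      rw [sum_range_succ, Real.rpow_neg (by positivity), ← Real.sqrt_eq_rpow]
      have h1 : 0 < √((H + 1 : ℕ):ℝ) := Real.sqrt_pos.2 (by positivity)
      have h2 : √(H:ℝ) * √(H:ℝ) = H := Real.mul_self_sqrt (by positivity)
      have h3 : √((H + 1 : ℕ):ℝ) * √((H + 1 : ℕ):ℝ) = H + 1 := by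
        rw [Real.mul_self_sqrt (by positivity)]; push_cast; ring
      have h0 : 0 ≤ √(H:ℝ) := Real.sqrt_nonneg _
      have : (√((H + 1 : ℕ):ℝ))⁻¹ ≤ 2 * (√((H + 1 : ℕ):ℝ) - √(H:ℝ)) := by
        rw [inv_le_iff_one_le_mul₀ h1]
        nlinarith [sq_nonneg (√((H + 1 : ℕ):ℝ) - √(H:ℝ))]
      linarith
  have hH' : (0:ℝ) < H := by exact_mod_cast hH
  calc ∑ h ∈ range H, ((h + 1 : ℕ) : ℝ) ^ (-κ)
      ≤ ∑ h ∈ range H, ((h + 1 : ℕ) : ℝ) ^ (-(1/2 : ℝ)) * (H:ℝ) ^ (1 / 2 - κ) := by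
        refine sum_le_sum fun h hh => ?_
        have e : ((h + 1 : ℕ) : ℝ) ^ (-κ)
            = ((h + 1 : ℕ) : ℝ) ^ (-(1/2 : ℝ)) * ((h + 1 : ℕ) : ℝ) ^ (1 / 2 - κ) := by
          rw [← Real.rpow_add (by positivity)]; ring_nf
        rw [e]
        have : h + 1 ≤ H := mem_range.1 hh
        gcongr
    _ = (∑ h ∈ range H, ((h + 1 : ℕ) : ℝ) ^ (-(1/2 : ℝ))) * (H:ℝ) ^ (1 / 2 - κ) := by
        rw [sum_mul]
    _ ≤ 2 * √H * (H:ℝ) ^ (1 / 2 - κ) := by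
        gcongr
        exact hs H
    _ = _ := by
        rw [Real.sqrt_eq_rpow, mul_assoc, ← Real.rpow_add hH']
        ring_nf

/-- The bound `L l^κ + L^ρ l^(-κ)` for exponential sums of length `L` whose phase has `k`-th
differences of order `l`. -/
def DiffTest (k : ℕ) (κ ρ : ℝ) : Prop :=
  ∀ α : ℝ, 1 ≤ α → ∃ C : ℝ, 0 < C ∧ ∀ l : ℝ, 0 < l → ∀ L : ℕ, ∀ f : ℕ → ℝ,
    (∀ n, n + k < L → l ≤ (fwdDiff 1)^[k] f n ∧ (fwdDiff 1)^[k] f n ≤ α * l) →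
    ‖∑ n ∈ range L, expTwoPi (f n)‖ ≤ C * (L * l ^ κ + (L:ℝ) ^ ρ * l ^ (-κ))

lemma diffTest_two : DiffTest 2 (1 / 2) 0 := by
  intro α hα
  refine ⟨20 * α, by positivity, fun l hl L f hf => ?_⟩
  have := norm_sum_expTwoPi_le_of_second_fwdDiff f L l α hl hα (fun n hn => (hf n hn).1)
    (fun n hn => (hf n hn).2)
  rw [Real.rpow_zero, one_mul, Real.rpow_neg hl.le, ← Real.sqrt_eq_rpow, ← one_div]
  exact this

lemma norm_sum_expTwoPi_le_card (f : ℕ → ℝ) (s : Finset ℕ) :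
    ‖∑ n ∈ s, expTwoPi (f n)‖ ≤ s.card := by
  refine (norm_sum_le _ _).trans ?_
  simp [norm_expTwoPi]

/-- One step of Weyl differencing. -/
lemma DiffTest.succ {k : ℕ} {κ ρ : ℝ} (hκ : 0 < κ) (hκ2 : κ ≤ 1 / 2) (hρ : 0 ≤ ρ)
    (h : DiffTest k κ ρ) : DiffTest (k + 1) (κ / (2 * (1 + κ))) ((1 + ρ) / 2) := by
  intro α hα
  obtain ⟨C, hC, hT⟩ := h α hα
  refine ⟨4 + 8 * C, by positivity, fun l hl L f hf => ?_⟩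
  set κ' := κ / (2 * (1 + κ)) with hκ'
  have hκ'0 : 0 < κ' := by positivity
  have htriv : ‖∑ n ∈ range L, expTwoPi (f n)‖ ≤ L := by
    simpa using norm_sum_expTwoPi_le_card f (range L)
  rcases Nat.eq_zero_or_pos L with rfl | hL
  · simp; positivity
  have hL1 : (1:ℝ) ≤ L := by exact_mod_cast hL
  have hL0 : (0:ℝ) < L := by linarith
  have hB0 : 0 < (L:ℝ) ^ ((1 + ρ) / 2) * l ^ (-κ') := by positivity
  have hA0 : 0 < (L:ℝ) * l ^ κ' := by positivity
  rcases le_or_gt 1 l with hl1 | hl1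
  · have : 1 ≤ l ^ κ' := Real.one_le_rpow hl1 hκ'0.le
    have : (L:ℝ) ≤ L * l ^ κ' := by nlinarith
    nlinarith [mul_pos hC hA0, mul_pos hC hB0]
  set H0 : ℝ := l ^ (-(2 * κ')) with hH0
  have hH01 : 1 ≤ H0 := Real.one_le_rpow_of_pos_of_le_one_of_nonpos hl hl1.le (by linarith)
  set H : ℕ := ⌈H0⌉₊ with hHdef
  have hHge : H0 ≤ H := Nat.le_ceil _
  have hHle : (H:ℝ) ≤ 2 * H0 := by
    have := Nat.ceil_lt_add_one (by linarith : 0 ≤ H0)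
    linarith
  have hHpos : 0 < H := by
    have : (0:ℝ) < H := by linarith
    exact_mod_cast this
  rcases lt_or_ge L H with hLH | hLH
  · have h1 : (L:ℝ) ≤ 2 * H0 := by
      have : (L:ℝ) ≤ H := by exact_mod_cast hLH.le
      linarith
    have h2 : (L:ℝ) ^ ((1:ℝ)/2) ≤ 2 * l ^ (-κ') := by
      have e : H0 ^ ((1:ℝ)/2) = l ^ (-κ') := by
        rw [hH0, ← Real.rpow_mul hl.le]; ring_nf
      calc (L:ℝ) ^ ((1:ℝ)/2) ≤ (2 * H0) ^ ((1:ℝ)/2) := by gcongr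
        _ = 2 ^ ((1:ℝ)/2) * l ^ (-κ') := by rw [Real.mul_rpow (by norm_num) (by linarith), e]
        _ ≤ 2 ^ (1:ℝ) * l ^ (-κ') := by
          gcongr
          · norm_num
          · norm_num
        _ = _ := by rw [Real.rpow_one]
    have h3 : (L:ℝ) ≤ 2 * ((L:ℝ) ^ ((1 + ρ) / 2) * l ^ (-κ')) := by
      calc (L:ℝ) = (L:ℝ) ^ ((1:ℝ)/2) * (L:ℝ) ^ ((1:ℝ)/2) := by
            rw [← Real.rpow_add hL0]; norm_num
        _ ≤ (L:ℝ) ^ ((1 + ρ) / 2) * (2 * l ^ (-κ')) := by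
            gcongr
            linarith
        _ = _ := by ring
    nlinarith [mul_pos hC hA0, mul_pos hC hB0]
  · have hW := sq_norm_sum_le_weyl (fun n => expTwoPi (f n)) L H hHpos hLH
    obtain ⟨K, hK⟩ : ∃ K, H = K + 1 := ⟨H - 1, by omega⟩
    set X := (H:ℝ) * (H * l) ^ κ with hX
    have hHr : (0:ℝ) < H := by exact_mod_cast hHpos
    have hin : ∑ h ∈ range H, ‖∑ n ∈ range (L - h), expTwoPi (f (n + h)) *
        (starRingEnd ℂ) (expTwoPi (f n))‖
        ≤ L + (C * (L * (H * (H * l) ^ κ)) + C * ((L:ℝ) ^ ρ * (2 * H * (H * l) ^ (-κ)))) := by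
      rw [hK, sum_range_succ', add_comm]
      refine add_le_add ?_ ?_
      · have e : ∑ n ∈ range (L - 0), expTwoPi (f (n + 0)) * (starRingEnd ℂ) (expTwoPi (f n))
            = ∑ n ∈ range L, 1 := by
          refine sum_congr (by simp) fun n _ => ?_
          rw [← expTwoPi_sub]; simp [expTwoPi_zero]
        rw [e]; simp
      · rw [← hK]
        have hb : ∀ h ∈ range K, ‖∑ n ∈ range (L - (h + 1)), expTwoPi (f (n + (h + 1))) *
            (starRingEnd ℂ) (expTwoPi (f n))‖ ≤ C * (L * (H * l) ^ κ) +
              C * ((L:ℝ) ^ ρ * l ^ (-κ)) * ((h + 1 : ℕ):ℝ) ^ (-κ) := by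
          intro h hh
          have hhK := mem_range.1 hh
          have hh0 : (0:ℝ) < ((h + 1 : ℕ):ℝ) := by positivity
          have hpos : 0 < ((h + 1 : ℕ):ℝ) * l := by positivity
          have := hT (((h + 1 : ℕ):ℝ) * l) hpos (L - (h + 1))
            (fun n => f (n + (h + 1)) - f n) (by
              intro n hn
              rw [fwdDiff_iter_shift_sub]
              have hj : ∀ j ∈ range (h + 1), l ≤ (fwdDiff 1)^[k + 1] f (n + j) ∧
                  (fwdDiff 1)^[k + 1] f (n + j) ≤ α * l := by
                intro j hj
                have := mem_range.1 hj
                exact hf (n + j) (by omega)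
              constructor
              · have := card_nsmul_le_sum (range (h + 1)) _ l (fun j hj' => (hj j hj').1)
                rw [card_range, nsmul_eq_mul] at this
                exact this
              · have := sum_le_card_nsmul (range (h + 1)) _ (α * l) (fun j hj' => (hj j hj').2)
                rw [card_range, nsmul_eq_mul] at this
                linarith)
          simp only [expTwoPi_sub] at this
          refine this.trans ?_
          have hle : ((L - (h + 1) : ℕ):ℝ) ≤ L := by exact_mod_cast Nat.sub_le _ _
          have hhH : ((h + 1 : ℕ):ℝ) ≤ H := by exact_mod_cast (by omega : h + 1 ≤ H)
          rw [mul_add]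
          refine add_le_add ?_ ?_
          · gcongr
          · rw [Real.mul_rpow hh0.le hl.le]
            calc C * (((L - (h + 1) : ℕ):ℝ) ^ ρ * (((h + 1 : ℕ):ℝ) ^ (-κ) * l ^ (-κ)))
                ≤ C * ((L:ℝ) ^ ρ * (((h + 1 : ℕ):ℝ) ^ (-κ) * l ^ (-κ))) := by gcongr
              _ = _ := by ring
        refine (sum_le_sum hb).trans ?_
        rw [sum_add_distrib, ← mul_sum (range K) (fun h => ((h + 1 : ℕ):ℝ) ^ (-κ))]
        refine add_le_add ?_ ?_
        · rw [sum_const, card_range, nsmul_eq_mul]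
          have hKH : (K:ℝ) ≤ H := by exact_mod_cast (by omega : K ≤ H)
          calc (K:ℝ) * (C * (L * (H * l) ^ κ)) ≤ H * (C * (L * (H * l) ^ κ)) := by gcongr
            _ = _ := by ring
        · have hs := sum_rpow_neg_le κ hκ2 K
          have hKH : (K:ℝ) ≤ H := by exact_mod_cast (by omega : K ≤ H)
          calc C * ((L:ℝ) ^ ρ * l ^ (-κ)) * ∑ h ∈ range K, ((h + 1 : ℕ):ℝ) ^ (-κ)
              ≤ C * ((L:ℝ) ^ ρ * l ^ (-κ)) * (2 * (K:ℝ) ^ (1 - κ)) := by gcongr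
            _ ≤ C * ((L:ℝ) ^ ρ * l ^ (-κ)) * (2 * (H:ℝ) ^ (1 - κ)) := by
                gcongr
                linarith
            _ = _ := by
                rw [Real.mul_rpow hHr.le hl.le (z := -κ), sub_eq_add_neg, Real.rpow_add hHr,
                  Real.rpow_one]
                ring
    have e1 : (H0 * l) ^ κ = l ^ (2 * κ') := by
      rw [hH0, ← Real.rpow_add_one hl.ne', ← Real.rpow_mul hl.le]
      congr 1
      rw [hκ']; field_simp; ring
    have e1' : (H0 * l) ^ (-κ) = l ^ (-(2 * κ')) := by
      rw [Real.rpow_neg (by positivity), e1, ← Real.rpow_neg hl.le]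
    have b1 : (H * l) ^ κ ≤ 2 * l ^ (2 * κ') := by
      calc (H * l) ^ κ ≤ (2 * (H0 * l)) ^ κ := by
            refine Real.rpow_le_rpow (by positivity) ?_ hκ.le
            nlinarith
        _ = 2 ^ κ * l ^ (2 * κ') := by rw [Real.mul_rpow (by norm_num) (by positivity), e1]
        _ ≤ 2 ^ (1:ℝ) * l ^ (2 * κ') := by
            gcongr
            · norm_num
            · linarith
        _ = _ := by rw [Real.rpow_one]
    have b2 : (H * l) ^ (-κ) ≤ l ^ (-(2 * κ')) := by
      rw [← e1']
      exact Real.rpow_le_rpow_of_nonpos (by positivity) (by gcongr) (by linarith)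
    have b3 : 1 / (H:ℝ) ≤ l ^ (2 * κ') := by
      rw [div_le_iff₀ hHr]
      have : l ^ (2 * κ') * H0 = 1 := by rw [hH0, ← Real.rpow_add hl]; simp
      have h0 : 0 < l ^ (2 * κ') := by positivity
      nlinarith
    have eA : (L * l ^ κ') ^ 2 = (L:ℝ) ^ 2 * l ^ (2 * κ') := by
      rw [mul_pow, ← Real.rpow_natCast (l ^ κ'), ← Real.rpow_mul hl.le]
      norm_num; left; ring_nf
    have eB : ((L:ℝ) ^ ((1 + ρ) / 2) * l ^ (-κ')) ^ 2 = L * (L:ℝ) ^ ρ * l ^ (-(2 * κ')) := by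
      rw [mul_pow, ← Real.rpow_natCast (l ^ (-κ')), ← Real.rpow_mul hl.le,
        ← Real.rpow_natCast ((L:ℝ) ^ ((1 + ρ) / 2)), ← Real.rpow_mul hL0.le,
        ← Real.rpow_one_add' hL0.le (by linarith)]
      congr 2
      · push_cast; ring
      · push_cast; ring
    generalize (L:ℝ) * l ^ κ' = A at *
    generalize (L:ℝ) ^ ((1 + ρ) / 2) * l ^ (-κ') = B at *
    have hfin : ‖∑ n ∈ range L, expTwoPi (f n)‖ ^ 2 ≤ ((4 + 8 * C) * (A + B)) ^ 2 := by
      calc ‖∑ n ∈ range L, expTwoPi (f n)‖ ^ 2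
          ≤ 4 * L / H * (L + (C * (L * (H * (H * l) ^ κ))
            + C * ((L:ℝ) ^ ρ * (2 * H * (H * l) ^ (-κ))))) := hW.trans (by gcongr)
        _ = 4 * L ^ 2 * (1 / H) + 4 * C * L ^ 2 * (H * l) ^ κ
            + 8 * C * (L * (L:ℝ) ^ ρ * (H * l) ^ (-κ)) := by field_simp; ring
        _ ≤ 4 * L ^ 2 * l ^ (2 * κ') + 4 * C * L ^ 2 * (2 * l ^ (2 * κ'))
            + 8 * C * (L * (L:ℝ) ^ ρ * l ^ (-(2 * κ'))) := by gcongr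
        _ = (4 + 8 * C) * A ^ 2 + 8 * C * B ^ 2 := by rw [eA, eB]; ring
        _ ≤ ((4 + 8 * C) * (A + B)) ^ 2 := by
            have hc : 1 ≤ 4 + 8 * C := by linarith
            have q : A ^ 2 + B ^ 2 ≤ (A + B) ^ 2 := by nlinarith [mul_pos hA0 hB0]
            have hc2 : 4 + 8 * C ≤ (4 + 8 * C) ^ 2 := le_self_pow₀ hc two_ne_zero
            have q1 : (4 + 8 * C) * A ^ 2 + 8 * C * B ^ 2 ≤ (4 + 8 * C) * (A ^ 2 + B ^ 2) := by
              linarith [sq_nonneg B]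
            have q2 : (4 + 8 * C) * (A ^ 2 + B ^ 2) ≤ (4 + 8 * C) * (A + B) ^ 2 :=
              mul_le_mul_of_nonneg_left q (by linarith)
            have q3 : (4 + 8 * C) * (A + B) ^ 2 ≤ (4 + 8 * C) ^ 2 * (A + B) ^ 2 :=
              mul_le_mul_of_nonneg_right hc2 (sq_nonneg _)
            rw [mul_pow]
            linarith
    exact le_of_sq_le_sq hfin (by positivity)

/-- Van der Corput's fifth derivative test, for sequences. -/
lemma diffTest_five : DiffTest 5 (1 / 30) (7 / 8) := by
  have h3 := diffTest_two.succ (by norm_num) (by norm_num) (by norm_num)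
  have h4 := h3.succ (by norm_num) (by norm_num) (by norm_num)
  have h5 := h4.succ (by norm_num) (by norm_num) (by norm_num)
  norm_num at h5
  norm_num
  exact h5

lemma fwdDiff_iter_mem_Icc (k : ℕ) : ∀ (F : ℕ → ℝ → ℝ) (a b l u c : ℝ),
    (∀ i < k, ∀ t ∈ Set.Icc a b, HasDerivAt (F i) (F (i + 1) t) t) →
    (∀ t ∈ Set.Icc a b, F k t ∈ Set.Icc l u) → ∀ n : ℕ, a ≤ c + n → c + n + k ≤ b →
    (fwdDiff 1)^[k] (fun n : ℕ => F 0 (c + n)) n ∈ Set.Icc l u := by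
  induction k with
  | zero =>
    intro F a b l u c _ h2 n hn hn2
    exact h2 _ ⟨hn, by simpa using hn2⟩
  | succ k ih =>
    intro F a b l u c h1 h2 n hn hn2
    push_cast at hn2
    rw [Function.iterate_succ_apply]
    have := ih (fun i t => F i (t + 1) - F i t) a (b - 1) l u c ?_ ?_ n hn (by linarith)
    · convert this using 2
      funext m
      simp [fwdDiff, add_assoc]
    · intro i hi t ht
      refine HasDerivAt.sub ?_ (h1 i (by omega) t ⟨ht.1, by linarith [ht.2]⟩)
      exact HasDerivAt.comp_add_const t 1
        (h1 i (by omega) (t + 1) ⟨by linarith [ht.1], by linarith [ht.2]⟩)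
    · intro t ht
      obtain ⟨ξ, hξ, he⟩ := exists_hasDerivAt_eq_slope (F k) (F (k + 1)) (by linarith : t < t + 1)
        (fun v hv => (h1 k (by omega) v ⟨by linarith [ht.1, hv.1],
          by linarith [ht.2, hv.2]⟩).continuousAt.continuousWithinAt)
        (fun v hv => h1 k (by omega) v ⟨by linarith [ht.1, hv.1], by linarith [ht.2, hv.2]⟩)
      have : F k (t + 1) - F k t = F (k + 1) ξ := by rw [he]; simp
      change F k (t + 1) - F k t ∈ _
      rw [this]
      exact h2 ξ ⟨by linarith [ht.1, hξ.1], by linarith [ht.2, hξ.2]⟩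

lemma exists_norm_sum_expTwoPi_sqrt_block_le : ∃ C : ℝ, 0 < C ∧ ∀ y : ℝ, 0 < y → ∀ θ : ℝ, 0 ≤ θ →
    θ < 1 → ∀ P L : ℕ, 1 ≤ P → L ≤ P →
    ‖∑ n ∈ range L, expTwoPi (2 * √(y * (P + θ + n)))‖
      ≤ C * ((P:ℝ) ^ ((17:ℝ)/20) * y ^ ((1:ℝ)/60) + (P:ℝ) ^ ((41:ℝ)/40) * y ^ (-(1:ℝ)/60)) := by
  obtain ⟨C, hC, hT⟩ := diffTest_five 32 (by norm_num)
  set c : ℝ := 105 / 16 * 2 ^ (-(9:ℝ)/2) with hc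
  have hc0 : 0 < c := by positivity
  refine ⟨C * (c ^ ((1:ℝ)/30) + c ^ (-((1:ℝ)/30))), by positivity,
    fun y hy θ hθ0 hθ1 P L hP hLP => ?_⟩
  have hP0 : (0:ℝ) < P := by exact_mod_cast hP
  have hLP' : (L:ℝ) ≤ P := by exact_mod_cast hLP
  set l : ℝ := c * √y * (P:ℝ) ^ (-(9:ℝ)/2) with hl
  have hl0 : 0 < l := by positivity
  set F : ℕ → ℝ → ℝ := fun i t => 2 * √y * (∏ j ∈ range i, ((1:ℝ)/2 - j)) * t ^ ((1:ℝ)/2 - i) with hF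
  have hF5 : ∀ t, F 5 t = 105 / 16 * √y * t ^ (-(9:ℝ)/2) := by
    intro t
    simp only [hF]
    rw [show (1:ℝ)/2 - ((5:ℕ):ℝ) = -(9:ℝ)/2 by norm_num,
      show ∏ j ∈ range 5, ((1:ℝ)/2 - j) = 105/32 by norm_num [prod_range_succ]]
    ring
  have e2 : l = 105 / 16 * √y * (2 * P : ℝ) ^ (-(9:ℝ)/2) := by
    rw [hl, hc, Real.mul_rpow (by norm_num) hP0.le]; ring
  have e3 : (P:ℝ) ^ (-(9:ℝ)/2) ≤ 32 * (2 * P : ℝ) ^ (-(9:ℝ)/2) := by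
    rw [Real.mul_rpow (by norm_num) hP0.le]
    have : (32:ℝ) * 2 ^ (-(9:ℝ)/2) = 2 ^ ((1:ℝ)/2) := by
      rw [show (32:ℝ) = 2 ^ (5:ℝ) by norm_num, ← Real.rpow_add (by norm_num)]
      norm_num
    rw [← mul_assoc, this]
    have : (1:ℝ) ≤ 2 ^ ((1:ℝ)/2) := Real.one_le_rpow (by norm_num) (by norm_num)
    have h0 : 0 < (P:ℝ) ^ (-(9:ℝ)/2) := by positivity
    nlinarith
  have hD : ∀ n, n + 5 < L → l ≤ (fwdDiff 1)^[5] (fun n : ℕ => F 0 (P + θ + n)) n ∧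
      (fwdDiff 1)^[5] (fun n : ℕ => F 0 (P + θ + n)) n ≤ 32 * l := by
    intro n hn
    have hn' : (n:ℝ) + 5 + 1 ≤ L := by exact_mod_cast hn
    refine fwdDiff_iter_mem_Icc 5 F P (2 * P) l (32 * l) (P + θ) ?_ ?_ n ?_ ?_
    · intro i _ t ht
      have ht0 : 0 < t := lt_of_lt_of_le hP0 ht.1
      have := (Real.hasDerivAt_rpow_const (x := t) (p := (1:ℝ)/2 - i) (Or.inl ht0.ne')).const_mul
        (2 * √y * (∏ j ∈ range i, ((1:ℝ)/2 - j)))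
      have e : F (i + 1) t = 2 * √y * (∏ j ∈ range i, ((1:ℝ)/2 - j)) *
          (((1:ℝ)/2 - i) * t ^ ((1:ℝ)/2 - i - 1)) := by
        simp only [hF, prod_range_succ]
        push_cast
        rw [show (1:ℝ)/2 - (i + 1) = 1/2 - i - 1 by ring]
        ring
      rw [e]
      exact this
    · intro t ht
      have ht0 : 0 < t := lt_of_lt_of_le hP0 ht.1
      rw [hF5, e2]
      have h1 : (2 * P : ℝ) ^ (-(9:ℝ)/2) ≤ t ^ (-(9:ℝ)/2) :=
        Real.rpow_le_rpow_of_nonpos ht0 ht.2 (by norm_num)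
      have h2 : t ^ (-(9:ℝ)/2) ≤ (P : ℝ) ^ (-(9:ℝ)/2) :=
        Real.rpow_le_rpow_of_nonpos hP0 ht.1 (by norm_num)
      have hy' : 0 ≤ 105 / 16 * √y := by positivity
      constructor
      · exact mul_le_mul_of_nonneg_left h1 hy'
      · have := mul_le_mul_of_nonneg_left (h2.trans e3) hy'
        linarith
    · have : (0:ℝ) ≤ n := Nat.cast_nonneg n
      linarith
    · push_cast
      linarith
  have hS := hT l hl0 L (fun n : ℕ => F 0 (P + θ + n)) hD
  have e0 : ∀ n : ℕ, F 0 (P + θ + n) = 2 * √(y * (P + θ + n)) := by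
    intro n
    simp only [hF, prod_range_zero]
    rw [Real.sqrt_mul hy.le, Real.sqrt_eq_rpow (P + θ + n)]
    norm_num
    ring
  simp only [e0] at hS
  refine hS.trans ?_
  have hl1 : l ^ ((1:ℝ)/30) = c ^ ((1:ℝ)/30) * (y ^ ((1:ℝ)/60) * (P:ℝ) ^ (-(3:ℝ)/20)) := by
    rw [hl, Real.sqrt_eq_rpow, Real.mul_rpow (by positivity) (by positivity),
      Real.mul_rpow (by positivity) (by positivity), ← Real.rpow_mul hy.le,
      ← Real.rpow_mul hP0.le]
    norm_num [mul_assoc]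
  have hl2 : l ^ (-((1:ℝ)/30)) = c ^ (-((1:ℝ)/30)) * (y ^ (-(1:ℝ)/60) * (P:ℝ) ^ ((3:ℝ)/20)) := by
    rw [hl, Real.sqrt_eq_rpow, Real.mul_rpow (by positivity) (by positivity),
      Real.mul_rpow (by positivity) (by positivity), ← Real.rpow_mul hy.le,
      ← Real.rpow_mul hP0.le]
    norm_num [mul_assoc]
  have p1 : (P:ℝ) * (P:ℝ) ^ (-(3:ℝ)/20) = (P:ℝ) ^ ((17:ℝ)/20) := by
    rw [← Real.rpow_one_add' hP0.le (by norm_num)]; norm_num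
  have p2 : (P:ℝ) ^ ((7:ℝ)/8) * (P:ℝ) ^ ((3:ℝ)/20) = (P:ℝ) ^ ((41:ℝ)/40) := by
    rw [← Real.rpow_add hP0]; norm_num
  have hc1 : 0 < c ^ ((1:ℝ)/30) := by positivity
  have hc2 : 0 < c ^ (-((1:ℝ)/30)) := by positivity
  calc C * (L * l ^ ((1:ℝ)/30) + (L:ℝ) ^ ((7:ℝ)/8) * l ^ (-((1:ℝ)/30)))
      ≤ C * (P * l ^ ((1:ℝ)/30) + (P:ℝ) ^ ((7:ℝ)/8) * l ^ (-((1:ℝ)/30))) := by gcongr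
    _ = C * (c ^ ((1:ℝ)/30) * ((P * (P:ℝ) ^ (-(3:ℝ)/20)) * y ^ ((1:ℝ)/60)) +
        c ^ (-((1:ℝ)/30)) * (((P:ℝ) ^ ((7:ℝ)/8) * (P:ℝ) ^ ((3:ℝ)/20)) * y ^ (-(1:ℝ)/60))) := by
        rw [hl1, hl2]; ring
    _ = C * (c ^ ((1:ℝ)/30) * ((P:ℝ) ^ ((17:ℝ)/20) * y ^ ((1:ℝ)/60)) +
        c ^ (-((1:ℝ)/30)) * ((P:ℝ) ^ ((41:ℝ)/40) * y ^ (-(1:ℝ)/60))) := by rw [p1, p2]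
    _ ≤ _ := by
        have a1 : 0 < (P:ℝ) ^ ((17:ℝ)/20) * y ^ ((1:ℝ)/60) := by positivity
        have a2 : 0 < (P:ℝ) ^ ((41:ℝ)/40) * y ^ (-(1:ℝ)/60) := by positivity
        rw [mul_assoc]
        refine mul_le_mul_of_nonneg_left ?_ hC.le
        nlinarith [mul_pos hc1 a2, mul_pos hc2 a1]

lemma exists_norm_sum_expTwoPi_sqrt_le : ∃ C : ℝ, 0 < C ∧ ∀ y : ℝ, 0 < y → ∀ θ : ℝ, 0 ≤ θ →
    θ < 1 → ∀ m : ℕ, ‖∑ n ∈ range m, expTwoPi (2 * √(y * (n + 1 + θ)))‖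
      ≤ C * ((m:ℝ) ^ ((17:ℝ)/20) * y ^ ((1:ℝ)/60) + (m:ℝ) ^ ((41:ℝ)/40) * y ^ (-(1:ℝ)/60)) := by
  obtain ⟨C, hC, h⟩ := exists_norm_sum_expTwoPi_sqrt_block_le
  refine ⟨3 * C, by positivity, fun y hy θ h0 h1 m => ?_⟩
  have hhalf : ∀ e : ℝ, 17 / 20 ≤ e → ((1:ℝ)/2) ^ e ≤ 3 / 5 := by
    intro e he
    calc ((1:ℝ)/2) ^ e ≤ ((1:ℝ)/2) ^ ((3:ℝ)/4) :=
          Real.rpow_le_rpow_of_exponent_ge (by norm_num) (by norm_num) (by linarith)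
      _ = (((1:ℝ)/2) ^ (3:ℝ)) ^ ((1:ℝ)/4) := by rw [← Real.rpow_mul (by norm_num)]; norm_num
      _ ≤ (((3:ℝ)/5) ^ (4:ℝ)) ^ ((1:ℝ)/4) := by
          refine Real.rpow_le_rpow (by positivity) ?_ (by norm_num)
          norm_num
      _ = 3 / 5 := by rw [← Real.rpow_mul (by norm_num)]; norm_num
  induction m using Nat.strong_induction_on with
  | _ m ih =>
    rcases Nat.eq_zero_or_pos m with rfl | hm
    · simp
    have hm0 : (0:ℝ) < m := by exact_mod_cast hm
    have hsplit : ∑ n ∈ range m, expTwoPi (2 * √(y * (n + 1 + θ)))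
        = ∑ n ∈ range (m / 2), expTwoPi (2 * √(y * (n + 1 + θ))) +
          ∑ n ∈ range (m - m / 2), expTwoPi (2 * √(y * ((m / 2 + 1 : ℕ) + θ + n))) := by
      conv_lhs => rw [show m = m / 2 + (m - m / 2) by omega, sum_range_add]
      congr 1
      refine sum_congr rfl fun n _ => ?_
      congr 4
      push_cast
      ring
    rw [hsplit]
    refine (norm_add_le _ _).trans ?_
    have b1 := ih (m / 2) (by omega)
    have b2 := h y hy θ h0 h1 (m / 2 + 1) (m - m / 2) (by omega) (by omega)
    have hle : ((m / 2 : ℕ):ℝ) ≤ 1 / 2 * m := by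
      have := @Nat.cast_div_le ℝ _ _ _ m 2
      push_cast at this; linarith
    have hle2 : ((m / 2 + 1 : ℕ):ℝ) ≤ m := by
      exact_mod_cast (by omega : m / 2 + 1 ≤ m)
    have q1 : ∀ e : ℝ, 17 / 20 ≤ e → ((m / 2 : ℕ):ℝ) ^ e ≤ 3 / 5 * (m:ℝ) ^ e := by
      intro e he
      calc ((m / 2 : ℕ):ℝ) ^ e ≤ (1 / 2 * m : ℝ) ^ e :=
            Real.rpow_le_rpow (by positivity) hle (by linarith)
        _ = (1 / 2 : ℝ) ^ e * (m:ℝ) ^ e := Real.mul_rpow (by norm_num) hm0.le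
        _ ≤ _ := mul_le_mul_of_nonneg_right (hhalf e he) (by positivity)
    have c1 : ((m / 2 : ℕ):ℝ) ^ ((17:ℝ)/20) * y ^ ((1:ℝ)/60)
        ≤ 3 / 5 * ((m:ℝ) ^ ((17:ℝ)/20) * y ^ ((1:ℝ)/60)) := by
      rw [← mul_assoc]
      exact mul_le_mul_of_nonneg_right (q1 _ le_rfl) (by positivity)
    have c2 : ((m / 2 : ℕ):ℝ) ^ ((41:ℝ)/40) * y ^ (-(1:ℝ)/60)
        ≤ 3 / 5 * ((m:ℝ) ^ ((41:ℝ)/40) * y ^ (-(1:ℝ)/60)) := by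
      rw [← mul_assoc]
      exact mul_le_mul_of_nonneg_right (q1 _ (by norm_num)) (by positivity)
    have d1 : ((m / 2 + 1 : ℕ):ℝ) ^ ((17:ℝ)/20) * y ^ ((1:ℝ)/60)
        ≤ (m:ℝ) ^ ((17:ℝ)/20) * y ^ ((1:ℝ)/60) := by gcongr
    have d2 : ((m / 2 + 1 : ℕ):ℝ) ^ ((41:ℝ)/40) * y ^ (-(1:ℝ)/60)
        ≤ (m:ℝ) ^ ((41:ℝ)/40) * y ^ (-(1:ℝ)/60) := by gcongr
    have a1 : 0 < (m:ℝ) ^ ((17:ℝ)/20) * y ^ ((1:ℝ)/60) := by positivity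
    have a2 : 0 < (m:ℝ) ^ ((41:ℝ)/40) * y ^ (-(1:ℝ)/60) := by positivity
    have b1' := b1.trans (mul_le_mul_of_nonneg_left (add_le_add c1 c2) (by positivity))
    have b2' := b2.trans (mul_le_mul_of_nonneg_left (add_le_add d1 d2) hC.le)
    nlinarith [mul_pos hC a1, mul_pos hC a2]

lemma integrableOn_inv_sqrt_mul_exp_neg {b : ℝ} (hb : 0 < b) :
    MeasureTheory.IntegrableOn (fun u : ℝ => 1 / √u * Real.exp (-b * u)) (Set.Ioi 0) := by
  have := integrableOn_rpow_mul_exp_neg_mul_rpow (p := 1) (s := -(1:ℝ)/2) (by norm_num) one_pos hb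
  refine this.congr_fun (fun u hu => ?_) measurableSet_Ioi
  have hu0 : (0:ℝ) < u := hu
  simp only [Real.rpow_one]
  rw [neg_div, Real.rpow_neg hu0.le, Real.sqrt_eq_rpow, one_div (u ^ _)]

lemma integrableOn_inv_sqrt_mul_exp {a b : ℝ} (ha : 0 < a) (hb : 0 < b) :
    MeasureTheory.IntegrableOn (fun u : ℝ => 1 / √u * Real.exp (-a / u - b * u)) (Set.Ioi 0) := by
  refine (integrableOn_inv_sqrt_mul_exp_neg hb).mono' (by fun_prop) ?_
  refine (MeasureTheory.ae_restrict_iff' measurableSet_Ioi).2 (Filter.Eventually.of_forall ?_)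
  intro u hu
  have hu0 : (0:ℝ) < u := hu
  rw [Real.norm_of_nonneg (by positivity)]
  refine mul_le_mul_of_nonneg_left (Real.exp_le_exp.2 ?_) (by positivity)
  have : 0 < a / u := by positivity
  rw [neg_div]
  linarith

lemma integral_inv_sqrt_mul_exp {a b : ℝ} (ha : 0 < a) (hb : 0 < b) :
    ∫ u in Set.Ioi (0:ℝ), 1 / √u * Real.exp (-a / u - b * u)
      = √Real.pi / √b * Real.exp (-2 * (√a * √b)) := by
  have hA : 0 < √a := Real.sqrt_pos.2 ha
  have hB : 0 < √b := Real.sqrt_pos.2 hb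
  set A := √a
  set B := √b
  have hA2 : A * A = a := Real.mul_self_sqrt ha.le
  have hB2 : B * B = b := Real.mul_self_sqrt hb.le
  set E : ℝ → ℝ := fun u => Real.exp (-a / u - b * u) with hE
  set W : ℝ → ℝ := fun u => B * √u - A / √u with hW
  set W' : ℝ → ℝ := fun u => B / (2 * √u) + A / (2 * (u * √u)) with hW'
  have hder : ∀ u ∈ Set.Ioi (0:ℝ), HasDerivWithinAt W (W' u) (Set.Ioi 0) u := by
    intro u hu
    have hu0 : (0:ℝ) < u := hu
    have hs : 0 < √u := Real.sqrt_pos.2 hu0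
    have h1 := Real.hasDerivAt_sqrt hu0.ne'
    have h2 := (h1.const_mul B).sub ((hasDerivAt_const u A).div h1 hs.ne')
    have e : W' u = B * (1 / (2 * √u)) - (0 * √u - A * (1 / (2 * √u))) / √u ^ 2 := by
      simp only [hW']
      rw [Real.sq_sqrt hu0.le]
      field_simp
      ring
    rw [e]
    exact h2.hasDerivWithinAt
  have hpos : ∀ u ∈ Set.Ioi (0:ℝ), 0 < W' u := by
    intro u hu
    have hu0 : (0:ℝ) < u := hu
    have hs : 0 < √u := Real.sqrt_pos.2 hu0
    simp only [hW']
    positivity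
  have hinj : Set.InjOn W (Set.Ioi 0) := by
    refine StrictMonoOn.injOn fun u hu v hv huv => ?_
    have hu0 : (0:ℝ) < u := hu
    have hs : 0 < √u := Real.sqrt_pos.2 hu0
    have hs2 : √u < √v := Real.sqrt_lt_sqrt hu0.le huv
    simp only [hW]
    have h1 : B * √u < B * √v := mul_lt_mul_of_pos_left hs2 hB
    have h2 : A / √v < A / √u := div_lt_div_of_pos_left hA hs hs2
    linarith
  have himg : W '' Set.Ioi 0 = Set.univ := by
    refine Set.eq_univ_of_forall fun w => ?_
    set D := √(w ^ 2 + 4 * A * B)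
    have hD2 : D * D = w ^ 2 + 4 * A * B := Real.mul_self_sqrt (by positivity)
    have hD0 : 0 ≤ D := Real.sqrt_nonneg _
    have hAB : 0 < A * B := by positivity
    have hD : 0 < w + D := by
      by_contra! h
      nlinarith
    set s := (w + D) / (2 * B) with hs
    have hs0 : 0 < s := by positivity
    refine ⟨s ^ 2, by simp only [Set.mem_Ioi]; positivity, ?_⟩
    simp only [hW]
    rw [Real.sqrt_sq hs0.le, sub_eq_iff_eq_add, ← mul_right_inj' hs0.ne']
    have : s * (w + A / s) = s * w + A := by field_simp
    rw [this, hs]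
    field_simp
    nlinarith
  have hexp : ∀ u ∈ Set.Ioi (0:ℝ), Real.exp (-1 * W u ^ 2) = Real.exp (2 * (A * B)) * E u := by
    intro u hu
    have hu0 : (0:ℝ) < u := hu
    have hs : 0 < √u := Real.sqrt_pos.2 hu0
    have hs2 : √u * √u = u := Real.mul_self_sqrt hu0.le
    simp only [hE, hW]
    rw [← Real.exp_add]
    congr 1
    rw [← hA2, ← hB2]
    nth_rw 3 4 [← hs2]
    field_simp
    ring
  have h_integral := MeasureTheory.integral_image_eq_integral_abs_deriv_smul measurableSet_Ioi hder hinj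
    (fun w => Real.exp (-1 * w ^ 2))
  have h_integral_two := (MeasureTheory.integrableOn_image_iff_integrableOn_abs_deriv_smul measurableSet_Ioi
    hder hinj (fun w => Real.exp (-1 * w ^ 2))).1
  rw [himg] at h_integral h_integral_two
  have hI2 := h_integral_two (integrable_exp_neg_mul_sq one_pos).integrableOn
  rw [MeasureTheory.setIntegral_univ, integral_gaussian, div_one] at h_integral
  set c : ℝ := Real.exp (2 * (A * B)) with hc
  have hc0 : 0 < c := Real.exp_pos _
  have hIE : MeasureTheory.IntegrableOn (fun u => 1 / √u * E u) (Set.Ioi 0) :=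
    integrableOn_inv_sqrt_mul_exp ha hb
  have hsum : Set.EqOn (fun u => |W' u| • Real.exp (-1 * W u ^ 2))
      (fun u => c * (B / 2) * (1 / √u * E u) + c * (A / 2) * (1 / (u * √u) * E u)) (Set.Ioi 0) := by
    intro u hu
    have hu0 : (0:ℝ) < u := hu
    have hs : 0 < √u := Real.sqrt_pos.2 hu0
    simp only [smul_eq_mul]
    rw [abs_of_pos (hpos u hu), hexp u hu]
    simp only [hW']
    field_simp
  have hI3 := hI2.congr_fun hsum measurableSet_Ioi
  rw [MeasureTheory.setIntegral_congr_fun measurableSet_Ioi hsum] at h_integral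
  have hIE' := hIE.const_mul (c * (B / 2))
  have hI4 : MeasureTheory.IntegrableOn (fun u => c * (A / 2) * (1 / (u * √u) * E u))
      (Set.Ioi 0) := by
    refine (hI3.sub hIE').congr (Filter.Eventually.of_forall fun u => ?_)
    simp
  have hrefl : ∫ u in Set.Ioi (0:ℝ), 1 / (u * √u) * E u = B / A * ∫ u in Set.Ioi (0:ℝ), 1 / √u * E u := by
    set k := a / b with hk
    have hk0 : 0 < k := by positivity
    have hd : ∀ u ∈ Set.Ioi (0:ℝ), HasDerivWithinAt (fun u => k / u) (-(k / u ^ 2)) (Set.Ioi 0) u := by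
      intro u hu
      have hu0 : (0:ℝ) < u := hu
      have := (hasDerivAt_const u k).div (hasDerivAt_id u) hu0.ne'
      refine HasDerivAt.hasDerivWithinAt ?_
      have e : -(k / u ^ 2) = (0 * id u - k * 1) / id u ^ 2 := by
        simp only [id]
        ring
      rw [e]
      exact this
    have hi : Set.InjOn (fun u => k / u) (Set.Ioi (0:ℝ)) := by
      intro u hu v hv h
      have hu0 : (0:ℝ) < u := hu
      have hv0 : (0:ℝ) < v := hv
      change k / u = k / v at h
      field_simp at h
      exact h.symm
    have him : (fun u => k / u) '' Set.Ioi (0:ℝ) = Set.Ioi 0 := by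
      ext v
      constructor
      · rintro ⟨u, hu, rfl⟩
        exact div_pos hk0 hu
      · intro hv
        have hv0 : (0:ℝ) < v := hv
        exact ⟨k / v, div_pos hk0 hv, by field_simp⟩
    have := MeasureTheory.integral_image_eq_integral_abs_deriv_smul measurableSet_Ioi hd hi
      (fun u => 1 / (u * √u) * E u)
    rw [him] at this
    rw [this, ← MeasureTheory.integral_const_mul]
    refine MeasureTheory.setIntegral_congr_fun measurableSet_Ioi fun u hu => ?_
    have hu0 : (0:ℝ) < u := hu
    have hs : 0 < √u := Real.sqrt_pos.2 hu0
    have hkk : √k = A / B := Real.sqrt_div ha.le b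
    simp only [smul_eq_mul, hE]
    rw [abs_neg, abs_of_pos (by positivity), Real.sqrt_div hk0.le, hkk]
    have : -a / (k / u) - b * (k / u) = -a / u - b * u := by
      rw [hk]
      field_simp
      ring
    rw [this, ← mul_assoc, ← mul_assoc]
    congr 1
    have hs2 : √u ^ 2 = u := Real.sq_sqrt hu0.le
    field_simp
    exact hs2
  rw [MeasureTheory.integral_add hIE' hI4, MeasureTheory.integral_const_mul,
    MeasureTheory.integral_const_mul, hrefl] at h_integral
  set J := ∫ u in Set.Ioi (0:ℝ), 1 / √u * E u
  have : √Real.pi = c * B * J := by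
    rw [h_integral]
    field_simp
    ring
  rw [this, hc, show -2 * (A * B) = -(2 * (A * B)) by ring, Real.exp_neg]
  field_simp

lemma integral_inv_sqrt_mul_cexp {α β : ℝ} (hα : 0 < α) (hβ : 0 < β) (p q : ℝ) :
    ∫ u in Set.Ioi (0:ℝ), ((1 / √u : ℝ) : ℂ) * Complex.exp (-(α + p * I) / u - (β + q * I) * u)
      = √Real.pi / (β + q * I) ^ ((1:ℂ)/2) *
        Complex.exp (-2 * ((α + p * I) ^ ((1:ℂ)/2) * (β + q * I) ^ ((1:ℂ)/2))) := by
  set d : ℝ → ℝ := fun u => 1 / √u * Real.exp (-α / u - β * u) with hd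
  have hd0 : ∀ u, 0 ≤ d u := fun u => by simp only [hd]; positivity
  have hdm : Measurable d := by simp only [hd]; fun_prop
  set μ : MeasureTheory.Measure ℝ :=
    (MeasureTheory.volume.restrict (Set.Ioi 0)).withDensity (fun u => ENNReal.ofReal (d u)) with hμ
  set X : ℝ → ℝ := fun u => -(p / u) - q * u with hX
  obtain ⟨η, hη0, hηα, hηβ⟩ : ∃ η : ℝ, 0 < η ∧ η * |p| < α ∧ η * |q| < β := by
    refine ⟨min (α / (|p| + 1)) (β / (|q| + 1)), by positivity, ?_, ?_⟩
    · have h1 : min (α / (|p| + 1)) (β / (|q| + 1)) ≤ α / (|p| + 1) := min_le_left _ _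
      have h2 := mul_le_mul_of_nonneg_right h1 (abs_nonneg p)
      refine h2.trans_lt ?_
      rw [div_mul_eq_mul_div, div_lt_iff₀ (by positivity)]
      nlinarith [abs_nonneg p]
    · have h1 : min (α / (|p| + 1)) (β / (|q| + 1)) ≤ β / (|q| + 1) := min_le_right _ _
      have h2 := mul_le_mul_of_nonneg_right h1 (abs_nonneg q)
      refine h2.trans_lt ?_
      rw [div_mul_eq_mul_div, div_lt_iff₀ (by positivity)]
      nlinarith [abs_nonneg q]
  have hre : ∀ t : ℝ, |t| < η → 0 < α + p * t ∧ 0 < β + q * t := by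
    intro t ht
    have h1 : |p * t| ≤ η * |p| := by
      rw [abs_mul, mul_comm]
      exact mul_le_mul_of_nonneg_right ht.le (abs_nonneg p)
    have h2 : |q * t| ≤ η * |q| := by
      rw [abs_mul, mul_comm]
      exact mul_le_mul_of_nonneg_right ht.le (abs_nonneg q)
    constructor
    · linarith [neg_abs_le (p * t)]
    · linarith [neg_abs_le (q * t)]
  set U : Set ℂ := {z : ℂ | |z.re| < η} with hU
  have hprod : ∀ t u : ℝ, d u * Real.exp (t * X u)
      = 1 / √u * Real.exp (-(α + p * t) / u - (β + q * t) * u) := by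
    intro t u
    simp only [hd, hX]
    rw [mul_assoc, ← Real.exp_add]
    congr 2
    ring
  have hset : ∀ t : ℝ, |t| < η → t ∈ ProbabilityTheory.integrableExpSet X μ := by
    intro t ht
    obtain ⟨h1, h2⟩ := hre t ht
    change MeasureTheory.Integrable (fun u => Real.exp (t * X u)) μ
    rw [hμ, MeasureTheory.integrable_withDensity_iff_integrable_smul' (by fun_prop) (by simp)]
    refine (integrableOn_inv_sqrt_mul_exp h1 h2).congr (Filter.Eventually.of_forall fun u => ?_)
    simp only [smul_eq_mul]
    rw [ENNReal.toReal_ofReal (hd0 u), hprod]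
  have h_integral : ∀ z : ℂ, ProbabilityTheory.complexMGF X μ z = ∫ u in Set.Ioi (0:ℝ),
      ((1 / √u : ℝ) : ℂ) * Complex.exp (-(α + p * z) / u - (β + q * z) * u) := by
    intro z
    rw [ProbabilityTheory.complexMGF, hμ, integral_withDensity_eq_integral_toReal_smul
      (by fun_prop) (by simp)]
    refine MeasureTheory.integral_congr_ae (Filter.Eventually.of_forall fun u => ?_)
    simp only
    rw [ENNReal.toReal_ofReal (hd0 u), Complex.real_smul]
    simp only [hd, hX]
    push_cast
    rw [mul_assoc, ← Complex.exp_add]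
    congr 2
    ring
  set R : ℂ → ℂ := fun z => √Real.pi / (β + q * z) ^ ((1:ℂ)/2) *
        Complex.exp (-2 * ((α + p * z) ^ ((1:ℂ)/2) * (β + q * z) ^ ((1:ℂ)/2))) with hR
  have hopen : IsOpen U := isOpen_lt (by fun_prop) continuous_const
  have hconn : IsPreconnected U := by
    have : Convex ℝ U := by
      have : U = Complex.reLm ⁻¹' (Set.Ioo (-η) η) := by
        ext z
        simp [hU, abs_lt]
      rw [this]
      exact (convex_Ioo _ _).linear_preimage _
    exact this.isPreconnected
  have hA1 : AnalyticOnNhd ℂ (ProbabilityTheory.complexMGF X μ) U := by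
    refine ProbabilityTheory.analyticOnNhd_complexMGF.mono fun z hz => ?_
    have : Set.Ioo (-η) η ⊆ ProbabilityTheory.integrableExpSet X μ :=
      fun t ht => hset t (abs_lt.2 ht)
    exact interior_maximal this isOpen_Ioo (abs_lt.1 hz)
  have hslit : ∀ z ∈ U, (α + p * z : ℂ) ∈ Complex.slitPlane ∧ (β + q * z : ℂ) ∈ Complex.slitPlane := by
    intro z hz
    obtain ⟨h1, h2⟩ := hre z.re hz
    refine ⟨Or.inl ?_, Or.inl ?_⟩
    · simpa using h1
    · simpa using h2
  have hA2 : AnalyticOnNhd ℂ R U := by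
    refine DifferentiableOn.analyticOnNhd (fun z hz => ?_) hopen
    obtain ⟨h1, h2⟩ := hslit z hz
    have e1 : DifferentiableAt ℂ (fun z : ℂ => (α + p * z : ℂ) ^ ((1:ℂ)/2)) z :=
      DifferentiableAt.cpow_const (by fun_prop) h1
    have e2 : DifferentiableAt ℂ (fun z : ℂ => (β + q * z : ℂ) ^ ((1:ℂ)/2)) z :=
      DifferentiableAt.cpow_const (by fun_prop) h2
    have e3 : (β + q * z : ℂ) ^ ((1:ℂ)/2) ≠ 0 := by
      rw [Complex.cpow_ne_zero_iff]
      exact Or.inl (Complex.slitPlane_ne_zero h2)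
    refine DifferentiableAt.differentiableWithinAt ?_
    exact ((differentiableAt_const _).div e2 e3).mul (((e1.mul e2).const_mul _).cexp)
  have hreal : ∀ t : ℝ, |t| < η → ProbabilityTheory.complexMGF X μ t = R t := by
    intro t ht
    obtain ⟨h1, h2⟩ := hre t ht
    rw [h_integral]
    have e := integral_inv_sqrt_mul_exp h1 h2
    have c1 : ∀ v : ℝ, 0 < v → ((v : ℂ)) ^ ((1:ℂ)/2) = ((√v : ℝ) : ℂ) := by
      intro v hv
      rw [Real.sqrt_eq_rpow, Complex.ofReal_cpow hv.le]
      norm_num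
    have e1 : (α + p * (t:ℂ) : ℂ) = ((α + p * t : ℝ) : ℂ) := by push_cast; ring
    have e2 : (β + q * (t:ℂ) : ℂ) = ((β + q * t : ℝ) : ℂ) := by push_cast; ring
    simp only [hR]
    rw [e1, e2, c1 _ h1, c1 _ h2]
    have := (integral_ofReal (𝕜 := ℂ) (μ := MeasureTheory.volume.restrict (Set.Ioi (0:ℝ)))
      (f := fun u => 1 / √u * Real.exp (-(α + p * t) / u - (β + q * t) * u))).trans
      (congrArg Complex.ofReal e)
    simp only [RCLike.ofReal_eq_complex_ofReal] at this
    push_cast at this ⊢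
    exact this
  have hfreq : ∃ᶠ z in nhdsWithin (0:ℂ) {0}ᶜ, ProbabilityTheory.complexMGF X μ z = R z := by
    have hten : Filter.Tendsto (fun n : ℕ => (((1:ℝ) / (n + 1) : ℝ) : ℂ)) Filter.atTop
        (nhdsWithin (0:ℂ) {0}ᶜ) := by
      refine tendsto_nhdsWithin_iff.2 ⟨?_, Filter.Eventually.of_forall fun n => ?_⟩
      · have := (Complex.continuous_ofReal.tendsto 0).comp
          (tendsto_one_div_add_atTop_nhds_zero_nat (𝕜 := ℝ))
        simpa [Function.comp_def] using this
      · have : ((1:ℝ) / (n + 1)) ≠ 0 := by positivity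
        simpa using (by exact_mod_cast this : (((1:ℝ) / (n + 1) : ℝ) : ℂ) ≠ 0)
    refine hten.frequently (Filter.Eventually.frequently ?_)
    have h0 := (tendsto_one_div_add_atTop_nhds_zero_nat (𝕜 := ℝ)).eventually (gt_mem_nhds hη0)
    filter_upwards [h0] with n hn
    refine hreal _ ?_
    rw [abs_of_pos (by positivity)]
    exact hn
  have h0U : (0:ℂ) ∈ U := by simp [hU, hη0]
  have hIU : I ∈ U := by simp [hU, hη0]
  have := hA1.eqOn_of_preconnected_of_frequently_eq hA2 hconn h0U hfreq hIU
  rw [h_integral] at this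
  exact this

lemma cpow_half_mul_self (c : ℂ) : c ^ ((1:ℂ)/2) * c ^ ((1:ℂ)/2) = c := by
  have := Complex.cpow_nat_inv_pow c (two_ne_zero)
  rw [pow_two] at this
  simpa using this

lemma norm_cpow_half (c : ℂ) : ‖c ^ ((1:ℂ)/2)‖ = √‖c‖ := by
  rw [← Real.sqrt_mul_self (norm_nonneg (c ^ ((1:ℂ)/2))), ← norm_mul, cpow_half_mul_self]

lemma abs_im_cpow_half_lt_re {c : ℂ} (hc : 0 < c.re) :
    |(c ^ ((1:ℂ)/2)).im| < (c ^ ((1:ℂ)/2)).re := by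
  have h0 : c ≠ 0 := by
    rintro rfl
    simp at hc
  have hre : 0 < (c ^ ((1:ℂ)/2)).re := by
    rw [Complex.cpow_def_of_ne_zero h0, Complex.exp_re]
    refine mul_pos (Real.exp_pos _) (Real.cos_pos_of_mem_Ioo ?_)
    have h1 := Complex.abs_arg_lt_pi_div_two_iff.2 (Or.inl hc)
    have h2 : (Complex.log c * (1 / 2)).im = Complex.arg c / 2 := by
      have : Complex.log c * (1 / 2) = ((1/2 : ℝ):ℂ) * Complex.log c := by push_cast; ring
      rw [this, Complex.im_ofReal_mul, Complex.log_im]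
      ring
    rw [h2]
    have := abs_lt.1 h1
    constructor <;> linarith [Real.pi_pos]
  have hsq := congrArg Complex.re (cpow_half_mul_self c)
  rw [Complex.mul_re] at hsq
  refine abs_lt_of_sq_lt_sq ?_ hre.le
  nlinarith

lemma re_cpow_half_mul_pos {a b : ℂ} (ha : 0 < a.re) (hb : 0 < b.re) :
    0 < (a ^ ((1:ℂ)/2) * b ^ ((1:ℂ)/2)).re := by
  have h1 := abs_lt.1 (abs_im_cpow_half_lt_re ha)
  have h2 := abs_lt.1 (abs_im_cpow_half_lt_re hb)
  rw [Complex.mul_re]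
  nlinarith

lemma re_cpow_half_div_pos {a b : ℂ} (ha : 0 < a.re) (hb : 0 < b.re) :
    0 < (a ^ ((1:ℂ)/2) / b ^ ((1:ℂ)/2)).re := by
  have h1 := abs_lt.1 (abs_im_cpow_half_lt_re ha)
  have h2 := abs_lt.1 (abs_im_cpow_half_lt_re hb)
  have h3 : 0 < Complex.normSq (b ^ ((1:ℂ)/2)) := by
    refine Complex.normSq_pos.2 fun h => ?_
    rw [h] at h2
    simp at h2
  rw [Complex.div_re, ← add_div]
  refine div_pos ?_ h3
  nlinarith

lemma abs_im_mul_le_re_cpow_half_mul {a b : ℂ} (ha : 0 < a.re) (hb : 0 < b.re) :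
    |(a * b).im| ≤ 2 * √(‖a‖ * ‖b‖) * (a ^ ((1:ℂ)/2) * b ^ ((1:ℂ)/2)).re := by
  have h0 := re_cpow_half_mul_pos ha hb
  set w := a ^ ((1:ℂ)/2) * b ^ ((1:ℂ)/2) with hw
  have h1 : a * b = w * w := by
    rw [hw, mul_mul_mul_comm, cpow_half_mul_self, cpow_half_mul_self]
  have h2 : ‖w‖ = √(‖a‖ * ‖b‖) := by
    rw [hw, norm_mul, norm_cpow_half, norm_cpow_half, Real.sqrt_mul (norm_nonneg a)]
  rw [h1, Complex.mul_im, ← h2, show w.re * w.im + w.im * w.re = 2 * w.im * w.re by ring, abs_mul,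
    abs_of_pos h0, abs_mul, abs_two]
  have := Complex.abs_im_le_norm w
  gcongr

lemma sqrt_norm_mul_le_re_cpow_half_mul {a b : ℂ} (ha : 0 < a.re) (hb : 0 < b.re)
    (hab : 0 ≤ (a * b).re) :
    √(‖a‖ * ‖b‖ / 2) ≤ (a ^ ((1:ℂ)/2) * b ^ ((1:ℂ)/2)).re := by
  have h0 := re_cpow_half_mul_pos ha hb
  set w := a ^ ((1:ℂ)/2) * b ^ ((1:ℂ)/2) with hw
  have h1 : a * b = w * w := by
    rw [hw, mul_mul_mul_comm, cpow_half_mul_self, cpow_half_mul_self]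
  refine Real.sqrt_le_iff.2 ⟨h0.le, ?_⟩
  rw [← norm_mul, h1, norm_mul, ← pow_two, Complex.sq_norm, Complex.normSq_apply]
  rw [h1, Complex.mul_re] at hab
  nlinarith

/-- The Fourier coefficients of the smoothed function `u ↦ u ^ (-1/2) * e (y / u)`. -/
noncomputable def dualTerm (N y μ : ℝ) : ℂ :=
  √Real.pi / ((1 / N : ℝ) + (-(2 * Real.pi * μ) : ℝ) * I) ^ ((1:ℂ)/2) *
    Complex.exp (-2 * (((N:ℝ) + (-(2 * Real.pi * y) : ℝ) * I) ^ ((1:ℂ)/2) *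
      ((1 / N : ℝ) + (-(2 * Real.pi * μ) : ℝ) * I) ^ ((1:ℂ)/2)))

lemma norm_dualTerm (N y μ : ℝ) : ‖dualTerm N y μ‖ =
    √Real.pi / √‖((1 / N : ℝ) + (-(2 * Real.pi * μ) : ℝ) * I : ℂ)‖ *
    Real.exp (-2 * (((N:ℝ) + (-(2 * Real.pi * y) : ℝ) * I : ℂ) ^ ((1:ℂ)/2) *
      ((1 / N : ℝ) + (-(2 * Real.pi * μ) : ℝ) * I : ℂ) ^ ((1:ℂ)/2)).re) := by
  rw [dualTerm, norm_mul, norm_div, norm_cpow_half, Complex.norm_exp, Complex.norm_real,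
    Real.norm_of_nonneg (Real.sqrt_nonneg _)]
  congr 3
  rw [show (-2:ℂ) = ((-2:ℝ):ℂ) by push_cast; ring, Complex.re_ofReal_mul]

lemma norm_add_mul_I_le (p q : ℝ) : ‖(p + q * I : ℂ)‖ ≤ |p| + |q| := by
  have := Complex.norm_le_abs_re_add_abs_im (p + q * I : ℂ)
  simpa using this

lemma abs_le_norm_add_mul_I (p q : ℝ) : |p| ≤ ‖(p + q * I : ℂ)‖ ∧ |q| ≤ ‖(p + q * I : ℂ)‖ := by
  have h1 := Complex.abs_re_le_norm (p + q * I : ℂ)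
  have h2 := Complex.abs_im_le_norm (p + q * I : ℂ)
  constructor
  · simpa using h1
  · simpa using h2

lemma exp_neg_mul_pow_le (k : ℕ) {s : ℝ} (hs : 0 ≤ s) : s ^ k * Real.exp (-s) ≤ k.factorial := by
  have h := Real.pow_div_factorial_le_exp s hs k
  rw [Real.exp_neg]
  have h1 := Real.exp_pos s
  rw [div_le_iff₀ (by positivity)] at h
  rw [← div_eq_mul_inv, div_le_iff₀ h1]
  linarith

lemma norm_dualTerm_le_of_nonneg {N y μ : ℝ} (hN : 1 ≤ N) (hy : N ^ 2 ≤ y) (hμ : 0 ≤ μ) :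
    ‖dualTerm N y μ‖ ≤ √Real.pi := by
  have hπ := Real.pi_gt_three
  have hπ4 := Real.pi_lt_four
  have hN0 : 0 < N := by linarith
  have hy0 : 0 < y := by nlinarith
  rw [norm_dualTerm]
  set a : ℂ := ((N:ℝ) + (-(2 * Real.pi * y) : ℝ) * I : ℂ) with ha
  set b : ℂ := ((1 / N : ℝ) + (-(2 * Real.pi * μ) : ℝ) * I : ℂ) with hb
  have har : 0 < a.re := by simpa [ha] using hN0
  have hbr : 0 < b.re := by simpa [hb] using hN0
  have hb0 : 0 < ‖b‖ := norm_pos_iff.2 fun h => by simp [h] at hbr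
  have key := abs_im_mul_le_re_cpow_half_mul har hbr
  have hw := re_cpow_half_mul_pos har hbr
  set W := (a ^ ((1:ℂ)/2) * b ^ ((1:ℂ)/2)).re
  have him : (a * b).im = -(2 * Real.pi * (N * μ + y / N)) := by
    simp [ha, hb]
    field_simp
    ring
  have hna : ‖a‖ ≤ 9 * y := by
    refine (norm_add_mul_I_le _ _).trans ?_
    rw [abs_of_pos hN0, abs_neg, abs_of_pos (by positivity)]
    nlinarith
  rw [him, abs_neg, abs_of_nonneg (by positivity), Real.sqrt_mul (norm_nonneg a)] at key
  have hsa : √‖a‖ ≤ 3 * √y := by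
    rw [show (3:ℝ) = √9 by rw [show (9:ℝ) = 3 ^ 2 by norm_num, Real.sqrt_sq]; norm_num,
      ← Real.sqrt_mul (by norm_num)]
    exact Real.sqrt_le_sqrt hna
  set β := √‖b‖
  have hβ : 0 < β := Real.sqrt_pos.2 hb0
  set Y := √y
  have hY : 0 < Y := Real.sqrt_pos.2 hy0
  have hYN : N ≤ Y := Real.le_sqrt_of_sq_le hy
  have hYY : Y * Y = y := Real.mul_self_sqrt hy0.le
  have h1 : 6 * Y ≤ 6 * Y * (β * W) := by
    calc 6 * Y ≤ 2 * Real.pi * Y := by nlinarith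
      _ ≤ 2 * Real.pi * (N * μ + y / N) := by
        have : Y ≤ y / N := by
          rw [le_div_iff₀ hN0, ← hYY]
          exact mul_le_mul_of_nonneg_left hYN hY.le
        have : 0 ≤ N * μ := by positivity
        have : Y ≤ N * μ + y / N := by linarith
        exact mul_le_mul_of_nonneg_left this (by positivity)
      _ ≤ 2 * (√‖a‖ * β) * W := key
      _ ≤ 2 * (3 * Y * β) * W := by gcongr
      _ = _ := by ring
  have h2 : 1 ≤ β * W := by
    by_contra! h
    nlinarith
  have h3 : Real.exp (-2 * W) ≤ β := by
    have e1 : Real.exp (-2 * W) ≤ 1 / W := by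
      rw [show -2 * W = -(2 * W) by ring, Real.exp_neg, ← one_div]
      refine one_div_le_one_div_of_le hw ?_
      have := Real.add_one_le_exp (2 * W)
      linarith
    refine e1.trans ?_
    rw [div_le_iff₀ hw]
    exact h2
  calc √Real.pi / β * Real.exp (-2 * W) ≤ √Real.pi / β * β := by gcongr
    _ = √Real.pi := by field_simp

lemma norm_dualTerm_le_of_nonpos {N y μ : ℝ} (hN : 1 ≤ N) (hy : N ^ 2 ≤ y) (hμ : μ ≤ 0) (j : ℕ)
    (hj : j ≤ -μ) : ‖dualTerm N y μ‖ ≤ √Real.pi / (j + 1) ^ 2 := by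
  have hπ := Real.pi_gt_three
  have hN0 : 0 < N := by linarith
  have hy0 : 0 < y := by nlinarith
  rw [norm_dualTerm]
  set a : ℂ := ((N:ℝ) + (-(2 * Real.pi * y) : ℝ) * I : ℂ) with ha
  set b : ℂ := ((1 / N : ℝ) + (-(2 * Real.pi * μ) : ℝ) * I : ℂ) with hb
  have har : 0 < a.re := by simpa [ha] using hN0
  have hbr : 0 < b.re := by simpa [hb] using hN0
  have hre : 0 ≤ (a * b).re := by
    have : (a * b).re = 1 + (2 * Real.pi) ^ 2 * y * (-μ) := by
      simp [ha, hb]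
      field_simp
      ring
    rw [this]
    have : 0 ≤ -μ := by linarith
    positivity
  have key := sqrt_norm_mul_le_re_cpow_half_mul har hbr hre
  have hw := re_cpow_half_mul_pos har hbr
  set W := (a ^ ((1:ℂ)/2) * b ^ ((1:ℂ)/2)).re
  have hna : 2 * y ≤ ‖a‖ := by
    refine le_trans ?_ (abs_le_norm_add_mul_I N (-(2 * Real.pi * y))).2
    rw [abs_neg, abs_of_pos (by positivity)]
    nlinarith
  have hnb1 : 1 / N ≤ ‖b‖ := by
    refine le_trans ?_ (abs_le_norm_add_mul_I (1 / N) (-(2 * Real.pi * μ))).1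
    exact le_abs_self _
  have hnb2 : 2 * (j:ℝ) ≤ ‖b‖ := by
    refine le_trans ?_ (abs_le_norm_add_mul_I (1 / N) (-(2 * Real.pi * μ))).2
    rw [show -(2 * Real.pi * μ) = 2 * Real.pi * (-μ) by ring, abs_of_nonneg (by nlinarith)]
    nlinarith
  have hb0 : 0 < ‖b‖ := norm_pos_iff.2 fun h => by simp [h] at hbr
  have hNb : 1 ≤ N * ‖b‖ := by rwa [div_le_iff₀' hN0] at hnb1
  have hj1 : ((j:ℝ) + 1) ≤ N * ‖b‖ := by
    rcases Nat.eq_zero_or_pos j with h | h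
    · simpa [h] using hNb
    · have : (1:ℝ) ≤ j := by exact_mod_cast h
      nlinarith
  set β := √‖b‖
  have hβ : 0 < β := Real.sqrt_pos.2 hb0
  have hββ : β * β = ‖b‖ := Real.mul_self_sqrt hb0.le
  have h1 : N * β ≤ W := by
    refine le_trans (Real.le_sqrt_of_sq_le ?_) key
    nlinarith
  have h2 : W ^ 3 * Real.exp (-2 * W) ≤ 1 := by
    have := exp_neg_mul_pow_le 3 (by positivity : 0 ≤ 2 * W)
    rw [mul_pow, show -(2 * W) = -2 * W by ring,
      show ((Nat.factorial 3 : ℕ):ℝ) = 6 by norm_num [Nat.factorial]] at this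
    linarith
  have hj2 : ((j:ℝ) + 1) ^ 2 ≤ β * W ^ 3 := by
    calc ((j:ℝ) + 1) ^ 2 ≤ (N * ‖b‖) ^ 2 := by gcongr
      _ = 1 * (N ^ 2 * β ^ 4) := by rw [← hββ]; ring
      _ ≤ N * (N ^ 2 * β ^ 4) := by gcongr
      _ = β * (N * β) ^ 3 := by ring
      _ ≤ β * W ^ 3 := by gcongr
  rw [le_div_iff₀ (by positivity)]
  calc √Real.pi / β * Real.exp (-2 * W) * ((j:ℝ) + 1) ^ 2
      ≤ √Real.pi / β * Real.exp (-2 * W) * (β * W ^ 3) := by gcongr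
    _ = √Real.pi * (W ^ 3 * Real.exp (-2 * W)) := by field_simp
    _ ≤ √Real.pi * 1 := by gcongr
    _ = _ := mul_one _

lemma exists_norm_dualTerm_mul_le : ∃ C : ℝ, 0 < C ∧ ∀ N y μ : ℝ, 1 ≤ N → N ^ 2 ≤ y → 1 ≤ μ →
    ‖dualTerm N y μ‖ * (1 / 2 + (N * √μ / √y + √y / (N * √μ)))
      ≤ C * (N / √y) / (μ * N ^ 2 / y + y / (μ * N ^ 2)) ^ 4 := by
  refine ⟨2 * (Nat.factorial 10 * (3 / 2) ^ 10), by positivity, fun N y μ hN hy hμ => ?_⟩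
  have hπ := Real.pi_gt_three
  have hπ4 := Real.pi_lt_four
  have hN0 : 0 < N := by linarith
  have hy0 : 0 < y := by nlinarith
  have hμ0 : 0 < μ := by linarith
  rw [norm_dualTerm]
  set a : ℂ := ((N:ℝ) + (-(2 * Real.pi * y) : ℝ) * I : ℂ) with ha
  set b : ℂ := ((1 / N : ℝ) + (-(2 * Real.pi * μ) : ℝ) * I : ℂ) with hb
  have har : 0 < a.re := by simpa [ha] using hN0
  have hbr : 0 < b.re := by simpa [hb] using hN0
  have hb0 : 0 < ‖b‖ := norm_pos_iff.2 fun h => by simp [h] at hbr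
  have key := abs_im_mul_le_re_cpow_half_mul har hbr
  have hw := re_cpow_half_mul_pos har hbr
  set W := (a ^ ((1:ℂ)/2) * b ^ ((1:ℂ)/2)).re
  have him : (a * b).im = -(2 * Real.pi * (N * μ + y / N)) := by
    simp [ha, hb]
    field_simp
    ring
  have hna : ‖a‖ ≤ 9 * y := by
    refine (norm_add_mul_I_le _ _).trans ?_
    rw [abs_of_pos hN0, abs_neg, abs_of_pos (by positivity)]
    nlinarith
  have hnb : ‖b‖ ≤ 9 * μ := by
    refine (norm_add_mul_I_le _ _).trans ?_
    rw [abs_of_pos (by positivity), abs_neg, abs_of_pos (by positivity)]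
    have : 1 / N ≤ 1 := by rw [div_le_one hN0]; exact hN
    nlinarith
  have hnb2 : 2 * Real.pi * μ ≤ ‖b‖ := by
    refine le_trans ?_ (abs_le_norm_add_mul_I (1 / N) (-(2 * Real.pi * μ))).2
    rw [abs_neg]
    exact le_abs_self _
  rw [him, abs_neg, abs_of_nonneg (by positivity)] at key
  set Y := √y
  have hY : 0 < Y := Real.sqrt_pos.2 hy0
  have hYY : Y ^ 2 = y := Real.sq_sqrt hy0.le
  set m := √μ
  have hm : 0 < m := Real.sqrt_pos.2 hμ0
  have hmm : m ^ 2 = μ := Real.sq_sqrt hμ0.le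
  have hsq : √(‖a‖ * ‖b‖) ≤ 9 * (Y * m) := by
    refine Real.sqrt_le_iff.2 ⟨by positivity, ?_⟩
    calc ‖a‖ * ‖b‖ ≤ (9 * y) * (9 * μ) := by gcongr
      _ = _ := by rw [← hYY, ← hmm]; ring
  set s := N * m / Y + Y / (N * m) with hs
  have hs0 : 0 < s := by positivity
  have hsT : s ^ 2 = μ * N ^ 2 / y + y / (μ * N ^ 2) + 2 := by
    rw [hs, ← hYY, ← hmm]
    field_simp
    ring
  set T := μ * N ^ 2 / y + y / (μ * N ^ 2) with hT
  have hT0 : 0 < T := by positivity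
  have hs1 : 1 ≤ s := by nlinarith
  have hW : s / 3 ≤ W := by
    have h1 : s * (Y * m) = N * μ + y / N := by
      rw [hs, ← hYY, ← hmm]
      field_simp
    have h2 : 2 * Real.pi * (s * (Y * m)) ≤ 18 * W * (Y * m) := by
      rw [h1]
      refine key.trans ?_
      calc 2 * √(‖a‖ * ‖b‖) * W ≤ 2 * (9 * (Y * m)) * W := by gcongr
        _ = _ := by ring
    have h3 : 0 < Y * m := by positivity
    have h4 : 2 * Real.pi * s ≤ 18 * W := by
      refine le_of_mul_le_mul_right ?_ h3
      linarith
    nlinarith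
  have hpre : √Real.pi / √‖b‖ ≤ N / Y * s := by
    have h1 : √Real.pi / √‖b‖ ≤ 1 / m := by
      rw [← Real.sqrt_div Real.pi_pos.le, ← Real.sqrt_one, ← Real.sqrt_div zero_le_one]
      refine Real.sqrt_le_sqrt ?_
      rw [div_le_div_iff₀ hb0 hμ0]
      nlinarith
    refine h1.trans ?_
    have : N / Y * s = 1 / m + (N / Y) * (N * m / Y) := by
      rw [hs]
      field_simp
      ring
    rw [this]
    have : 0 < (N / Y) * (N * m / Y) := by positivity
    linarith
  have hexp : Real.exp (-2 * W) ≤ Real.exp (-(2 * s / 3)) := Real.exp_le_exp.2 (by linarith)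
  have hfac := exp_neg_mul_pow_le 10 (by positivity : 0 ≤ 2 * s / 3)
  have hfac2 : s ^ 10 * Real.exp (-(2 * s / 3)) ≤ Nat.factorial 10 * (3 / 2) ^ 10 := by
    rw [show 2 * s / 3 = s * (2 / 3) by ring, mul_pow] at hfac
    have e : (2 / 3 : ℝ) ^ 10 * (3 / 2) ^ 10 = 1 := by norm_num
    have := mul_le_mul_of_nonneg_right hfac (by positivity : (0:ℝ) ≤ (3 / 2) ^ 10)
    rw [show 2 * s / 3 = s * (2 / 3) by ring]
    calc s ^ 10 * Real.exp (-(s * (2 / 3)))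
        = s ^ 10 * ((2 / 3 : ℝ) ^ 10 * (3 / 2) ^ 10) * Real.exp (-(s * (2 / 3))) := by
          rw [e, mul_one]
      _ = s ^ 10 * (2 / 3) ^ 10 * Real.exp (-(s * (2 / 3))) * (3 / 2) ^ 10 := by ring
      _ ≤ _ := this
  rw [le_div_iff₀ (by positivity)]
  have hTs : T ^ 4 ≤ s ^ 8 := by
    calc T ^ 4 ≤ (s ^ 2) ^ 4 := by
          gcongr
          linarith
      _ = s ^ 8 := by ring
  calc √Real.pi / √‖b‖ * Real.exp (-2 * W) * (1 / 2 + s) * T ^ 4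
      ≤ N / Y * s * Real.exp (-(2 * s / 3)) * (2 * s) * s ^ 8 := by
        gcongr
        linarith
    _ = 2 * (s ^ 10 * Real.exp (-(2 * s / 3))) * (N / Y) := by ring
    _ ≤ 2 * (Nat.factorial 10 * (3 / 2) ^ 10) * (N / Y) := by gcongr

/-- `dualTerm` with its oscillation `e (2 * √(y * μ))` removed. -/
noncomputable def dualAmp (N y μ : ℝ) : ℂ :=
  dualTerm N y μ * expTwoPi (-(2 * √(y * μ)))

lemma dualTerm_eq_dualAmp_mul (N y μ : ℝ) :
    dualTerm N y μ = dualAmp N y μ * expTwoPi (2 * √(y * μ)) := by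
  rw [dualAmp, mul_assoc, ← expTwoPi_add]
  simp [expTwoPi_zero]

lemma norm_dualAmp (N y μ : ℝ) : ‖dualAmp N y μ‖ = ‖dualTerm N y μ‖ := by
  rw [dualAmp, norm_mul, norm_expTwoPi, mul_one]

lemma hasDerivAt_dualAmp {N y μ : ℝ} (hN : 0 < N) (hy : 0 < y) (hμ : 0 < μ) :
    ∃ d : ℂ, HasDerivAt (fun u : ℝ => dualAmp N y u) d μ ∧
      ‖d‖ ≤ ‖dualTerm N y μ‖ * (1 / 2 + (N * √μ / √y + √y / (N * √μ))) / μ := by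
  set a : ℂ := ((N:ℝ) + (-(2 * Real.pi * y) : ℝ) * I : ℂ) with ha
  set b : ℝ → ℂ := fun μ => ((1 / N : ℝ) + (-(2 * Real.pi * μ) : ℝ) * I : ℂ) with hb
  have har : 0 < a.re := by simpa [ha] using hN
  have hbr : 0 < (b μ).re := by simpa [hb] using hN
  have hb0 : b μ ≠ 0 := fun h => by simp [h] at hbr
  have hnb : 2 * Real.pi * μ ≤ ‖b μ‖ := by
    refine le_trans ?_ (abs_le_norm_add_mul_I (1 / N) (-(2 * Real.pi * μ))).2
    rw [abs_neg]
    exact le_abs_self _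
  have hdb : HasDerivAt b (-(2 * Real.pi * I)) μ := by
    have h1 : HasDerivAt (fun u : ℝ => (-(2 * Real.pi * u) : ℝ)) (-(2 * Real.pi * 1)) μ :=
      ((hasDerivAt_id μ).const_mul _).neg
    have h2 := (h1.ofReal_comp.mul_const I).const_add ((1 / N : ℝ) : ℂ)
    refine h2.congr_deriv ?_
    push_cast
    ring
  set q : ℝ → ℂ := fun u => (b u) ^ ((1:ℂ)/2) with hq
  have hq0 : q μ ≠ 0 := by
    simp only [hq]
    rw [Complex.cpow_ne_zero_iff]
    exact Or.inl hb0
  have hqq : q μ * q μ = b μ := cpow_half_mul_self _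
  have hdq : HasDerivAt q (-(Real.pi * I) / q μ) μ := by
    have h1 := (hasDerivAt_id (b μ)).cpow_const (c := (1:ℂ)/2) (Or.inl hbr)
    have h2 := h1.comp_of_eq μ hdb rfl
    have e : (1:ℂ) / 2 * id (b μ) ^ ((1:ℂ)/2 - 1) * 1 * -(2 * Real.pi * I) = -(Real.pi * I) / q μ := by
      rw [Complex.cpow_sub _ _ (by exact hb0), Complex.cpow_one, id]
      change 1 / 2 * (q μ / b μ) * 1 * -(2 * Real.pi * I) = _
      rw [← hqq]
      field_simp
    rw [e] at h2
    exact h2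
  set p : ℂ := a ^ ((1:ℂ)/2) with hp
  have hpp : p * p = a := cpow_half_mul_self _
  set ρ : ℝ := √y / √μ with hρ
  have hsy : 0 < √y := Real.sqrt_pos.2 hy
  have hsμ : 0 < √μ := Real.sqrt_pos.2 hμ
  have hρ0 : 0 < ρ := by positivity
  have hdphase : HasDerivAt (fun u : ℝ => -(2 * √(y * u))) (-ρ) μ := by
    have h1 : HasDerivAt (fun u => y * u) (y * 1) μ := (hasDerivAt_id μ).const_mul y
    have h2 := ((h1.sqrt (by positivity)).const_mul 2).neg
    refine h2.congr_deriv ?_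
    rw [Real.sqrt_mul hy.le, hρ]
    have := Real.mul_self_sqrt hy.le
    field_simp
    nlinarith
  have hde : HasDerivAt (fun u : ℝ => expTwoPi (-(2 * √(y * u))))
      (expTwoPi (-(2 * √(y * μ))) * (-(2 * Real.pi * ρ * I))) μ := by
    have h1 := ((hdphase.const_mul (2 * Real.pi)).ofReal_comp.mul_const I).cexp
    refine h1.congr_deriv ?_
    simp only [expTwoPi]
    push_cast
    ring
  have hdV : HasDerivAt (fun u : ℝ => dualTerm N y u)
      (dualTerm N y μ * (Real.pi * I / b μ + 2 * Real.pi * I * (p / q μ))) μ := by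
    have h1 : HasDerivAt (fun u : ℝ => (√Real.pi : ℂ) / q u * Complex.exp (-2 * (p * q u)))
      ((0 * q μ - √Real.pi * (-(Real.pi * I) / q μ)) / q μ ^ 2 * Complex.exp (-2 * (p * q μ)) +
        √Real.pi / q μ * (Complex.exp (-2 * (p * q μ)) * (-2 * (p * (-(Real.pi * I) / q μ))))) μ :=
      ((hasDerivAt_const μ (√Real.pi : ℂ)).div hdq hq0).mul
        (((hdq.const_mul p).const_mul (-2)).cexp)
    have e : (0 * q μ - √Real.pi * (-(Real.pi * I) / q μ)) / q μ ^ 2 * Complex.exp (-2 * (p * q μ)) +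
        √Real.pi / q μ * (Complex.exp (-2 * (p * q μ)) * (-2 * (p * (-(Real.pi * I) / q μ))))
        = √Real.pi / q μ * Complex.exp (-2 * (p * q μ)) *
          (Real.pi * I / b μ + 2 * Real.pi * I * (p / q μ)) := by
      rw [← hqq]
      field_simp
      ring
    rw [e] at h1
    exact h1
  refine ⟨_, hdV.mul hde, ?_⟩
  have hr : ‖p / q μ - ρ‖ ≤ (N * μ + y / N) / (2 * Real.pi * μ ^ 2 * ρ) := by
    have hre : 0 < (p / q μ).re := re_cpow_half_div_pos har hbr
    have h1 : ρ ≤ ‖p / q μ + ρ‖ := by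
      refine le_trans ?_ (Complex.re_le_norm _)
      simp only [Complex.add_re, Complex.ofReal_re]
      linarith
    have hρρ : ρ ^ 2 = y / μ := by
      rw [hρ, div_pow, Real.sq_sqrt hy.le, Real.sq_sqrt hμ.le]
    have h2 : (p / q μ - ρ) * (p / q μ + ρ) = ((N * μ - y / N : ℝ) : ℂ) / (b μ * μ) := by
      have e1 : (p / q μ - ρ) * (p / q μ + ρ) = (p * p) / (q μ * q μ) - ((ρ ^ 2 : ℝ) : ℂ) := by
        push_cast
        ring
      have hμC : (μ : ℂ) ≠ 0 := by exact_mod_cast hμ.ne'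
      rw [e1, hpp, hqq, hρρ]
      have e2 : a * μ - y * b μ = ((N * μ - y / N : ℝ) : ℂ) := by
        simp only [ha, hb]
        push_cast
        ring
      rw [← e2]
      push_cast
      field_simp
    have h3 := congrArg norm h2
    rw [norm_mul, norm_div, norm_mul, Complex.norm_real, Complex.norm_real,
      Real.norm_of_nonneg hμ.le] at h3
    have h4 : ‖(N * μ - y / N : ℝ)‖ ≤ N * μ + y / N := by
      rw [Real.norm_eq_abs]
      refine (abs_sub _ _).trans ?_
      rw [abs_of_pos (by positivity), abs_of_pos (by positivity)]
    have h5 : ‖p / q μ - ρ‖ * ρ ≤ (N * μ + y / N) / (2 * Real.pi * μ * μ) := by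
      calc _ ≤ ‖p / q μ - ρ‖ * ‖p / q μ + ρ‖ := by gcongr
        _ = _ := h3
        _ ≤ _ := by gcongr
    rw [← le_div_iff₀ hρ0] at h5
    refine h5.trans (le_of_eq ?_)
    field_simp
  have hd : dualTerm N y μ * (Real.pi * I / b μ + 2 * Real.pi * I * (p / q μ)) *
        expTwoPi (-(2 * √(y * μ))) +
      dualTerm N y μ * (expTwoPi (-(2 * √(y * μ))) * (-(2 * Real.pi * ρ * I)))
      = dualTerm N y μ * expTwoPi (-(2 * √(y * μ))) *
        (Real.pi * I / b μ + 2 * Real.pi * I * (p / q μ - ρ)) := by ring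
  rw [hd, norm_mul, norm_mul, norm_expTwoPi, mul_one, mul_div_assoc ‖dualTerm N y μ‖]
  refine mul_le_mul_of_nonneg_left ?_ (norm_nonneg _)
  have hπ := Real.pi_pos
  refine (norm_add_le _ _).trans ?_
  have n1 : ‖(Real.pi * I / b μ : ℂ)‖ ≤ 1 / 2 / μ := by
    rw [norm_div, norm_mul, Complex.norm_I, Complex.norm_real, Real.norm_of_nonneg hπ.le, mul_one]
    calc Real.pi / ‖b μ‖ ≤ Real.pi / (2 * Real.pi * μ) := by gcongr
      _ = _ := by field_simp
  have n2 : ‖(2 * Real.pi * I * (p / q μ - ρ) : ℂ)‖ ≤ (N * √μ / √y + √y / (N * √μ)) / μ := by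
    rw [norm_mul, norm_mul, norm_mul, Complex.norm_I, Complex.norm_real,
      Real.norm_of_nonneg hπ.le, mul_one, Complex.norm_ofNat]
    calc 2 * Real.pi * ‖p / q μ - ρ‖
        ≤ 2 * Real.pi * ((N * μ + y / N) / (2 * Real.pi * μ ^ 2 * ρ)) := by gcongr
      _ = _ := by
        rw [hρ]
        have e1 : √μ ^ 2 = μ := Real.sq_sqrt hμ.le
        have e2 : √y ^ 2 = y := Real.sq_sqrt hy.le
        set sm := √μ
        set sy := √y
        rw [← e1, ← e2]
        field_simp
  rw [add_div]
  exact add_le_add n1 n2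

lemma rpow_le_add_inv {κ c : ℝ} (hκ : 0 < κ) (hc : |c| ≤ 1) : κ ^ c ≤ κ + κ⁻¹ := by
  obtain ⟨h1, h2⟩ := abs_le.1 hc
  rcases le_total 1 κ with h | h
  · have := Real.rpow_le_rpow_of_exponent_le h h2
    rw [Real.rpow_one] at this
    have : 0 < κ⁻¹ := by positivity
    linarith
  · have := Real.rpow_le_rpow_of_exponent_ge hκ h h1
    rw [Real.rpow_neg_one] at this
    linarith

lemma norm_sum_mul_le_sum_mul (g z : ℕ → ℂ) (A : ℕ → ℝ) (hA : ∀ m, ‖∑ i ∈ range m, z i‖ ≤ A m)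
    (L : ℕ) : ‖∑ i ∈ range (L + 1), g i * z i‖
      ≤ ‖g L‖ * A (L + 1) + ∑ i ∈ range L, ‖g (i + 1) - g i‖ * A (i + 1) := by
  have key : ∀ L : ℕ, ∑ i ∈ range (L + 1), g i * z i = g L * ∑ i ∈ range (L + 1), z i
      - ∑ i ∈ range L, (g (i + 1) - g i) * ∑ j ∈ range (i + 1), z j := by
    intro L
    induction L with
    | zero => simp
    | succ L ih =>
      rw [sum_range_succ]
      rw [ih, sum_range_succ (fun i => z i) (L + 1),
        sum_range_succ (fun i => (g (i + 1) - g i) * ∑ j ∈ range (i + 1), z j) L]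
      ring
  rw [key]
  refine (norm_sub_le _ _).trans (add_le_add ?_ ?_)
  · rw [norm_mul]
    exact mul_le_mul_of_nonneg_left (hA _) (norm_nonneg _)
  · refine (norm_sum_le _ _).trans (sum_le_sum fun i _ => ?_)
    rw [norm_mul]
    exact mul_le_mul_of_nonneg_left (hA _) (norm_nonneg _)

lemma sum_sq_div_add_sq_le {M : ℝ} (hM : 0 < M) (L : ℕ) :
    ∑ i ∈ range L, M ^ 2 / (M + (i + 1)) ^ 2 ≤ M := by
  have : ∑ i ∈ range L, M ^ 2 / (M + (i + 1)) ^ 2 ≤ M - M ^ 2 / (M + L) := by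
    induction L with
    | zero =>
      simp
      field_simp
      exact le_rfl
    | succ L ih =>
      rw [sum_range_succ]
      have : M ^ 2 / (M + (L + 1)) ^ 2 ≤ M ^ 2 / (M + L) - M ^ 2 / (M + (L + 1)) := by
        have h1 : M ^ 2 / (M + L) - M ^ 2 / (M + (L + 1)) = M ^ 2 / ((M + L) * (M + (L + 1))) := by
          field_simp
          ring
        rw [h1]
        refine div_le_div_of_nonneg_left (by positivity) (by positivity) ?_
        rw [pow_two]
        gcongr
        linarith
      push_cast
      linarith
  refine this.trans ?_
  have : 0 ≤ M ^ 2 / (M + L) := by positivity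
  linarith

lemma exists_norm_dualAmp_sub_le : ∃ C : ℝ, 0 < C ∧ ∀ N y μ : ℝ, 1 ≤ N → N ^ 2 ≤ y → 1 ≤ μ →
    ‖dualAmp N y (μ + 1) - dualAmp N y μ‖
      ≤ C * (N / √y) / (μ * N ^ 2 / y + y / (μ * N ^ 2)) ^ 4 / μ := by
  obtain ⟨C, hC, h⟩ := exists_norm_dualTerm_mul_le
  refine ⟨16 * C, by positivity, fun N y μ hN hy hμ => ?_⟩
  have hN0 : 0 < N := by linarith
  have hy0 : 0 < y := by nlinarith
  have hμ0 : 0 < μ := by linarith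
  have hder : ∀ u ∈ Set.Icc μ (μ + 1), ∃ d : ℂ, HasDerivAt (fun u : ℝ => dualAmp N y u) d u ∧
      ‖d‖ ≤ 16 * C * (N / √y) / (μ * N ^ 2 / y + y / (μ * N ^ 2)) ^ 4 / μ := by
    intro u hu
    have hu1 : 1 ≤ u := hμ.trans hu.1
    have hu0 : 0 < u := by linarith
    have hu2 : u ≤ 2 * μ := by linarith [hu.2]
    obtain ⟨d, hd, hd2⟩ := hasDerivAt_dualAmp hN0 hy0 hu0
    refine ⟨d, hd, hd2.trans ?_⟩
    refine (div_le_div_of_nonneg_right (h N y u hN hy hu1) hu0.le).trans ?_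
    have hT : (μ * N ^ 2 / y + y / (μ * N ^ 2)) / 2 ≤ u * N ^ 2 / y + y / (u * N ^ 2) := by
      have h1 : μ * N ^ 2 / y ≤ u * N ^ 2 / y := by
        gcongr
        exact hu.1
      have h2 : y / (μ * N ^ 2) / 2 ≤ y / (u * N ^ 2) := by
        rw [div_div]
        refine div_le_div_of_nonneg_left hy0.le (by positivity) ?_
        nlinarith [pow_pos hN0 2]
      have : 0 < μ * N ^ 2 / y := by positivity
      linarith
    have hT0 : 0 < μ * N ^ 2 / y + y / (μ * N ^ 2) := by positivity
    calc C * (N / √y) / (u * N ^ 2 / y + y / (u * N ^ 2)) ^ 4 / u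
        ≤ C * (N / √y) / ((μ * N ^ 2 / y + y / (μ * N ^ 2)) / 2) ^ 4 / μ := by
          gcongr
          exact hu.1
      _ = _ := by
        rw [div_pow]
        field_simp
        norm_num
  choose! d hd hd2 using hder
  have := norm_image_sub_le_of_norm_deriv_le_segment'
    (fun u hu => (hd u hu).hasDerivWithinAt) (fun u hu => hd2 u (Set.Ico_subset_Icc_self hu))
    (μ + 1) (Set.right_mem_Icc.2 (by linarith))
  simpa using this

lemma rpow_mul_div_pow_four_le {M μ e : ℝ} (hM : 0 < M) (hμ : 0 < μ) (he0 : 0 ≤ e) (he2 : e ≤ 2) :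
    μ ^ e / (μ / M + (μ / M)⁻¹) ^ 4 / μ ≤ 4 * M ^ e / M * (M ^ 2 / (M + μ) ^ 2) ∧
    μ ^ e / (μ / M + (μ / M)⁻¹) ^ 4 ≤ M ^ e := by
  set κ := μ / M with hκ
  have hκ0 : 0 < κ := by positivity
  have hμκ : μ = κ * M := by rw [hκ]; field_simp
  set T := κ + κ⁻¹ with hT
  have hT0 : 0 < T := by positivity
  have hinv : κ * κ⁻¹ = 1 := mul_inv_cancel₀ hκ0.ne'
  have hT2 : 2 ≤ T := by
    rw [hT]
    have : 0 < κ⁻¹ := by positivity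
    nlinarith [sq_nonneg (κ - κ⁻¹)]
  have hκT : κ ≤ T := by
    rw [hT]
    have : 0 < κ⁻¹ := by positivity
    linarith
  constructor
  · have h1 : κ ^ (e - 1) ≤ T := rpow_le_add_inv hκ0 (abs_le.2 ⟨by linarith, by linarith⟩)
    have h2 : μ ^ e / T ^ 4 / μ = M ^ e / M * (κ ^ (e - 1) / T ^ 4) := by
      rw [hμκ, Real.mul_rpow hκ0.le hM.le, Real.rpow_sub_one hκ0.ne']
      field_simp
    have h3 : M ^ 2 / (M + μ) ^ 2 = 1 / (1 + κ) ^ 2 := by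
      rw [hμκ]
      field_simp
    rw [h2, h3]
    have h4 : κ ^ (e - 1) / T ^ 4 ≤ 4 * (1 / (1 + κ) ^ 2) := by
      rw [mul_one_div, div_le_div_iff₀ (by positivity) (by positivity)]
      calc κ ^ (e - 1) * (1 + κ) ^ 2 ≤ T * (T + T) ^ 2 := by
            gcongr
            linarith
        _ = 4 * (T ^ 3 * 1) := by ring
        _ ≤ 4 * (T ^ 3 * T) := by gcongr; linarith
        _ = 4 * T ^ 4 := by ring
    calc M ^ e / M * (κ ^ (e - 1) / T ^ 4) ≤ M ^ e / M * (4 * (1 / (1 + κ) ^ 2)) := by gcongr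
      _ = _ := by ring
  · have h1 : κ ^ (e / 2) ≤ T := rpow_le_add_inv hκ0 (abs_le.2 ⟨by linarith, by linarith⟩)
    rw [div_le_iff₀ (by positivity), hμκ, Real.mul_rpow hκ0.le hM.le, mul_comm]
    refine mul_le_mul_of_nonneg_left ?_ (by positivity)
    calc κ ^ e = (κ ^ (e / 2)) ^ 2 := by
          rw [← Real.rpow_natCast, ← Real.rpow_mul hκ0.le]
          norm_num
      _ ≤ T ^ 2 := by gcongr
      _ ≤ T ^ 4 := pow_le_pow_right₀ (by linarith) (by norm_num)

lemma exists_norm_sum_dualTerm_le : ∃ C : ℝ, 0 < C ∧ ∀ N y θ : ℝ, 1 ≤ N → N ^ 2 ≤ y → 0 ≤ θ →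
    θ < 1 → ∀ L : ℕ, ‖∑ n ∈ range L, dualTerm N y (n + 1 + θ)‖ ≤
      C * (N / √y) * ((y / N ^ 2) ^ ((17:ℝ)/20) * y ^ ((1:ℝ)/60) +
        (y / N ^ 2) ^ ((41:ℝ)/40) * y ^ (-(1:ℝ)/60)) := by
  obtain ⟨C₁, hC₁, h₁⟩ := exists_norm_dualTerm_mul_le
  obtain ⟨C₂, hC₂, h₂⟩ := exists_norm_dualAmp_sub_le
  obtain ⟨C₃, hC₃, h₃⟩ := exists_norm_sum_expTwoPi_sqrt_le
  refine ⟨(2 * C₁ + C₂ * 4) * C₃, by positivity, fun N y θ hN hy hθ0 hθ1 L => ?_⟩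
  have hN0 : 0 < N := by linarith
  have hy0 : 0 < y := by nlinarith
  set M := y / N ^ 2 with hM
  have hM0 : 0 < M := by positivity
  set E : ℝ → ℝ := fun m => m ^ ((17:ℝ)/20) * y ^ ((1:ℝ)/60) + m ^ ((41:ℝ)/40) * y ^ (-(1:ℝ)/60)
    with hE
  have hE0 : ∀ m, 0 ≤ m → 0 ≤ E m := fun m hm => by simp only [hE]; positivity
  change _ ≤ _ * E M
  rcases Nat.eq_zero_or_pos L with rfl | hL
  · simpa using mul_nonneg (by positivity) (hE0 M hM0.le)
  obtain ⟨K, rfl⟩ : ∃ K, L = K + 1 := ⟨L - 1, by omega⟩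
  have hEmono : ∀ m m' : ℝ, 0 ≤ m → m ≤ m' → E m ≤ E m' := by
    intro m m' hm hmm
    simp only [hE]
    gcongr
  set μ : ℕ → ℝ := fun n => n + 1 + θ with hμ
  have hμ1 : ∀ n : ℕ, (n:ℝ) + 1 ≤ μ n := fun n => by simp only [hμ]; linarith
  have hμ1' : ∀ n, 1 ≤ μ n := fun n => by
    have : (0:ℝ) ≤ n := Nat.cast_nonneg n
    linarith [hμ1 n]
  have hμ0 : ∀ n, 0 < μ n := fun n => by linarith [hμ1' n]
  have hT : ∀ n, μ n * N ^ 2 / y + y / (μ n * N ^ 2) = μ n / M + (μ n / M)⁻¹ := by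
    intro n
    rw [hM]
    have := (hμ0 n).ne'
    field_simp
  have hA : ∀ m : ℕ, ‖∑ i ∈ range m, expTwoPi (2 * √(y * μ i))‖ ≤ C₃ * E m :=
    fun m => h₃ y hy0 θ hθ0 hθ1 m
  have hmain := norm_sum_mul_le_sum_mul (fun n => dualAmp N y (μ n)) _ _ hA K
  have e0 : ∑ n ∈ range (K + 1), dualTerm N y (n + 1 + θ)
      = ∑ n ∈ range (K + 1), dualAmp N y (μ n) * expTwoPi (2 * √(y * μ n)) :=
    sum_congr rfl fun n _ => dualTerm_eq_dualAmp_mul N y (μ n)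
  rw [e0]
  refine hmain.trans ?_
  have hEA : ∀ n : ℕ, E ((n + 1 : ℕ):ℝ) ≤ E (μ n) := fun n =>
    hEmono _ _ (by positivity) (by push_cast; exact hμ1 n)
  have hE1 : ∀ n, E (μ n) / (μ n / M + (μ n / M)⁻¹) ^ 4 ≤ E M := by
    intro n
    have a1 := (rpow_mul_div_pow_four_le hM0 (hμ0 n) (by norm_num : (0:ℝ) ≤ 17 / 20) (by norm_num)).2
    have a2 := (rpow_mul_div_pow_four_le hM0 (hμ0 n) (by norm_num : (0:ℝ) ≤ 41 / 40) (by norm_num)).2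
    simp only [hE]
    rw [add_div, mul_div_right_comm, mul_div_right_comm]
    gcongr
  have hE2 : ∀ n, E (μ n) / (μ n / M + (μ n / M)⁻¹) ^ 4 / μ n
      ≤ 4 * E M / M * (M ^ 2 / (M + μ n) ^ 2) := by
    intro n
    have a1 := (rpow_mul_div_pow_four_le hM0 (hμ0 n) (by norm_num : (0:ℝ) ≤ 17 / 20) (by norm_num)).1
    have a2 := (rpow_mul_div_pow_four_le hM0 (hμ0 n) (by norm_num : (0:ℝ) ≤ 41 / 40) (by norm_num)).1
    have p1 : 0 ≤ y ^ ((1:ℝ)/60) := by positivity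
    have p2 : 0 ≤ y ^ (-(1:ℝ)/60) := by positivity
    have b1 := mul_le_mul_of_nonneg_right a1 p1
    have b2 := mul_le_mul_of_nonneg_right a2 p2
    simp only [hE]
    calc _ = _ + _ := by
          rw [add_div, add_div, mul_div_right_comm, mul_div_right_comm, mul_div_right_comm,
            mul_div_right_comm]
      _ ≤ _ := add_le_add b1 b2
      _ = _ := by ring
  have hy12 : 0 ≤ N / √y := by positivity
  have hEM := hE0 M hM0.le
  have hfirst : ‖dualAmp N y (μ K)‖ * (C₃ * E ((K + 1 : ℕ):ℝ)) ≤ 2 * C₁ * C₃ * (N / √y) * E M := by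
    have b1 : ‖dualAmp N y (μ K)‖ ≤ 2 * C₁ * (N / √y) / (μ K / M + (μ K / M)⁻¹) ^ 4 := by
      have b2 := h₁ N y (μ K) hN hy (hμ1' K)
      rw [hT] at b2
      rw [norm_dualAmp]
      have b3 : ‖dualTerm N y (μ K)‖ * (1 / 2) ≤
          ‖dualTerm N y (μ K)‖ * (1 / 2 + (N * √(μ K) / √y + √y / (N * √(μ K)))) := by
        gcongr
        have : 0 ≤ N * √(μ K) / √y + √y / (N * √(μ K)) := by positivity
        linarith
      have b4 := b3.trans b2
      rw [show 2 * C₁ * (N / √y) / (μ K / M + (μ K / M)⁻¹) ^ 4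
        = 2 * (C₁ * (N / √y) / (μ K / M + (μ K / M)⁻¹) ^ 4) by ring]
      linarith
    have hk := hμ0 K
    calc ‖dualAmp N y (μ K)‖ * (C₃ * E ((K + 1 : ℕ):ℝ))
        ≤ 2 * C₁ * (N / √y) / (μ K / M + (μ K / M)⁻¹) ^ 4 * (C₃ * E (μ K)) :=
          mul_le_mul b1 (mul_le_mul_of_nonneg_left (hEA K) hC₃.le)
            (mul_nonneg hC₃.le (hE0 _ (by positivity))) (by positivity)
      _ = 2 * C₁ * C₃ * (N / √y) * (E (μ K) / (μ K / M + (μ K / M)⁻¹) ^ 4) := by ring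
      _ ≤ _ := mul_le_mul_of_nonneg_left (hE1 K) (by positivity)
  have hsecond : ∑ i ∈ range K, ‖dualAmp N y (μ (i + 1)) - dualAmp N y (μ i)‖ *
      (C₃ * E ((i + 1 : ℕ):ℝ)) ≤ C₂ * 4 * C₃ * (N / √y) * E M := by
    calc _ ≤ ∑ i ∈ range K, C₂ * 4 * C₃ * (N / √y) * E M / M * (M ^ 2 / (M + (i + 1)) ^ 2) := by
          refine sum_le_sum fun i _ => ?_
          have hk := hμ0 i
          have b1 := h₂ N y (μ i) hN hy (hμ1' i)
          rw [hT] at b1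
          have e1 : μ (i + 1) = μ i + 1 := by
            simp only [hμ]
            push_cast
            ring
          rw [e1]
          calc _ ≤ C₂ * (N / √y) / (μ i / M + (μ i / M)⁻¹) ^ 4 / μ i * (C₃ * E (μ i)) :=
                mul_le_mul b1 (mul_le_mul_of_nonneg_left (hEA i) hC₃.le)
                  (mul_nonneg hC₃.le (hE0 _ (by positivity))) (by positivity)
            _ = C₂ * C₃ * (N / √y) * (E (μ i) / (μ i / M + (μ i / M)⁻¹) ^ 4 / μ i) := by ring
            _ ≤ C₂ * C₃ * (N / √y) * (4 * E M / M * (M ^ 2 / (M + μ i) ^ 2)) :=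
                mul_le_mul_of_nonneg_left (hE2 i) (by positivity)
            _ ≤ C₂ * C₃ * (N / √y) * (4 * E M / M * (M ^ 2 / (M + (i + 1)) ^ 2)) := by
                have := hμ1 i
                gcongr
            _ = _ := by ring
      _ = C₂ * 4 * C₃ * (N / √y) * E M / M * ∑ i ∈ range K, M ^ 2 / (M + (i + 1)) ^ 2 := by
          rw [mul_sum]
      _ ≤ C₂ * 4 * C₃ * (N / √y) * E M / M * M :=
          mul_le_mul_of_nonneg_left (sum_sq_div_add_sq_le hM0 K) (by positivity)
      _ = _ := by field_simp
  calc _ ≤ 2 * C₁ * C₃ * (N / √y) * E M + C₂ * 4 * C₃ * (N / √y) * E M :=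
        add_le_add hfirst hsecond
    _ = _ := by ring

/-- The smooth weight `u ↦ u^(-1/2) exp (-N/u - u/N)`, vanishing for `u ≤ 0`. -/
noncomputable def smoothWeight (N u : ℝ) : ℝ := 1 / √u * Real.exp (-N / u - u / N)

lemma smoothWeight_nonneg (N u : ℝ) : 0 ≤ smoothWeight N u := by
  unfold smoothWeight
  positivity

lemma smoothWeight_of_nonpos (N : ℝ) {u : ℝ} (hu : u ≤ 0) : smoothWeight N u = 0 := by
  simp [smoothWeight, Real.sqrt_eq_zero_of_nonpos hu]

lemma smoothWeight_le_sqrt {N : ℝ} (hN : 1 ≤ N) (u : ℝ) : smoothWeight N u ≤ √u := by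
  rcases le_or_gt u 0 with hu | hu
  · rw [smoothWeight_of_nonpos N hu]
    positivity
  have hs : 0 < √u := Real.sqrt_pos.2 hu
  have h1 : Real.exp (-N / u - u / N) ≤ u := by
    have h2 : Real.exp (-N / u - u / N) ≤ Real.exp (-(N / u)) := by
      apply Real.exp_le_exp.2
      have : 0 ≤ u / N := by positivity
      rw [neg_div]
      linarith
    have h3 := exp_neg_mul_pow_le 1 (s := N / u) (by positivity)
    have h4 : 1 / u ≤ N / u := by gcongr
    have h5 : 1 / u * Real.exp (-(N / u)) ≤ 1 := by
      refine le_trans (mul_le_mul_of_nonneg_right h4 (by positivity)) ?_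
      simpa using h3
    have h6 : Real.exp (-(N / u)) ≤ u := by
      rw [one_div_mul_eq_div, div_le_one hu] at h5
      exact h5
    exact h2.trans h6
  calc smoothWeight N u ≤ 1 / √u * u := by unfold smoothWeight; gcongr
    _ = √u := by
      rw [one_div_mul_eq_div, div_eq_iff hs.ne', Real.mul_self_sqrt hu.le]

lemma smoothWeight_le_div_sq {N u : ℝ} (hN : 1 ≤ N) (hu : 1 ≤ u) :
    smoothWeight N u ≤ 2 * N ^ 2 / u ^ 2 := by
  have hs : 1 ≤ √u := Real.one_le_sqrt.2 hu
  have h1 : 1 / √u ≤ 1 := by rw [div_le_one (by positivity)]; exact hs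
  have h2 : Real.exp (-N / u - u / N) ≤ Real.exp (-(u / N)) := by
    apply Real.exp_le_exp.2
    have : 0 ≤ N / u := by positivity
    rw [neg_div]
    linarith
  have h3 := exp_neg_mul_pow_le 2 (s := u / N) (by positivity)
  have h4 : Real.exp (-(u / N)) ≤ 2 * N ^ 2 / u ^ 2 := by
    rw [div_pow, Nat.factorial_two] at h3
    rw [le_div_iff₀ (by positivity)]
    rw [div_mul_eq_mul_div, div_le_iff₀ (by positivity)] at h3
    push_cast at h3
    linarith
  calc smoothWeight N u ≤ 1 * Real.exp (-(u / N)) := by unfold smoothWeight; gcongr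
    _ ≤ _ := by rw [one_mul]; exact h4

lemma summable_inv_add_one_sq : Summable fun n : ℕ => 1 / ((n : ℝ) + 1) ^ 2 := by
  have := (summable_nat_add_iff 1).2 (Real.summable_one_div_nat_pow.2 (by norm_num : 1 < 2))
  simpa using this

lemma summable_smoothWeight {N : ℝ} (hN : 1 ≤ N) :
    Summable fun n : ℕ => smoothWeight N (n + 1) := by
  refine Summable.of_nonneg_of_le (fun n => smoothWeight_nonneg _ _)
    (fun n => smoothWeight_le_div_sq hN (by simp)) ?_
  have := summable_inv_add_one_sq.mul_left (2 * N ^ 2)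
  refine this.congr fun n => ?_
  ring

/-- The smoothed exponential with phase `y / u + θ u`. -/
noncomputable def smoothPhase (N y θ u : ℝ) : ℂ :=
  (smoothWeight N u : ℂ) * (expTwoPi (y / u) * expTwoPi (θ * u))

lemma norm_smoothPhase (N y θ u : ℝ) : ‖smoothPhase N y θ u‖ = smoothWeight N u := by
  rw [smoothPhase, norm_mul, norm_mul, norm_expTwoPi, norm_expTwoPi, mul_one, mul_one,
    Complex.norm_real, Real.norm_of_nonneg (smoothWeight_nonneg _ _)]

lemma continuous_expTwoPi : Continuous expTwoPi := by
  unfold expTwoPi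
  fun_prop

lemma continuous_smoothPhase {N : ℝ} (hN : 1 ≤ N) (y θ : ℝ) : Continuous (smoothPhase N y θ) := by
  rw [continuous_iff_continuousAt]
  intro u
  rcases eq_or_ne u 0 with rfl | hu
  · have h0 : smoothPhase N y θ 0 = 0 := by
      simp [smoothPhase, smoothWeight_of_nonpos]
    rw [ContinuousAt, h0]
    apply squeeze_zero_norm (a := fun u => √u)
    · intro u
      rw [norm_smoothPhase]
      exact smoothWeight_le_sqrt hN u
    · have := Real.continuous_sqrt.tendsto 0
      rwa [Real.sqrt_zero] at this
  · rcases lt_or_gt_of_ne hu with h | h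
    · have : smoothPhase N y θ =ᶠ[nhds u] fun _ => 0 := by
        filter_upwards [gt_mem_nhds h] with v hv
        simp [smoothPhase, smoothWeight_of_nonpos N (le_of_lt hv)]
      exact (continuousAt_congr this).2 continuousAt_const
    · have hs : √u ≠ 0 := (Real.sqrt_pos.2 h).ne'
      unfold smoothPhase
      have h1 : ContinuousAt (fun u : ℝ => smoothWeight N u) u := by
        unfold smoothWeight
        fun_prop (disch := assumption)
      have h2 : ContinuousAt (fun u : ℝ => expTwoPi (y / u)) u :=
        continuous_expTwoPi.continuousAt.comp (f := fun u : ℝ => y / u)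
          (by fun_prop (disch := assumption))
      have h3 : ContinuousAt (fun u : ℝ => expTwoPi (θ * u)) u :=
        continuous_expTwoPi.continuousAt.comp (f := fun u : ℝ => θ * u) (by fun_prop)
      exact (Complex.continuous_ofReal.continuousAt.comp h1).mul (h2.mul h3)

lemma isBigO_smoothPhase {N : ℝ} (hN : 1 ≤ N) (y θ : ℝ) :
    smoothPhase N y θ =O[Filter.cocompact ℝ] fun x : ℝ => |x| ^ (-2 : ℝ) := by
  refine Asymptotics.IsBigO.of_bound (2 * N ^ 2) ?_
  have : ∀ᶠ x : ℝ in Filter.cocompact ℝ, 1 ≤ ‖x‖ :=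
    (tendsto_norm_cocompact_atTop (E := ℝ)).eventually (Filter.eventually_ge_atTop 1)
  filter_upwards [this] with x hx
  rw [norm_smoothPhase]
  rcases le_or_gt x 0 with h | h
  · rw [smoothWeight_of_nonpos N h]
    positivity
  · rw [Real.norm_of_nonneg h.le] at hx
    refine (smoothWeight_le_div_sq hN hx).trans (le_of_eq ?_)
    rw [abs_of_pos h, Real.norm_of_nonneg (by positivity), Real.rpow_neg h.le,
      show (2:ℝ) = ((2:ℕ):ℝ) by norm_num, Real.rpow_natCast]
    rfl

lemma fourier_smoothPhase {N : ℝ} (hN : 1 ≤ N) (y θ m : ℝ) :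
    FourierTransform.fourier (smoothPhase N y θ) m = dualTerm N y (θ - m) := by
  have hN0 : 0 < N := by linarith
  rw [Real.fourier_real_eq_integral_exp_smul, dualTerm,
    ← integral_inv_sqrt_mul_cexp hN0 (by positivity : 0 < 1 / N),
    ← MeasureTheory.integral_indicator measurableSet_Ioi]
  congr 1
  ext u
  by_cases hu : 0 < u
  · rw [Set.indicator_of_mem (Set.mem_Ioi.2 hu), smoothPhase, smoothWeight, expTwoPi, expTwoPi,
      smul_eq_mul, ofReal_mul (1 / √u), ofReal_exp]
    have hu' : (u : ℂ) ≠ 0 := by exact_mod_cast hu.ne'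
    have hN' : (N : ℂ) ≠ 0 := by exact_mod_cast hN0.ne'
    rw [mul_comm, mul_assoc, mul_assoc, mul_assoc, ← Complex.exp_add, ← Complex.exp_add,
      ← Complex.exp_add]
    congr 2
    push_cast
    field_simp
    ring
  · rw [Set.indicator_of_notMem (by simpa using hu), smoothPhase,
      smoothWeight_of_nonpos N (not_lt.1 hu)]
    simp

lemma summable_dualTerm_nat {N y θ : ℝ} (hN : 1 ≤ N) (hy : N ^ 2 ≤ y) (hθ : 0 ≤ θ) :
    Summable fun n : ℕ => dualTerm N y (n + 1 + θ) := by
  obtain ⟨C, hC, h⟩ := exists_norm_dualTerm_mul_le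
  have hy0 : 0 < y := by nlinarith
  have hN0 : 0 < N := by linarith
  have hsy : 0 < √y := Real.sqrt_pos.2 hy0
  refine Summable.of_norm_bounded (g := fun n : ℕ =>
    2 * (C * (N / √y) / (N ^ 2 / y) ^ 4) * (1 / ((n : ℝ) + 1) ^ 2))
    (summable_inv_add_one_sq.mul_left _) fun n => ?_
  have hμ : (1:ℝ) ≤ n + 1 + θ := by
    have : (0:ℝ) ≤ n := by positivity
    linarith
  have h1 := h N y (n + 1 + θ) hN hy hμ
  set μ : ℝ := n + 1 + θ with hμd
  have hμ0 : 0 < μ := by linarith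
  have hn1 : (n:ℝ) + 1 ≤ μ := by linarith
  have h2 : ‖dualTerm N y μ‖ * (1 / 2) ≤ C * (N / √y) / (μ * N ^ 2 / y) ^ 4 := by
    refine le_trans (mul_le_mul_of_nonneg_left ?_ (norm_nonneg _)) (h1.trans ?_)
    · have : 0 ≤ N * √μ / √y + √y / (N * √μ) := by positivity
      linarith
    · gcongr
      have : 0 ≤ y / (μ * N ^ 2) := by positivity
      linarith
  have h3 : C * (N / √y) / (μ * N ^ 2 / y) ^ 4
      = C * (N / √y) / (N ^ 2 / y) ^ 4 * (1 / μ ^ 4) := by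
    rw [mul_div_assoc μ, mul_pow]
    field_simp
  have h4 : 1 / μ ^ 4 ≤ 1 / ((n:ℝ) + 1) ^ 2 := by
    have : ((n:ℝ) + 1) ^ 2 ≤ μ ^ 2 := by gcongr
    have : μ ^ 2 ≤ μ ^ 4 := pow_le_pow_right₀ hμ (by norm_num)
    gcongr
    linarith
  have h5 : C * (N / √y) / (N ^ 2 / y) ^ 4 * (1 / μ ^ 4)
      ≤ C * (N / √y) / (N ^ 2 / y) ^ 4 * (1 / ((n:ℝ) + 1) ^ 2) := by gcongr
  linarith

lemma norm_dualTerm_sub_nat_le {N y θ : ℝ} (hN : 1 ≤ N) (hy : N ^ 2 ≤ y) (hθ : θ < 1) (n : ℕ) :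
    ‖dualTerm N y (θ - (n + 1))‖ ≤ √Real.pi * (1 / ((n : ℝ) + 1) ^ 2) := by
  rw [mul_one_div]
  have : (0:ℝ) ≤ n := by positivity
  exact norm_dualTerm_le_of_nonpos hN hy (by linarith) n (by linarith)

lemma tsum_smoothPhase {N y θ : ℝ} (hN : 1 ≤ N) (hy : N ^ 2 ≤ y) (hθ : 0 ≤ θ) (hθ1 : θ < 1) :
    ∑' n : ℕ, smoothPhase N y θ (n + 1) = ∑' n : ℕ, dualTerm N y (θ - (n + 1)) + dualTerm N y θ
      + ∑' n : ℕ, dualTerm N y (n + 1 + θ) := by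
  have hneg : Summable fun n : ℕ => dualTerm N y (θ - (n + 1)) :=
    Summable.of_norm_bounded (summable_inv_add_one_sq.mul_left _)
      (norm_dualTerm_sub_nat_le hN hy hθ1)
  have hpos := summable_dualTerm_nat hN hy hθ
  have hdual : HasSum (fun n : ℤ => dualTerm N y (θ - n))
      (∑' n : ℕ, dualTerm N y (θ - (n + 1)) + dualTerm N y θ
        + ∑' n : ℕ, dualTerm N y (n + 1 + θ)) := by
    have := HasSum.of_add_one_of_neg_add_one (f := fun n : ℤ => dualTerm N y (θ - n))
      (m := ∑' n : ℕ, dualTerm N y (θ - (n + 1))) (m' := ∑' n : ℕ, dualTerm N y (n + 1 + θ))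
      (by simpa using hneg.hasSum) (by
        have : (fun n : ℕ => dualTerm N y (θ - ((-((n:ℤ) + 1) : ℤ) : ℝ)))
            = fun n : ℕ => dualTerm N y (n + 1 + θ) := by
          ext n
          congr 1
          push_cast
          ring
        rw [this]
        exact hpos.hasSum)
    simpa using this
  have hleft : HasSum (fun n : ℤ => smoothPhase N y θ n) (∑' n : ℕ, smoothPhase N y θ (n + 1)) := by
    have h0 : ∀ u : ℝ, u ≤ 0 → smoothPhase N y θ u = 0 := fun u hu => by
      simp [smoothPhase, smoothWeight_of_nonpos N hu]
    have hs : Summable fun n : ℕ => smoothPhase N y θ (n + 1) :=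
      Summable.of_norm ((summable_smoothWeight hN).congr fun n => (norm_smoothPhase _ _ _ _).symm)
    have := HasSum.of_add_one_of_neg_add_one (f := fun n : ℤ => smoothPhase N y θ n)
      (m := ∑' n : ℕ, smoothPhase N y θ (n + 1)) (m' := 0)
      (by simpa using hs.hasSum) (by
        have : (fun n : ℕ => smoothPhase N y θ ((-((n:ℤ) + 1) : ℤ) : ℝ)) = fun _ => 0 := by
          ext n
          refine h0 _ ?_
          push_cast
          have : (0:ℝ) ≤ n := by positivity
          linarith
        rw [this]
        exact hasSum_zero)
    simpa [h0 0 le_rfl] using this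
  have hF : (fun n : ℤ => FourierTransform.fourier (smoothPhase N y θ) (n : ℝ))
      = fun n : ℤ => dualTerm N y (θ - n) := by
    ext n
    rw [fourier_smoothPhase hN]
  have hP := Real.tsum_eq_tsum_fourier_of_rpow_decay_of_summable (continuous_smoothPhase hN y θ)
    (by norm_num) (isBigO_smoothPhase hN y θ) (by rw [hF]; exact hdual.summable) 0
  rw [← hleft.tsum_eq, ← hdual.tsum_eq, ← hF]
  simpa using hP

/-- Bound for the smoothed sum with phase `y / n + θ n`. -/
lemma exists_norm_tsum_smoothPhase_le : ∃ C : ℝ, 0 < C ∧ ∀ N y θ : ℝ, 1 ≤ N → N ^ 2 ≤ y → 0 ≤ θ →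
    θ < 1 → ‖∑' n : ℕ, smoothPhase N y θ (n + 1)‖
      ≤ C * (N / √y) * ((y / N ^ 2) ^ ((17:ℝ) / 20) * y ^ ((1:ℝ) / 60)
        + (y / N ^ 2) ^ ((41:ℝ) / 40) * y ^ (-(1:ℝ) / 60)) := by
  obtain ⟨C, hC, h⟩ := exists_norm_sum_dualTerm_le
  set K : ℝ := ∑' n : ℕ, 1 / ((n : ℝ) + 1) ^ 2 with hK
  have hK0 : 0 ≤ K := tsum_nonneg fun n => by positivity
  have hπ : 0 < √Real.pi := Real.sqrt_pos.2 Real.pi_pos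
  refine ⟨√Real.pi * K + √Real.pi + C, by positivity, fun N y θ hN hy hθ hθ1 => ?_⟩
  have hN0 : 0 < N := by linarith
  have hy1 : 1 ≤ y := by nlinarith
  have hy0 : 0 < y := by linarith
  rw [tsum_smoothPhase hN hy hθ hθ1]
  set E := (y / N ^ 2) ^ ((17:ℝ) / 20) * y ^ ((1:ℝ) / 60)
        + (y / N ^ 2) ^ ((41:ℝ) / 40) * y ^ (-(1:ℝ) / 60) with hE
  have hM1 : 1 ≤ y / N ^ 2 := by rw [le_div_iff₀ (by positivity)]; linarith
  have hE1 : 1 ≤ N / √y * E := by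
    have e1 : N / √y = (y / N ^ 2) ^ (-(1:ℝ) / 2) := by
      rw [neg_div, Real.rpow_neg (by positivity), ← Real.sqrt_eq_rpow, Real.sqrt_div hy0.le,
        Real.sqrt_sq hN0.le, inv_div]
    have e2 : 1 ≤ (y / N ^ 2) ^ (-(1:ℝ) / 2) * (y / N ^ 2) ^ ((17:ℝ) / 20) := by
      rw [← Real.rpow_add (by positivity)]
      exact Real.one_le_rpow hM1 (by norm_num)
    have e3 : 1 ≤ y ^ ((1:ℝ) / 60) := Real.one_le_rpow hy1 (by norm_num)
    rw [hE, e1, mul_add, ← mul_assoc]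
    have : 0 ≤ (y / N ^ 2) ^ (-(1:ℝ) / 2) * ((y / N ^ 2) ^ ((41:ℝ) / 40) * y ^ (-(1:ℝ) / 60)) := by
      positivity
    have := one_le_mul_of_one_le_of_one_le e2 e3
    linarith
  have h1 : ‖∑' n : ℕ, dualTerm N y (θ - (n + 1))‖ ≤ √Real.pi * K := by
    refine tsum_of_norm_bounded ?_ (norm_dualTerm_sub_nat_le hN hy hθ1)
    exact summable_inv_add_one_sq.hasSum.mul_left _
  have h2 := norm_dualTerm_le_of_nonneg hN hy hθ
  have h3 : ‖∑' n : ℕ, dualTerm N y (n + 1 + θ)‖ ≤ C * (N / √y) * E :=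
    le_of_tendsto (summable_dualTerm_nat hN hy hθ).hasSum.tendsto_sum_nat.norm
      (Filter.Eventually.of_forall fun L => h N y θ hN hy hθ hθ1 L)
  calc _ ≤ √Real.pi * K + √Real.pi + C * (N / √y) * E :=
        (norm_add_le _ _).trans (add_le_add ((norm_add_le _ _).trans (add_le_add h1 h2)) h3)
    _ ≤ (√Real.pi * K + √Real.pi) * (N / √y * E) + C * (N / √y) * E := by
        have := le_mul_of_one_le_right (by positivity : 0 ≤ √Real.pi * K + √Real.pi) hE1
        linarith
    _ = _ := by ring

lemma integral_expTwoPi_mul_int (j : ℤ) :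
    ∫ θ in (0:ℝ)..1, expTwoPi (θ * j) = if j = 0 then 1 else 0 := by
  split_ifs with hj
  · subst hj
    simp [expTwoPi_zero]
  · have hc : (2 * Real.pi * j * I : ℂ) ≠ 0 := by
      have : (Real.pi : ℂ) ≠ 0 := by exact_mod_cast Real.pi_ne_zero
      have : (j : ℂ) ≠ 0 := by exact_mod_cast hj
      simp_all
    have h1 : (fun θ : ℝ => expTwoPi (θ * j)) = fun θ : ℝ => Complex.exp (2 * Real.pi * j * I * θ) := by
      ext θ
      rw [expTwoPi]
      push_cast
      ring_nf
    rw [h1, integral_exp_mul_complex hc]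
    have h2 : Complex.exp (2 * Real.pi * j * I * (1:ℝ)) = 1 := by
      rw [Complex.exp_eq_one_iff]
      exact ⟨j, by push_cast; ring⟩
    rw [h2]
    simp

lemma integral_tsum_mul_sum_expTwoPi {c : ℕ → ℂ} (hc : Summable fun n => ‖c n‖) (s : Finset ℕ) :
    ∫ θ in (0:ℝ)..1, (∑' n : ℕ, c n * expTwoPi (θ * (n + 1))) * ∑ k ∈ s, expTwoPi (-(θ * (k + 1)))
      = ∑ n ∈ s, c n := by
  set D : ℝ → ℂ := fun θ => ∑ k ∈ s, expTwoPi (-(θ * (k + 1))) with hD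
  have hDc : Continuous D := by
    refine continuous_finsetSum _ fun k _ => continuous_expTwoPi.comp (by fun_prop)
  have hDn : ∀ θ, ‖D θ‖ ≤ s.card := fun θ => by
    refine (norm_sum_le _ _).trans (le_of_eq ?_)
    simp [norm_expTwoPi]
  have h1 := intervalIntegral.hasSum_integral_of_dominated_convergence (a := 0) (b := 1)
    (μ := MeasureTheory.volume) (F := fun (n : ℕ) (θ : ℝ) => c n * expTwoPi (θ * (n + 1)) * D θ)
    (f := fun θ => (∑' n : ℕ, c n * expTwoPi (θ * (n + 1))) * D θ)
    (fun n _ => ‖c n‖ * s.card)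
    (fun n => by
      have : Continuous fun θ : ℝ => expTwoPi (θ * (n + 1)) :=
        continuous_expTwoPi.comp (by fun_prop)
      exact ((continuous_const.mul this).mul hDc).aestronglyMeasurable)
    (fun n => Filter.Eventually.of_forall fun θ _ => by
      rw [norm_mul, norm_mul, norm_expTwoPi, mul_one]
      exact mul_le_mul_of_nonneg_left (hDn θ) (norm_nonneg _))
    (Filter.Eventually.of_forall fun θ _ => hc.mul_right _)
    intervalIntegrable_const
    (Filter.Eventually.of_forall fun θ _ => by
      refine HasSum.mul_right _ (Summable.hasSum (Summable.of_norm (hc.congr fun n => ?_)))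
      rw [norm_mul, norm_expTwoPi, mul_one])
  rw [← h1.tsum_eq]
  have h2 : ∀ n : ℕ, ∫ θ in (0:ℝ)..1, c n * expTwoPi (θ * (n + 1)) * D θ
      = if n ∈ s then c n else 0 := by
    intro n
    have e1 : ∀ θ : ℝ, c n * expTwoPi (θ * (n + 1)) * D θ
        = ∑ k ∈ s, c n * expTwoPi (θ * ((n - k : ℤ) : ℝ)) := by
      intro θ
      rw [hD, mul_sum]
      refine sum_congr rfl fun k _ => ?_
      rw [mul_assoc, ← expTwoPi_add]
      congr 2
      push_cast
      ring
    simp_rw [e1]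
    rw [intervalIntegral.integral_finsetSum fun k _ => ?_]
    · simp_rw [intervalIntegral.integral_const_mul, integral_expTwoPi_mul_int]
      simp [sub_eq_zero]
    · refine Continuous.intervalIntegrable (continuous_const.mul ?_) _ _
      exact continuous_expTwoPi.comp (by fun_prop)
  simp_rw [h2]
  rw [tsum_eq_sum (s := s) (fun n hn => by simp [hn])]
  exact sum_congr rfl fun n hn => by simp [hn]

lemma le_two_div_add {d L θ : ℝ} (hL : 0 < L) (hθ : 0 ≤ θ) (h1 : d ≤ L)
    (h2 : d * (2 * θ) ≤ 1) : d ≤ 2 / (1 / L + 2 * θ) := by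
  rw [le_div_iff₀ (by positivity), mul_add, mul_one_div]
  have : d / L ≤ 1 := by rw [div_le_one hL]; exact h1
  linarith

/-- Pointwise bound for the Dirichlet kernel on the unit interval. -/
lemma norm_sum_expTwoPi_neg_le {θ : ℝ} (h0 : 0 ≤ θ) (h1 : θ ≤ 1) (a L : ℕ) (hL : 0 < L) :
    ‖∑ i ∈ range L, expTwoPi (-(θ * ((a + i : ℕ) + 1)))‖
      ≤ 2 / (1 / L + 2 * θ) + 2 / (1 / L + 2 * (1 - θ)) := by
  set d := ‖∑ i ∈ range L, expTwoPi (-(θ * ((a + i : ℕ) + 1)))‖ with hd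
  have hd0 : 0 ≤ d := norm_nonneg _
  have hLr : (0:ℝ) < L := by exact_mod_cast hL
  have hdL : d ≤ L := by
    refine (norm_sum_le _ _).trans (le_of_eq ?_)
    simp [norm_expTwoPi]
  have hgeom : d * (2 * |Real.sin (Real.pi * θ)|) ≤ 2 := by
    have e1 : (∑ i ∈ range L, expTwoPi (-(θ * ((a + i : ℕ) + 1)))) * (expTwoPi (-θ) - 1)
        = expTwoPi (-(θ * ((a + L : ℕ) + 1))) - expTwoPi (-(θ * ((a + 0 : ℕ) + 1))) := by
      rw [← sum_range_sub (fun i : ℕ => expTwoPi (-(θ * ((a + i : ℕ) + 1)))), sum_mul]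
      refine sum_congr rfl fun i _ => ?_
      rw [mul_sub, ← expTwoPi_add, mul_one]
      congr 2
      push_cast
      ring
    have e2 := congrArg norm e1
    rw [norm_mul, norm_expTwoPi_sub_one, mul_neg, Real.sin_neg, abs_neg] at e2
    rw [e2]
    refine (norm_sub_le _ _).trans (le_of_eq ?_)
    rw [norm_expTwoPi, norm_expTwoPi]
    norm_num
  have hπ := Real.pi_pos
  have hsin : ∀ φ : ℝ, 0 ≤ φ → φ ≤ 1 / 2 → 2 * φ ≤ Real.sin (Real.pi * φ) := by
    intro φ hφ hφ2
    have := Real.mul_le_sin (x := Real.pi * φ) (by positivity) (by nlinarith)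
    calc 2 * φ = 2 / Real.pi * (Real.pi * φ) := by field_simp
      _ ≤ _ := this
  rcases le_total θ (1 / 2) with h | h
  · have h3 := (hsin θ h0 h).trans (le_abs_self _)
    have h4 := mul_le_mul_of_nonneg_left h3 hd0
    have : 0 ≤ 2 / (1 / (L:ℝ) + 2 * (1 - θ)) := by
      have : 0 ≤ 1 - θ := by linarith
      positivity
    have := le_two_div_add hLr h0 hdL (by linarith)
    linarith
  · have h3 := hsin (1 - θ) (by linarith) (by linarith)
    have e : Real.sin (Real.pi * (1 - θ)) = Real.sin (Real.pi * θ) := by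
      rw [mul_sub, mul_one, Real.sin_pi_sub]
    rw [e] at h3
    have h4 := mul_le_mul_of_nonneg_left (h3.trans (le_abs_self _)) hd0
    have : 0 ≤ 2 / (1 / (L:ℝ) + 2 * θ) := by positivity
    have := le_two_div_add hLr (by linarith : 0 ≤ 1 - θ) hdL (by linarith)
    linarith

lemma integral_two_div_add (c : ℝ) (hc : 0 < c) :
    ∫ θ in (0:ℝ)..1, 2 / (c + 2 * θ) = Real.log (1 + 2 / c) := by
  have h := intervalIntegral.integral_eq_sub_of_hasDerivAt (a := 0) (b := 1)
    (f := fun θ : ℝ => Real.log (c + 2 * θ)) (f' := fun θ => 2 / (c + 2 * θ)) (fun θ hθ => ?_) ?_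
  · rw [h, ← Real.log_div (by positivity) (by positivity)]
    congr 1
    field_simp
    ring
  · rw [Set.uIcc_of_le zero_le_one] at hθ
    have := hθ.1
    have h1 : HasDerivAt (fun θ : ℝ => c + 2 * θ) 2 θ := by
      simpa using ((hasDerivAt_id θ).const_mul 2).const_add c
    exact h1.log (by positivity)
  · refine ContinuousOn.intervalIntegrable fun θ hθ => ?_
    rw [Set.uIcc_of_le zero_le_one] at hθ
    have := hθ.1
    have : c + 2 * θ ≠ 0 := by positivity
    exact ContinuousAt.continuousWithinAt (by fun_prop (disch := assumption))

lemma intervalIntegrable_two_div_add (c : ℝ) (hc : 0 < c) :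
    IntervalIntegrable (fun θ : ℝ => 2 / (c + 2 * θ)) MeasureTheory.volume 0 1 := by
  refine ContinuousOn.intervalIntegrable fun θ hθ => ?_
  rw [Set.uIcc_of_le zero_le_one] at hθ
  have := hθ.1
  have : c + 2 * θ ≠ 0 := by positivity
  exact ContinuousAt.continuousWithinAt (by fun_prop (disch := assumption))

/-- A short sum of coefficients is controlled by the supremum of the trigonometric series. -/
lemma norm_sum_le_of_norm_tsum_expTwoPi_le {c : ℕ → ℂ} (hc : Summable fun n => ‖c n‖) {B : ℝ}
    (hB : ∀ θ : ℝ, 0 ≤ θ → θ < 1 → ‖∑' n : ℕ, c n * expTwoPi (θ * (n + 1))‖ ≤ B)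
    (a L : ℕ) : ‖∑ i ∈ range L, c (a + i)‖ ≤ 2 * B * Real.log (1 + 2 * L) := by
  rcases Nat.eq_zero_or_pos L with rfl | hL
  · simp
  have hLr : (0:ℝ) < L := by exact_mod_cast hL
  have hB0 : 0 ≤ B := (norm_nonneg _).trans (hB 0 le_rfl zero_lt_one)
  have h1 := integral_tsum_mul_sum_expTwoPi hc (Ico a (a + L))
  simp only [sum_Ico_eq_sum_range, Nat.add_sub_cancel_left] at h1
  rw [← h1]
  have i1 := intervalIntegrable_two_div_add (1 / (L:ℝ)) (by positivity)
  have i2 : IntervalIntegrable (fun θ : ℝ => 2 / (1 / (L:ℝ) + 2 * (1 - θ))) MeasureTheory.volume 0 1 := by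
    have := (i1.comp_sub_left 1).symm
    simpa using this
  refine (intervalIntegral.norm_integral_le_of_norm_le (g := fun θ => B *
    (2 / (1 / (L:ℝ) + 2 * θ) + 2 / (1 / (L:ℝ) + 2 * (1 - θ)))) zero_le_one ?_
    ((i1.add i2).const_mul B)).trans (le_of_eq ?_)
  · have hne : ∀ᵐ θ : ℝ, θ ≠ 1 := by simp [MeasureTheory.ae_iff]
    filter_upwards [hne] with θ hθ1 hθ
    rw [norm_mul]
    exact mul_le_mul (hB θ hθ.1.le (lt_of_le_of_ne hθ.2 hθ1))
      (norm_sum_expTwoPi_neg_le hθ.1.le hθ.2 a L hL) (norm_nonneg _) hB0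
  · rw [intervalIntegral.integral_const_mul, intervalIntegral.integral_add i1 i2,
      intervalIntegral.integral_comp_sub_left (fun θ => 2 / (1 / (L:ℝ) + 2 * θ)) 1]
    rw [sub_self, sub_zero, integral_two_div_add _ (by positivity)]
    rw [div_div_eq_mul_div, div_one]
    ring

lemma inv_smoothWeight (N u : ℝ) :
    (smoothWeight N u)⁻¹ = √u * Real.exp (N / u + u / N) := by
  rw [smoothWeight, mul_inv, one_div, inv_inv, ← Real.exp_neg]
  congr 2
  ring

lemma smoothWeight_pos {N u : ℝ} (hu : 0 < u) : 0 < smoothWeight N u := by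
  have := Real.sqrt_pos.2 hu
  unfold smoothWeight
  positivity

lemma inv_smoothWeight_mono {N u v : ℝ} (hN : 0 < N) (hu : N ≤ u) (huv : u ≤ v) :
    (smoothWeight N u)⁻¹ ≤ (smoothWeight N v)⁻¹ := by
  have hu0 : 0 < u := by linarith
  have hv0 : 0 < v := by linarith
  rw [inv_smoothWeight, inv_smoothWeight]
  have h : N / u + u / N ≤ N / v + v / N := by
    have : N / v + v / N - (N / u + u / N) = (v - u) * (u * v - N * N) / (N * u * v) := by
      field_simp
      ring
    have h2 : 0 ≤ (v - u) * (u * v - N * N) / (N * u * v) := by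
      have : N * N ≤ u * v := by nlinarith
      have : 0 ≤ u * v - N * N := by linarith
      have : 0 ≤ v - u := by linarith
      positivity
    linarith
  gcongr

lemma inv_smoothWeight_le {N u : ℝ} (hN : 0 < N) (hu : N ≤ u) (hu2 : u ≤ 2 * N) :
    (smoothWeight N u)⁻¹ ≤ √2 * Real.exp 3 * √N := by
  have hu0 : 0 < u := by linarith
  rw [inv_smoothWeight]
  have h1 : √u ≤ √2 * √N := by
    rw [← Real.sqrt_mul (by norm_num)]
    exact Real.sqrt_le_sqrt hu2
  have h2 : N / u + u / N ≤ 3 := by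
    have : N / u ≤ 1 := by rw [div_le_one hu0]; exact hu
    have : u / N ≤ 2 := by rw [div_le_iff₀ hN]; exact hu2
    linarith
  calc √u * Real.exp (N / u + u / N) ≤ √2 * √N * Real.exp 3 := by gcongr
    _ = _ := by ring

lemma log_one_add_four_mul_le {N : ℝ} (hN : 1 ≤ N) : Real.log (1 + 4 * N) ≤ 2 * (1 + Real.log N) := by
  have h1 : Real.log (1 + 4 * N) ≤ Real.log (Real.exp 2 * N) := by
    apply Real.log_le_log (by linarith)
    have : 5 ≤ Real.exp 2 := by
      have := Real.exp_one_gt_d9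
      have e : Real.exp 2 = Real.exp 1 * Real.exp 1 := by rw [← Real.exp_add]; norm_num
      rw [e]
      nlinarith
    nlinarith
  rw [Real.log_mul (Real.exp_pos 2).ne' (by linarith), Real.log_exp] at h1
  have := Real.log_nonneg hN
  linarith

/-- Bound for exponential sums with phase `y / n` over a dyadic block. -/
lemma exists_norm_sum_expTwoPi_div_le : ∃ C : ℝ, 0 < C ∧ ∀ N y : ℝ, 1 ≤ N → N ^ 2 ≤ y →
    ∀ a L : ℕ, N ≤ a → (a : ℝ) + L ≤ 2 * N + 1 →
    ‖∑ i ∈ range L, expTwoPi (y / (a + i : ℕ))‖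
      ≤ C * (1 + Real.log N) * (N ^ (-(1:ℝ) / 5) * y ^ ((11:ℝ) / 30)
        + N ^ (-(11:ℝ) / 20) * y ^ ((61:ℝ) / 120)) := by
  obtain ⟨C, hC, h⟩ := exists_norm_tsum_smoothPhase_le
  refine ⟨C * (8 * (√2 * Real.exp 3)), by positivity, fun N y hN hy a L ha hL => ?_⟩
  have hN0 : 0 < N := by linarith
  have hy0 : 0 < y := by nlinarith
  have hlog := Real.log_nonneg hN
  set E := (y / N ^ 2) ^ ((17:ℝ) / 20) * y ^ ((1:ℝ) / 60)
        + (y / N ^ 2) ^ ((41:ℝ) / 40) * y ^ (-(1:ℝ) / 60) with hE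
  set B := C * (N / √y) * E with hB
  have hB0 : 0 ≤ B := by positivity
  have hconv : √N * (N / √y * E) = N ^ (-(1:ℝ) / 5) * y ^ ((11:ℝ) / 30)
        + N ^ (-(11:ℝ) / 20) * y ^ ((61:ℝ) / 120) := by
    have hs : ∀ c : ℝ, (y / N ^ 2) ^ c = y ^ c * N ^ (-(2 * c)) := by
      intro c
      rw [Real.div_rpow hy0.le (by positivity), ← Real.rpow_natCast, ← Real.rpow_mul hN0.le,
        Real.rpow_neg hN0.le, div_eq_mul_inv]
      norm_num
    have e1 : √N * (N / √y) = N ^ ((3:ℝ) / 2) * y ^ (-(1:ℝ) / 2) := by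
      rw [neg_div, Real.rpow_neg hy0.le, ← Real.sqrt_eq_rpow,
        show (3:ℝ) / 2 = 1 / 2 + 1 by norm_num, Real.rpow_add hN0, Real.rpow_one,
        ← Real.sqrt_eq_rpow]
      ring
    rw [← mul_assoc, e1, hE, hs, hs]
    have p1 : N ^ (-(1:ℝ) / 5) = N ^ ((3:ℝ) / 2) * N ^ (-(2 * ((17:ℝ) / 20))) := by
      rw [← Real.rpow_add hN0]; norm_num
    have p2 : N ^ (-(11:ℝ) / 20) = N ^ ((3:ℝ) / 2) * N ^ (-(2 * ((41:ℝ) / 40))) := by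
      rw [← Real.rpow_add hN0]; norm_num
    have p3 : y ^ ((11:ℝ) / 30) = y ^ (-(1:ℝ) / 2) * y ^ ((17:ℝ) / 20) * y ^ ((1:ℝ) / 60) := by
      rw [← Real.rpow_add hy0, ← Real.rpow_add hy0]; norm_num
    have p4 : y ^ ((61:ℝ) / 120) = y ^ (-(1:ℝ) / 2) * y ^ ((41:ℝ) / 40) * y ^ (-(1:ℝ) / 60) := by
      rw [← Real.rpow_add hy0, ← Real.rpow_add hy0]; norm_num
    rw [p1, p2, p3, p4]
    ring
  rcases L with - | L
  · rw [range_zero, sum_empty, norm_zero]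
    positivity
  obtain ⟨b, rfl⟩ : ∃ b, a = b + 1 := by
    rcases a with - | b
    · exfalso
      push_cast at ha
      linarith
    · exact ⟨b, rfl⟩
  push_cast at ha hL
  set c : ℕ → ℂ := fun n => (smoothWeight N (n + 1) : ℂ) * expTwoPi (y / (n + 1)) with hc
  have hcs : Summable fun n => ‖c n‖ := by
    refine (summable_smoothWeight hN).congr fun n => ?_
    rw [hc, norm_mul, norm_expTwoPi, mul_one, Complex.norm_real,
      Real.norm_of_nonneg (smoothWeight_nonneg _ _)]
  have hpart : ∀ m ≤ L + 1, ‖∑ i ∈ range m, c (b + i)‖ ≤ 4 * B * (1 + Real.log N) := by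
    intro m hm
    have h1 := norm_sum_le_of_norm_tsum_expTwoPi_le hcs (B := B) (fun θ h0 h1 => by
      refine (congrArg norm (tsum_congr fun n => ?_)).trans_le (h N y θ hN hy h0 h1)
      simp only [smoothPhase, hc, mul_assoc]) b m
    have hmr : (m:ℝ) ≤ L + 1 := by exact_mod_cast hm
    have h2 : Real.log (1 + 2 * m) ≤ 2 * (1 + Real.log N) := by
      refine le_trans (Real.log_le_log (by positivity) ?_) (log_one_add_four_mul_le hN)
      linarith
    have h3 := mul_le_mul_of_nonneg_left h2 (by positivity : 0 ≤ 2 * B)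
    linarith
  have hterm : ∀ i : ℕ, expTwoPi (y / (b + 1 + i : ℕ))
      = (((smoothWeight N (b + 1 + i))⁻¹ : ℝ) : ℂ) * c (b + i) := by
    intro i
    have hp : 0 < smoothWeight N (b + 1 + i) := smoothWeight_pos (by positivity)
    have hp' : (smoothWeight N (b + 1 + i) : ℂ) ≠ 0 := by exact_mod_cast hp.ne'
    have e : ((b + i : ℕ) : ℝ) + 1 = b + 1 + i := by push_cast; ring
    have e' : ((b + 1 + i : ℕ) : ℝ) = b + 1 + i := by push_cast; ring
    simp only [hc]
    rw [e, e', ← mul_assoc, ofReal_inv, inv_mul_cancel₀ hp', one_mul]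
  simp_rw [hterm]
  refine (norm_sum_mul_le_of_partial_sums _ _ L _ hpart).trans ?_
  have hinv : ∀ i : ℕ, 0 ≤ (smoothWeight N (b + 1 + i))⁻¹ := fun i => by
    have := smoothWeight_nonneg N (b + 1 + i)
    positivity
  have hvar : ∑ i ∈ range L, ‖(((smoothWeight N (b + 1 + (i + 1 : ℕ)))⁻¹ : ℝ) : ℂ)
      - (((smoothWeight N (b + 1 + i))⁻¹ : ℝ) : ℂ)‖
      ≤ (smoothWeight N (b + 1 + L))⁻¹ := by
    have e : ∀ i ∈ range L, ‖(((smoothWeight N (b + 1 + (i + 1 : ℕ)))⁻¹ : ℝ) : ℂ)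
      - (((smoothWeight N (b + 1 + i))⁻¹ : ℝ) : ℂ)‖
      = (smoothWeight N (b + 1 + (i + 1 : ℕ)))⁻¹ - (smoothWeight N (b + 1 + i))⁻¹ := by
      intro i _
      rw [← ofReal_sub, Complex.norm_real, Real.norm_of_nonneg]
      rw [sub_nonneg]
      refine inv_smoothWeight_mono hN0 ?_ ?_
      · have : (0:ℝ) ≤ i := by positivity
        linarith
      · push_cast
        linarith
    rw [sum_congr rfl e, sum_range_sub (fun i : ℕ => (smoothWeight N (b + 1 + i))⁻¹)]
    have := hinv 0
    linarith
  have hlast : (smoothWeight N (b + 1 + L))⁻¹ ≤ √2 * Real.exp 3 * √N := by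
    refine inv_smoothWeight_le hN0 ?_ (by linarith)
    have : (0:ℝ) ≤ L := by positivity
    linarith
  have hn : ‖(((smoothWeight N (b + 1 + L))⁻¹ : ℝ) : ℂ)‖ = (smoothWeight N (b + 1 + L))⁻¹ := by
    rw [Complex.norm_real, Real.norm_of_nonneg (hinv L)]
  calc _ ≤ 4 * B * (1 + Real.log N) * (2 * (√2 * Real.exp 3 * √N)) := by
        refine mul_le_mul_of_nonneg_left ?_ (by positivity)
        rw [hn]
        linarith
    _ = C * (8 * (√2 * Real.exp 3)) * (1 + Real.log N) * (√N * (N / √y * E)) := by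
        rw [hB]; ring
    _ = _ := by rw [hconv]

/-- The sawtooth function `u ↦ {u} - 1/2`. -/
noncomputable def sawtooth (u : ℝ) : ℝ := Int.fract u - 1 / 2

lemma abs_sawtooth_le (u : ℝ) : |sawtooth u| ≤ 1 / 2 := by
  have h0 := Int.fract_nonneg u
  have h1 := (Int.fract_lt_one u).le
  rw [sawtooth, abs_le]
  constructor <;> linarith

/-- Half the periodic second Bernoulli function, a primitive of `sawtooth`. -/
noncomputable def sawtoothPrimitive (u : ℝ) : ℝ := (Int.fract u ^ 2 - Int.fract u + 1 / 6) / 2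

lemma re_expTwoPi (u : ℝ) : (expTwoPi u).re = Real.cos (2 * Real.pi * u) := by
  rw [expTwoPi, Complex.exp_ofReal_mul_I_re]

lemma hasSum_sawtoothPrimitive (u : ℝ) :
    HasSum (fun n : ℕ => 1 / (2 * Real.pi ^ 2 * ((n : ℝ) + 1) ^ 2) * (expTwoPi ((n + 1) * u)).re)
      (sawtoothPrimitive u) := by
  have h := hasSum_one_div_nat_pow_mul_cos one_ne_zero
    (x := Int.fract u) ⟨Int.fract_nonneg u, (Int.fract_lt_one u).le⟩
  rw [← hasSum_nat_add_iff' 1] at h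
  have h2 := h.mul_left (1 / (2 * Real.pi ^ 2))
  have hB : (Polynomial.map (algebraMap ℚ ℝ) (Polynomial.bernoulli (2 * 1))).eval (Int.fract u)
      = Int.fract u ^ 2 - Int.fract u + 1 / 6 := by
    rw [Polynomial.bernoulli_def]
    simp [sum_range_succ, bernoulli_two, bernoulli_one]
    ring
  rw [hB] at h2
  have hπ := Real.pi_ne_zero
  have e : 1 / (2 * Real.pi ^ 2) * ((-1 : ℝ) ^ (1 + 1) * (2 * Real.pi) ^ (2 * 1) / 2
      / (Nat.factorial (2 * 1)) * (Int.fract u ^ 2 - Int.fract u + 1 / 6)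
      - ∑ i ∈ range 1, 1 / (i : ℝ) ^ (2 * 1) * Real.cos (2 * Real.pi * i * Int.fract u))
      = sawtoothPrimitive u := by
    simp only [sawtoothPrimitive]
    simp
    field_simp
  rw [e] at h2
  refine h2.congr_fun fun n => ?_
  have hcos : Real.cos (2 * Real.pi * (n + 1 : ℕ) * Int.fract u) = (expTwoPi ((n + 1) * u)).re := by
    have : expTwoPi ((n + 1) * u) = expTwoPi ((n + 1) * Int.fract u) := by
      have e1 : ((n:ℝ) + 1) * u = (n + 1) * Int.fract u + (((n + 1) * ⌊u⌋ : ℤ) : ℝ) := by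
        rw [Int.fract]
        push_cast
        ring
      rw [e1, expTwoPi_add, expTwoPi_int, mul_one]
    rw [this, re_expTwoPi]
    push_cast
    ring_nf
  rw [hcos]
  push_cast
  rw [← mul_assoc, one_div_mul_one_div]

lemma sawtooth_mul_le {u δ : ℝ} (h0 : 0 < δ) (h1 : δ ≤ 1) :
    δ * sawtooth u ≤ δ ^ 2 + (sawtoothPrimitive u - sawtoothPrimitive (u - δ)) := by
  have f0 := Int.fract_nonneg u
  have f1 := Int.fract_lt_one u
  have hfl := Int.floor_add_fract u
  rw [sawtooth, sawtoothPrimitive, sawtoothPrimitive]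
  rcases le_or_gt δ (Int.fract u) with h | h
  · have : Int.fract (u - δ) = Int.fract u - δ := by
      rw [Int.fract_eq_iff]
      exact ⟨by linarith, by linarith, ⌊u⌋, by linarith⟩
    rw [this]
    nlinarith
  · have : Int.fract (u - δ) = Int.fract u - δ + 1 := by
      rw [Int.fract_eq_iff]
      exact ⟨by linarith, by linarith, ⌊u⌋ - 1, by push_cast; linarith⟩
    rw [this]
    nlinarith

lemma le_sawtooth_mul {u δ : ℝ} (h0 : 0 < δ) (h1 : δ ≤ 1) :
    (sawtoothPrimitive (u + δ) - sawtoothPrimitive u) - δ ^ 2 ≤ δ * sawtooth u := by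
  have f0 := Int.fract_nonneg u
  have f1 := Int.fract_lt_one u
  have hfl := Int.floor_add_fract u
  rw [sawtooth, sawtoothPrimitive, sawtoothPrimitive]
  rcases lt_or_ge (Int.fract u + δ) 1 with h | h
  · have : Int.fract (u + δ) = Int.fract u + δ := by
      rw [Int.fract_eq_iff]
      exact ⟨by linarith, by linarith, ⌊u⌋, by linarith⟩
    rw [this]
    nlinarith
  · have : Int.fract (u + δ) = Int.fract u + δ - 1 := by
      rw [Int.fract_eq_iff]
      exact ⟨by linarith, by linarith, ⌊u⌋ + 1, by push_cast; linarith⟩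
    rw [this]
    nlinarith

lemma norm_expTwoPi_sub_one_le_rpow {z κ : ℝ} (hz : 0 < z) (h0 : 0 ≤ κ) (h1 : κ ≤ 1) :
    ‖expTwoPi z - 1‖ ≤ 2 * Real.pi * z ^ κ := by
  have hπ := Real.pi_gt_three
  rw [norm_expTwoPi_sub_one]
  rcases le_total z 1 with h | h
  · have e1 : |Real.sin (Real.pi * z)| ≤ Real.pi * z := by
      have := Real.abs_sin_le_abs (x := Real.pi * z)
      rwa [abs_of_pos (by positivity : 0 < Real.pi * z)] at this
    have e2 : z ≤ z ^ κ := by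
      have := Real.rpow_le_rpow_of_exponent_ge hz h h1
      rwa [Real.rpow_one] at this
    nlinarith
  · have e1 := Real.abs_sin_le_one (Real.pi * z)
    have e2 : 1 ≤ z ^ κ := Real.one_le_rpow h h0
    nlinarith

lemma expTwoPi_shift_bound {ι : Type*} (s : Finset ι) (u : ι → ℝ) (n : ℕ) (δ : ℝ) :
    |∑ i ∈ s, ((expTwoPi ((n + 1) * (u i + δ))).re - (expTwoPi ((n + 1) * u i)).re)|
      ≤ ‖∑ i ∈ s, expTwoPi ((n + 1) * u i)‖ * ‖expTwoPi ((n + 1) * δ) - 1‖ := by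
  rw [← norm_mul, sum_mul]
  have : ∑ i ∈ s, ((expTwoPi ((n + 1) * (u i + δ))).re - (expTwoPi ((n + 1) * u i)).re)
      = (∑ i ∈ s, expTwoPi ((n + 1) * u i) * (expTwoPi ((n + 1) * δ) - 1)).re := by
    rw [Complex.re_sum]
    refine sum_congr rfl fun i _ => ?_
    rw [mul_sub, ← expTwoPi_add, mul_one, Complex.sub_re, mul_add]
  rw [this]
  exact Complex.abs_re_le_norm _

lemma norm_expTwoPi_neg_sub_one (u : ℝ) : ‖expTwoPi (-u) - 1‖ = ‖expTwoPi u - 1‖ := by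
  rw [norm_expTwoPi_sub_one, norm_expTwoPi_sub_one, mul_neg, Real.sin_neg, abs_neg]

lemma abs_sum_sawtoothPrimitive_sub_le {ι : Type*} (s : Finset ι) (u : ι → ℝ) {δ ρ : ℝ}
    (h0 : 0 < δ) (hρ : |ρ| = δ) {K₁ K₂ e₁ e₂ η : ℝ} (hK₁ : 0 ≤ K₁)
    (hK₂ : 0 ≤ K₂) (he₁ : 0 ≤ e₁) (he₂ : 0 ≤ e₂) (hη : 0 < η) (he₁' : e₁ + η ≤ 1) (he₂' : e₂ + η ≤ 1)
    (hT : ∀ n : ℕ, ‖∑ i ∈ s, expTwoPi ((n + 1) * u i)‖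
      ≤ K₁ * ((n : ℝ) + 1) ^ e₁ + K₂ * ((n : ℝ) + 1) ^ e₂) :
    |∑ i ∈ s, (sawtoothPrimitive (u i + ρ) - sawtoothPrimitive (u i))|
      ≤ δ * (K₁ * δ ^ (-(e₁ + η)) + K₂ * δ ^ (-(e₂ + η)))
        * ∑' n : ℕ, ((n : ℝ) + 1) ^ (-(1 + η)) := by
  have hπ := Real.pi_gt_three
  have hsum : Summable fun n : ℕ => ((n : ℝ) + 1) ^ (-(1 + η)) := by
    have := (summable_nat_add_iff 1).2 (Real.summable_nat_rpow.2 (by linarith : -(1 + η) < -1))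
    simpa using this
  have hS : HasSum (fun n : ℕ => 1 / (2 * Real.pi ^ 2 * ((n : ℝ) + 1) ^ 2) *
      ∑ i ∈ s, ((expTwoPi ((n + 1) * (u i + ρ))).re - (expTwoPi ((n + 1) * u i)).re))
      (∑ i ∈ s, (sawtoothPrimitive (u i + ρ) - sawtoothPrimitive (u i))) := by
    have := hasSum_sum (s := s) fun i _ =>
      (hasSum_sawtoothPrimitive (u i + ρ)).sub (hasSum_sawtoothPrimitive (u i))
    refine this.congr_fun fun n => ?_
    rw [mul_sum]
    exact sum_congr rfl fun i _ => mul_sub _ _ _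
  have hterm : ∀ n : ℕ, ‖1 / (2 * Real.pi ^ 2 * ((n : ℝ) + 1) ^ 2) *
      ∑ i ∈ s, ((expTwoPi ((n + 1) * (u i + ρ))).re - (expTwoPi ((n + 1) * u i)).re)‖
      ≤ δ * (K₁ * δ ^ (-(e₁ + η)) + K₂ * δ ^ (-(e₂ + η))) * ((n : ℝ) + 1) ^ (-(1 + η)) := by
    intro n
    set m : ℝ := (n : ℝ) + 1 with hm
    have hm0 : 0 < m := by positivity
    set D := ‖expTwoPi (m * ρ) - 1‖ with hD
    have hDd : D = ‖expTwoPi (m * δ) - 1‖ := by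
      rcases abs_cases ρ with ⟨h, _⟩ | ⟨h, _⟩
      · rw [← hρ, h]
      · rw [← hρ, h, mul_neg, norm_expTwoPi_neg_sub_one]
    have hpow : ∀ e : ℝ, e + η ≤ 1 → 0 ≤ e →
        m ^ e * D / (2 * Real.pi ^ 2 * m ^ 2) ≤ δ * δ ^ (-(e + η)) * m ^ (-(1 + η)) := by
      intro e he he0
      have h1 := norm_expTwoPi_sub_one_le_rpow (z := m * δ) (κ := 1 - (e + η)) (by positivity)
        (by linarith) (by linarith)
      rw [← hDd, Real.mul_rpow hm0.le h0.le] at h1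
      have h2 : δ * δ ^ (-(e + η)) = δ ^ (1 - (e + η)) := by
        rw [sub_eq_add_neg, Real.rpow_add h0, Real.rpow_one]
      have h3 : m ^ (-(1 + η)) = m ^ e * m ^ (1 - (e + η)) / m ^ 2 := by
        rw [← Real.rpow_add hm0, ← Real.rpow_natCast, ← Real.rpow_sub hm0]
        congr 1
        push_cast
        ring
      rw [h2, h3, div_le_iff₀ (by positivity)]
      have h4 : δ ^ (1 - (e + η)) * (m ^ e * m ^ (1 - (e + η)) / m ^ 2) * (2 * Real.pi ^ 2 * m ^ 2)
          = Real.pi * (m ^ e * (2 * Real.pi * (m ^ (1 - (e + η)) * δ ^ (1 - (e + η))))) := by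
        field_simp
      rw [h4]
      have h5 : m ^ e * D ≤ m ^ e * (2 * Real.pi * (m ^ (1 - (e + η)) * δ ^ (1 - (e + η)))) := by
        gcongr
      have h6 : 0 ≤ m ^ e * D := by positivity
      nlinarith
    rw [norm_mul, Real.norm_of_nonneg (by positivity), Real.norm_eq_abs, one_div_mul_eq_div]
    have h1 := expTwoPi_shift_bound s u n ρ
    rw [← hm, ← hD] at h1
    have h2 := mul_le_mul_of_nonneg_right (hT n) (norm_nonneg _ : 0 ≤ D)
    rw [← hm] at h2
    have p1 := mul_le_mul_of_nonneg_left (hpow e₁ he₁' he₁) hK₁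
    have p2 := mul_le_mul_of_nonneg_left (hpow e₂ he₂' he₂) hK₂
    calc _ ≤ (K₁ * m ^ e₁ + K₂ * m ^ e₂) * D / (2 * Real.pi ^ 2 * m ^ 2) := by
          gcongr
          exact h1.trans h2
      _ = K₁ * (m ^ e₁ * D / (2 * Real.pi ^ 2 * m ^ 2))
          + K₂ * (m ^ e₂ * D / (2 * Real.pi ^ 2 * m ^ 2)) := by ring
      _ ≤ _ := add_le_add p1 p2
      _ = _ := by ring
  rw [← hS.tsum_eq, ← Real.norm_eq_abs]
  exact tsum_of_norm_bounded (hsum.hasSum.mul_left _) hterm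

/-- Bound for sums of the sawtooth function in terms of exponential sums. -/
lemma abs_sum_sawtooth_le {ι : Type*} (s : Finset ι) (u : ι → ℝ) {δ : ℝ}
    (h0 : 0 < δ) (h1 : δ ≤ 1) {K₁ K₂ e₁ e₂ η : ℝ} (hK₁ : 0 ≤ K₁)
    (hK₂ : 0 ≤ K₂) (he₁ : 0 ≤ e₁) (he₂ : 0 ≤ e₂) (hη : 0 < η) (he₁' : e₁ + η ≤ 1) (he₂' : e₂ + η ≤ 1)
    (hT : ∀ n : ℕ, ‖∑ i ∈ s, expTwoPi ((n + 1) * u i)‖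
      ≤ K₁ * ((n : ℝ) + 1) ^ e₁ + K₂ * ((n : ℝ) + 1) ^ e₂) :
    |∑ i ∈ s, sawtooth (u i)| ≤ δ * s.card + (K₁ * δ ^ (-(e₁ + η)) + K₂ * δ ^ (-(e₂ + η)))
        * ∑' n : ℕ, ((n : ℝ) + 1) ^ (-(1 + η)) := by
  have hp := abs_sum_sawtoothPrimitive_sub_le s u (ρ := δ) h0 (abs_of_pos h0) hK₁ hK₂ he₁ he₂ hη
    he₁' he₂' hT
  have hm := abs_sum_sawtoothPrimitive_sub_le s u (ρ := -δ) h0 (by rw [abs_neg, abs_of_pos h0])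
    hK₁ hK₂ he₁ he₂ hη he₁' he₂' hT
  set W := (K₁ * δ ^ (-(e₁ + η)) + K₂ * δ ^ (-(e₂ + η))) * ∑' n : ℕ, ((n : ℝ) + 1) ^ (-(1 + η))
    with hW
  rw [mul_assoc δ, ← hW] at hp hm
  have u1 := sum_le_sum fun i (_ : i ∈ s) => sawtooth_mul_le (u := u i) h0 h1
  have u2 := sum_le_sum fun i (_ : i ∈ s) => le_sawtooth_mul (u := u i) h0 h1
  rw [← mul_sum, sum_add_distrib, sum_const, nsmul_eq_mul] at u1
  rw [← mul_sum, sum_sub_distrib, sum_const, nsmul_eq_mul] at u2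
  have e : ∑ i ∈ s, (sawtoothPrimitive (u i + -δ) - sawtoothPrimitive (u i))
      = -∑ i ∈ s, (sawtoothPrimitive (u i) - sawtoothPrimitive (u i - δ)) := by
    rw [← sum_neg_distrib]
    refine sum_congr rfl fun i _ => ?_
    rw [← sub_eq_add_neg]
    ring
  rw [e, abs_neg] at hm
  have m1 := (abs_le.1 hm).2
  have p1 := (abs_le.1 hp).1
  rw [abs_le]
  constructor
  · refine le_of_mul_le_mul_left ?_ h0
    linarith
  · refine le_of_mul_le_mul_left ?_ h0
    linarith

lemma one_add_log_le_rpow {N η : ℝ} (hN : 1 ≤ N) (hη : 0 < η) :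
    1 + Real.log N ≤ (1 + 1 / η) * N ^ η := by
  have h1 := Real.log_le_rpow_div (by linarith : 0 ≤ N) hη
  have h2 : 1 ≤ N ^ η := Real.one_le_rpow hN hη.le
  calc 1 + Real.log N ≤ N ^ η + N ^ η / η := by linarith
    _ = _ := by ring

/-- Exponent bookkeeping for the sawtooth sum over a dyadic block. -/
lemma rpow_mul_rpow_div_le {x N η p q e : ℝ} (hx : 1 ≤ x) (hN : x ^ ((27:ℝ) / 82) ≤ N)
    (hNx : N ^ 2 ≤ x) (hη : 0 ≤ η)
    (hpe : max ((p + e) * (1 / 2)) ((p + e) * (27 / 82)) + q - 27 / 82 * e ≤ 27 / 82) :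
    N ^ p * x ^ q * (x ^ ((27:ℝ) / 82) / N) ^ (-(e + η)) ≤ x ^ ((27:ℝ) / 82 + η) := by
  have hx0 : 0 < x := by linarith
  have hX1 : 1 ≤ x ^ ((27:ℝ) / 82) := Real.one_le_rpow hx (by norm_num)
  have hN0 : 0 < N := by linarith
  have hN1 : 1 ≤ N := hX1.trans hN
  have hNs : N ≤ x ^ ((1:ℝ) / 2) := by
    rw [← Real.sqrt_eq_rpow]
    exact Real.le_sqrt_of_sq_le hNx
  have hpow : N ^ (p + e) ≤ x ^ (max ((p + e) * (1 / 2)) ((p + e) * (27 / 82))) := by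
    rcases le_total 0 (p + e) with h | h
    · refine (Real.rpow_le_rpow hN0.le hNs h).trans ?_
      rw [← Real.rpow_mul hx0.le]
      refine Real.rpow_le_rpow_of_exponent_le hx (le_trans (le_of_eq ?_) (le_max_left _ _))
      ring
    · refine (Real.rpow_le_rpow_of_nonpos (by positivity) hN h).trans ?_
      rw [← Real.rpow_mul hx0.le]
      refine Real.rpow_le_rpow_of_exponent_le hx (le_trans (le_of_eq ?_) (le_max_right _ _))
      ring
  have hNη : N ^ η ≤ x ^ (η * (1 / 2)) := by
    refine (Real.rpow_le_rpow hN0.le hNs hη).trans (le_of_eq ?_)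
    rw [← Real.rpow_mul hx0.le]
    ring_nf
  have hd : (x ^ ((27:ℝ) / 82) / N) ^ (-(e + η))
      = N ^ e * N ^ η * x ^ (-(27 / 82 * (e + η))) := by
    rw [Real.div_rpow (by positivity) hN0.le, ← Real.rpow_mul hx0.le, Real.rpow_neg hN0.le,
      div_inv_eq_mul, Real.rpow_add hN0]
    ring_nf
  rw [hd]
  calc N ^ p * x ^ q * (N ^ e * N ^ η * x ^ (-(27 / 82 * (e + η))))
      = N ^ (p + e) * N ^ η * (x ^ q * x ^ (-(27 / 82 * (e + η)))) := by
        rw [Real.rpow_add hN0]; ring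
    _ ≤ x ^ (max ((p + e) * (1 / 2)) ((p + e) * (27 / 82))) * x ^ (η * (1 / 2))
        * (x ^ q * x ^ (-(27 / 82 * (e + η)))) := by gcongr
    _ = x ^ (max ((p + e) * (1 / 2)) ((p + e) * (27 / 82)) + η * (1 / 2)
        + (q + -(27 / 82 * (e + η)))) := by
        rw [← Real.rpow_add hx0, ← Real.rpow_add hx0, ← Real.rpow_add hx0]
    _ ≤ _ := by
        apply Real.rpow_le_rpow_of_exponent_le hx
        linarith

lemma exists_abs_sum_sawtooth_block_le {η : ℝ} (hη : 0 < η) (hη' : η ≤ 1 / 4) :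
    ∃ C : ℝ, 0 < C ∧ ∀ x N : ℝ, 1 ≤ N → N ^ 2 ≤ x → ∀ a L : ℕ, N ≤ a → (a : ℝ) + L ≤ 2 * N + 1 →
      |∑ i ∈ range L, sawtooth (x / (a + i : ℕ))| ≤ C * x ^ ((27:ℝ) / 82 + 2 * η) := by
  obtain ⟨C, hC, h⟩ := exists_norm_sum_expTwoPi_div_le
  set Z := ∑' n : ℕ, ((n : ℝ) + 1) ^ (-(1 + η)) with hZ
  have hZ0 : 0 ≤ Z := tsum_nonneg fun n => by positivity
  refine ⟨2 + 2 * C * (1 + 1 / η) * Z, by positivity, fun x N hN hNx a L ha hL => ?_⟩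
  have hx : 1 ≤ x := by nlinarith
  have hx0 : 0 < x := by linarith
  have hN0 : 0 < N := by linarith
  have hLN : (L:ℝ) ≤ 2 * N := by linarith
  have hX1 : 1 ≤ x ^ ((27:ℝ) / 82) := Real.one_le_rpow hx (by norm_num)
  have hXη : x ^ ((27:ℝ) / 82) ≤ x ^ ((27:ℝ) / 82 + 2 * η) :=
    Real.rpow_le_rpow_of_exponent_le hx (by linarith)
  rcases le_or_gt N (x ^ ((27:ℝ) / 82)) with hsmall | hbig
  · have h1 : |∑ i ∈ range L, sawtooth (x / (a + i : ℕ))| ≤ L * (1 / 2) := by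
      refine (abs_sum_le_sum_abs _ _).trans
        ((sum_le_sum fun i _ => abs_sawtooth_le _).trans (le_of_eq ?_))
      simp
    have h2 : 0 ≤ 2 * C * (1 + 1 / η) * Z * x ^ ((27:ℝ) / 82 + 2 * η) := by positivity
    have h3 : 0 ≤ x ^ ((27:ℝ) / 82) := by linarith
    linarith
  set δ := x ^ ((27:ℝ) / 82) / N with hδ
  have hδ0 : 0 < δ := by positivity
  have hδ1 : δ ≤ 1 := by rw [hδ, div_le_one hN0]; exact hbig.le
  have hlog := Real.log_nonneg hN
  set K := C * (1 + Real.log N) with hK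
  have hK0 : 0 ≤ K := by positivity
  have hKle : K ≤ C * (1 + 1 / η) * x ^ η := by
    have h1 := one_add_log_le_rpow hN hη
    have h2 : N ≤ x := by nlinarith
    rw [hK, mul_assoc]
    refine mul_le_mul_of_nonneg_left (h1.trans ?_) hC.le
    gcongr
  have hT : ∀ n : ℕ, ‖∑ i ∈ range L, expTwoPi ((n + 1) * (x / (a + i : ℕ)))‖
      ≤ K * (N ^ (-(1:ℝ) / 5) * x ^ ((11:ℝ) / 30)) * ((n : ℝ) + 1) ^ ((11:ℝ) / 30)
        + K * (N ^ (-(11:ℝ) / 20) * x ^ ((61:ℝ) / 120)) * ((n : ℝ) + 1) ^ ((61:ℝ) / 120) := by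
    intro n
    have hn : (1:ℝ) ≤ n + 1 := by
      have : (0:ℝ) ≤ n := by positivity
      linarith
    have h1 := h N ((n + 1) * x) hN (hNx.trans (le_mul_of_one_le_left hx0.le hn)) a L ha hL
    rw [← hK, Real.mul_rpow (by positivity) hx0.le, Real.mul_rpow (by positivity) hx0.le] at h1
    simp_rw [← mul_div_assoc]
    refine h1.trans (le_of_eq ?_)
    ring
  have key := abs_sum_sawtooth_le (range L) (fun i : ℕ => x / (a + i : ℕ)) hδ0 hδ1
    (by positivity) (by positivity) (by norm_num) (by norm_num) hη (by linarith) (by linarith) hT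
  rw [← hZ, card_range] at key
  refine key.trans ?_
  have b1 := rpow_mul_rpow_div_le (p := -(1:ℝ) / 5) (q := (11:ℝ) / 30) (e := (11:ℝ) / 30) hx hbig.le
    hNx hη.le (by norm_num)
  have b2 := rpow_mul_rpow_div_le (p := -(11:ℝ) / 20) (q := (61:ℝ) / 120) (e := (61:ℝ) / 120) hx
    hbig.le hNx hη.le (by norm_num)
  rw [← hδ] at b1 b2
  have hδL : δ * L ≤ 2 * x ^ ((27:ℝ) / 82 + 2 * η) := by
    have : δ * L ≤ δ * (2 * N) := mul_le_mul_of_nonneg_left hLN hδ0.le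
    have e : δ * (2 * N) = 2 * x ^ ((27:ℝ) / 82) := by rw [hδ]; field_simp
    linarith
  have hxx : x ^ η * x ^ ((27:ℝ) / 82 + η) = x ^ ((27:ℝ) / 82 + 2 * η) := by
    rw [← Real.rpow_add hx0]
    ring_nf
  calc _ = δ * L + K * (N ^ (-(1:ℝ) / 5) * x ^ ((11:ℝ) / 30) * δ ^ (-((11:ℝ) / 30 + η))
        + N ^ (-(11:ℝ) / 20) * x ^ ((61:ℝ) / 120) * δ ^ (-((61:ℝ) / 120 + η))) * Z := by ring
    _ ≤ 2 * x ^ ((27:ℝ) / 82 + 2 * η) + (C * (1 + 1 / η) * x ^ η)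
        * (x ^ ((27:ℝ) / 82 + η) + x ^ ((27:ℝ) / 82 + η)) * Z := by gcongr
    _ = 2 * x ^ ((27:ℝ) / 82 + 2 * η) + 2 * C * (1 + 1 / η) * Z
        * (x ^ η * x ^ ((27:ℝ) / 82 + η)) := by ring
    _ = _ := by rw [hxx]; ring

/-- Van der Corput's bound for the sawtooth sum in the divisor problem. -/
lemma exists_abs_sum_sawtooth_le {η : ℝ} (hη : 0 < η) (hη' : η ≤ 1 / 4) :
    ∃ C : ℝ, 0 < C ∧ ∀ x : ℝ, 1 ≤ x → ∀ m : ℕ, (m : ℝ) ^ 2 ≤ x →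
      |∑ i ∈ range m, sawtooth (x / (i + 1 : ℕ))| ≤ C * x ^ ((27:ℝ) / 82 + 3 * η) := by
  obtain ⟨C, hC, h⟩ := exists_abs_sum_sawtooth_block_le hη hη'
  refine ⟨C * (2 * (1 + 1 / η)), by positivity, fun x hx m hm => ?_⟩
  have hx0 : 0 < x := by linarith
  set K := C * x ^ ((27:ℝ) / 82 + 2 * η) with hK
  have hK0 : 0 < K := by positivity
  have main : ∀ m : ℕ, (m : ℝ) ^ 2 ≤ x →
      |∑ i ∈ range m, sawtooth (x / (i + 1 : ℕ))| ≤ K * (Nat.log 2 m + 1) := by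
    intro m
    induction m using Nat.strong_induction_on with
    | _ m ih =>
      intro hm
      rcases Nat.eq_zero_or_pos m with rfl | hm0
      · simp [hK0.le]
      have hlt : m / 2 < m := Nat.div_lt_self hm0 one_lt_two
      have hdec : 2 * (m / 2) ≤ m ∧ m ≤ 2 * (m / 2) + 1 := by omega
      have hblock := h x ((m / 2 : ℕ) + 1) (by simp) (by
        refine le_trans ?_ hm
        gcongr
        have : m / 2 + 1 ≤ m := hlt
        exact_mod_cast this) (m / 2 + 1) (m - m / 2) (by push_cast; rfl) (by
        rw [Nat.cast_sub hlt.le]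
        have : (m:ℝ) ≤ 2 * (m / 2 : ℕ) + 1 := by exact_mod_cast hdec.2
        push_cast at this ⊢
        linarith)
      have hsplit : ∑ i ∈ range m, sawtooth (x / (i + 1 : ℕ))
          = ∑ i ∈ range (m / 2), sawtooth (x / (i + 1 : ℕ))
            + ∑ i ∈ range (m - m / 2), sawtooth (x / (m / 2 + 1 + i : ℕ)) := by
        conv_lhs => rw [← Nat.add_sub_of_le hlt.le, sum_range_add]
        congr 1
        refine sum_congr rfl fun i _ => ?_
        congr 3
        ring
      rw [hsplit]
      refine (abs_add_le _ _).trans ?_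
      rcases Nat.lt_or_ge m 2 with hm2 | hm2
      · have : m / 2 = 0 := by omega
        rw [this] at hblock ⊢
        simp only [range_zero, sum_empty, abs_zero, zero_add]
        simp only [zero_add] at hblock
        have : (0:ℝ) ≤ Nat.log 2 m := by positivity
        nlinarith
      · have hlog : Nat.log 2 m = Nat.log 2 (m / 2) + 1 := Nat.log_of_one_lt_of_le one_lt_two hm2
        have h1 := ih (m / 2) hlt (by
          refine le_trans ?_ hm
          gcongr)
        rw [hlog, Nat.cast_add_one]
        linarith
  refine (main m hm).trans ?_
  rcases Nat.eq_zero_or_pos m with rfl | hm0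
  · simp only [Nat.log_zero_right, Nat.cast_zero, zero_add, mul_one]
    rw [hK]
    have e1 : x ^ ((27:ℝ) / 82 + 2 * η) ≤ x ^ ((27:ℝ) / 82 + 3 * η) :=
      Real.rpow_le_rpow_of_exponent_le hx (by linarith)
    have e2 : (1:ℝ) ≤ 2 * (1 + 1 / η) := by
      have : 0 < 1 / η := by positivity
      linarith
    calc C * x ^ ((27:ℝ) / 82 + 2 * η) ≤ C * x ^ ((27:ℝ) / 82 + 3 * η) := by gcongr
      _ ≤ C * (2 * (1 + 1 / η)) * x ^ ((27:ℝ) / 82 + 3 * η) := by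
        gcongr
        exact le_mul_of_one_le_right hC.le e2
  have hm1 : (1:ℝ) ≤ m := by exact_mod_cast hm0
  have hmx : (m:ℝ) ≤ x := by nlinarith
  have hlog2 : (Nat.log 2 m : ℝ) ≤ 2 * Real.log m := by
    have h1 := Real.natLog_le_logb m 2
    rw [Real.logb] at h1
    have h2 := Real.log_two_gt_d9
    have h3 : Real.log m / Real.log (2 : ℕ) ≤ 2 * Real.log m := by
      have := Real.log_nonneg hm1
      push_cast
      rw [div_le_iff₀ (by linarith)]
      nlinarith
    linarith
  have h4 := one_add_log_le_rpow hm1 hη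
  have h5 : (m:ℝ) ^ η ≤ x ^ η := by gcongr
  have h6 : (Nat.log 2 m : ℝ) + 1 ≤ 2 * (1 + 1 / η) * x ^ η := by
    have : (1 + 1 / η) * (m:ℝ) ^ η ≤ (1 + 1 / η) * x ^ η := by gcongr
    linarith
  calc K * (Nat.log 2 m + 1) ≤ K * (2 * (1 + 1 / η) * x ^ η) := by gcongr
    _ = C * (2 * (1 + 1 / η)) * (x ^ ((27:ℝ) / 82 + 2 * η) * x ^ η) := by rw [hK]; ring
    _ = _ := by
      rw [← Real.rpow_add hx0]
      ring_nf

lemma norm_cpow_sub_cpow_le {r : ℂ} (hr : r.re = 0) {a b : ℝ} (ha : 0 < a) (hab : a ≤ b) :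
    ‖(b : ℂ) ^ r - (a : ℂ) ^ r‖ ≤ ‖r‖ / a * (b - a) := by
  rcases eq_or_ne r 0 with rfl | hr0
  · simp
  refine norm_image_sub_le_of_norm_deriv_le_segment' (f := fun y : ℝ => (y : ℂ) ^ r)
    (f' := fun y : ℝ => r * (y : ℂ) ^ (r - 1)) (fun y hy => ?_) (fun y hy => ?_) b ⟨hab, le_rfl⟩
  · exact (hasDerivAt_ofReal_cpow_const (ha.trans_le hy.1).ne' hr0).hasDerivWithinAt
  · have hy0 : 0 < y := ha.trans_le hy.1
    rw [norm_mul, norm_cpow_eq_rpow_re_of_pos hy0, sub_re, hr, one_re, zero_sub,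
      Real.rpow_neg_one, ← div_eq_mul_inv]
    exact div_le_div_of_nonneg_left (norm_nonneg _) ha hy.1

lemma sum_range_inv_le_one_add_log (n : ℕ) :
    ∑ i ∈ range n, (((i + 1 : ℕ) : ℝ))⁻¹ ≤ 1 + Real.log n := by
  have h := harmonic_le_one_add_log n
  simpa [harmonic] using h

/-- The sawtooth sum twisted by `d ^ (2it)`. -/
lemma exists_norm_sum_cpow_mul_sawtooth_le {η : ℝ} (hη : 0 < η) (hη' : η ≤ 1 / 4) :
    ∃ C : ℝ, 0 < C ∧ ∀ x : ℝ, 1 ≤ x → ∀ m : ℕ, (m : ℝ) ^ 2 ≤ x → ∀ t : ℝ,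
      ‖∑ i ∈ range m, ((i + 1 : ℕ) : ℂ) ^ (2 * t * I) * (sawtooth (x / (i + 1 : ℕ)) : ℂ)‖
        ≤ C * (1 + |t|) * x ^ ((27:ℝ) / 82 + 4 * η) := by
  obtain ⟨C, hC, h⟩ := exists_abs_sum_sawtooth_le hη hη'
  refine ⟨C * (2 * (1 + 1 / η)), by positivity, fun x hx m hm t => ?_⟩
  have hx0 : 0 < x := by linarith
  rcases m with _ | L
  · simp only [range_zero, sum_empty, norm_zero]
    positivity
  have hre : (2 * t * I : ℂ).re = 0 := by simp
  have hn : ‖(2 * t * I : ℂ)‖ = 2 * |t| := by simp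
  have hB := norm_sum_mul_le_of_partial_sums
    (fun i : ℕ => ((i + 1 : ℕ) : ℂ) ^ (2 * t * I : ℂ))
    (fun i : ℕ => (sawtooth (x / (i + 1 : ℕ)) : ℂ)) L (C * x ^ ((27:ℝ) / 82 + 3 * η))
    (fun k hk => by
      rw [← ofReal_sum, norm_real, Real.norm_eq_abs]
      refine h x hx k (le_trans ?_ hm)
      gcongr)
  refine hB.trans ?_
  have hg : ‖((L + 1 : ℕ) : ℂ) ^ (2 * t * I : ℂ)‖ = 1 := by
    rw [norm_natCast_cpow_of_pos (Nat.succ_pos L), hre, Real.rpow_zero]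
  have hd : ∀ i ∈ range L, ‖((i + 1 + 1 : ℕ) : ℂ) ^ (2 * t * I : ℂ)
      - ((i + 1 : ℕ) : ℂ) ^ (2 * t * I : ℂ)‖ ≤ 2 * |t| * (((i + 1 : ℕ) : ℝ))⁻¹ := by
    intro i _
    have := norm_cpow_sub_cpow_le hre (a := ((i + 1 : ℕ) : ℝ)) (b := ((i + 1 + 1 : ℕ) : ℝ))
      (by positivity) (by gcongr; omega)
    rw [hn, ofReal_natCast, ofReal_natCast] at this
    refine this.trans_eq ?_
    rw [Nat.cast_add_one (i + 1)]
    ring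
  have hL : (L : ℝ) ≤ x := by
    have : (L : ℝ) + 1 ≤ ((L : ℝ) + 1) ^ 2 := by nlinarith [(Nat.cast_nonneg L : (0:ℝ) ≤ L)]
    push_cast at hm
    linarith
  have hlog : 1 + Real.log L ≤ (1 + 1 / η) * x ^ η := by
    refine le_trans ?_ (one_add_log_le_rpow hx hη)
    rcases Nat.eq_zero_or_pos L with rfl | h0
    · simpa using Real.log_nonneg hx
    · gcongr
  have hsum := (sum_le_sum hd).trans_eq (mul_sum _ _ _).symm
  have hx1 : 1 ≤ x ^ η := Real.one_le_rpow hx hη.le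
  have h1 : 1 ≤ (1 + 1 / η) * x ^ η := by
    have : 0 < 1 / η := by positivity
    nlinarith
  have htot : ‖((L + 1 : ℕ) : ℂ) ^ (2 * t * I : ℂ)‖ + ∑ i ∈ range L,
      ‖((i + 1 + 1 : ℕ) : ℂ) ^ (2 * t * I : ℂ) - ((i + 1 : ℕ) : ℂ) ^ (2 * t * I : ℂ)‖
      ≤ 2 * (1 + |t|) * ((1 + 1 / η) * x ^ η) := by
    rw [hg]
    have h2 := (sum_range_inv_le_one_add_log L).trans hlog
    have h3 := mul_le_mul_of_nonneg_left h2 (by positivity : 0 ≤ 2 * |t|)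
    linarith
  calc _ ≤ C * x ^ ((27:ℝ) / 82 + 3 * η) * (2 * (1 + |t|) * ((1 + 1 / η) * x ^ η)) := by
        gcongr
    _ = C * (2 * (1 + 1 / η)) * (1 + |t|) * (x ^ ((27:ℝ) / 82 + 3 * η) * x ^ η) := by ring
    _ = _ := by
        rw [← Real.rpow_add hx0]
        ring_nf

/-- A function of `v` interpolating the Euler–Maclaurin main terms on `[a, a + 1]`. -/
noncomputable def eulerMaclaurinKernel (w : ℂ) (a v : ℝ) : ℂ :=
  (v : ℂ) ^ (1 - w) / (1 - w) - (v - a - 1 / 2) * (v : ℂ) ^ (-w)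
    - w / 2 * ((v - a) * (v - a - 1)) * (v : ℂ) ^ (-w - 1)

lemma hasDerivAt_eulerMaclaurinKernel {w : ℂ} (hw0 : w ≠ 0) (hw1 : w ≠ 1) (hw2 : w ≠ -1)
    (a : ℝ) {v : ℝ} (hv : 0 < v) :
    HasDerivAt (eulerMaclaurinKernel w a)
      (w * (w + 1) / 2 * ((v - a) * (v - a - 1)) * (v : ℂ) ^ (-w - 2)) v := by
  have hv0 : (v : ℂ) ≠ 0 := ofReal_ne_zero.mpr hv.ne'
  have h1 : HasDerivAt (fun y : ℝ => (y : ℂ) ^ (1 - w) / (1 - w)) ((v : ℂ) ^ (-w)) v := by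
    have := hasDerivAt_ofReal_cpow_const' hv.ne' (r := -w) (fun h => hw1 (neg_inj.mp h))
    rwa [show -w + 1 = 1 - w by ring] at this
  have h2 := hasDerivAt_ofReal_cpow_const hv.ne' (r := -w) (neg_ne_zero.mpr hw0)
  have h3 := hasDerivAt_ofReal_cpow_const hv.ne' (r := -w - 1)
    (fun h => hw2 (by linear_combination -h))
  have h4 : HasDerivAt (fun y : ℝ => (y : ℂ)) 1 v := ofRealCLM.hasDerivAt
  have h5 : HasDerivAt (fun y : ℝ => (y : ℂ) - a) 1 v := h4.sub_const _
  have h6 : HasDerivAt (fun y : ℝ => (y : ℂ) - a - 1 / 2) 1 v := h5.sub_const _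
  have h7 : HasDerivAt (fun y : ℝ => (y : ℂ) - a - 1) 1 v := h5.sub_const _
  refine ((h1.sub (h6.mul h2)).sub (((h5.mul h7).const_mul (w / 2)).mul h3)).congr_deriv ?_
  have e1 : (v : ℂ) ^ (-w - 1) = (v : ℂ) ^ (-w - 2) * v := by
    rw [show -w - 1 = (-w - 2) + 1 by ring, cpow_add _ _ hv0, cpow_one]
  simp only [Pi.mul_apply]
  rw [show -w - 1 - 1 = -w - 2 by ring, e1]
  ring

lemma norm_eulerMaclaurinKernel_sub_le {w : ℂ} (hw0 : w ≠ 0) (hw1 : w ≠ 1) (hw : 0 ≤ w.re)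
    {a v : ℝ} (ha : 0 < a) (hv : a ≤ v) (hv' : v ≤ a + 1) :
    ‖eulerMaclaurinKernel w a v - eulerMaclaurinKernel w a a‖
      ≤ (1 + ‖w‖) ^ 2 / 8 * a ^ (-w.re - 2) := by
  have hw2 : w ≠ -1 := by
    rintro rfl
    norm_num at hw
  have key := norm_image_sub_le_of_norm_deriv_le_segment' (a := a) (b := a + 1)
    (C := (1 + ‖w‖) ^ 2 / 8 * a ^ (-w.re - 2))
    (fun y hy => (hasDerivAt_eulerMaclaurinKernel hw0 hw1 hw2 a
      (ha.trans_le hy.1)).hasDerivWithinAt) (fun y hy => ?_) v ⟨hv, hv'⟩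
  · refine key.trans (mul_le_of_le_one_right (by positivity) (by linarith))
  · have hy0 : 0 < y := ha.trans_le hy.1
    have h1 : ‖((y : ℂ) - a) * (y - a - 1)‖ ≤ 1 / 4 := by
      rw [show ((y : ℂ) - a) * (y - a - 1) = (((y - a) * (y - a - 1) : ℝ) : ℂ) by push_cast; ring,
        norm_real, Real.norm_eq_abs, abs_le]
      have := hy.1
      have := hy.2
      constructor <;> nlinarith [sq_nonneg (y - a - 1 / 2)]
    have h2 : ‖(y : ℂ) ^ (-w - 2)‖ ≤ a ^ (-w.re - 2) := by
      rw [norm_cpow_eq_rpow_re_of_pos hy0]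
      simp only [sub_re, neg_re, re_ofNat]
      exact Real.rpow_le_rpow_of_nonpos ha hy.1 (by linarith)
    have h3 : ‖w + 1‖ ≤ 1 + ‖w‖ := by
      simpa [add_comm] using norm_add_le w 1
    rw [norm_mul, norm_mul, norm_div, norm_mul, RCLike.norm_ofNat]
    calc ‖w‖ * ‖w + 1‖ / 2 * ‖((y : ℂ) - a) * (y - a - 1)‖ * ‖(y : ℂ) ^ (-w - 2)‖
        ≤ (1 + ‖w‖) * (1 + ‖w‖) / 2 * (1 / 4) * a ^ (-w.re - 2) := by
          gcongr
          linarith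
      _ = _ := by ring

/-- The partial sums of the Dirichlet series of `ζ`. -/
noncomputable def zetaPartialSum (w : ℂ) (n : ℕ) : ℂ :=
  ∑ i ∈ range n, ((i + 1 : ℕ) : ℂ) ^ (-w)

/-- The partial sums of the Dirichlet series of `ζ`, regularized by their Euler–Maclaurin main
terms. -/
noncomputable def zetaRegularizedSum (w : ℂ) (n : ℕ) : ℂ :=
  zetaPartialSum w n - (n : ℂ) ^ (1 - w) / (1 - w) - (n : ℂ) ^ (-w) / 2

lemma norm_zetaRegularizedSum_succ_sub_le {w : ℂ} (hw0 : w ≠ 0) (hw1 : w ≠ 1) (hw : 0 ≤ w.re)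
    {n : ℕ} (hn : 0 < n) :
    ‖zetaRegularizedSum w (n + 1) - zetaRegularizedSum w n‖
      ≤ (1 + ‖w‖) ^ 2 / 8 * (n : ℝ) ^ (-w.re - 2) := by
  have hn0 : (0 : ℝ) < n := by exact_mod_cast hn
  have h := norm_eulerMaclaurinKernel_sub_le hw0 hw1 hw hn0 (v := n + 1) (by linarith) le_rfl
  have e : zetaRegularizedSum w (n + 1) - zetaRegularizedSum w n
      = -(eulerMaclaurinKernel w n (n + 1) - eulerMaclaurinKernel w n n) := by
    simp only [zetaRegularizedSum, zetaPartialSum, eulerMaclaurinKernel, sum_range_succ]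
    push_cast
    ring
  rwa [e, norm_neg]

lemma norm_zetaRegularizedSum_add_sub_le {w : ℂ} (hw0 : w ≠ 0) (hw1 : w ≠ 1) (hw : 0 ≤ w.re)
    {n : ℕ} (hn : 0 < n) (j : ℕ) :
    ‖zetaRegularizedSum w (n + j) - zetaRegularizedSum w n‖
      ≤ (1 + ‖w‖) ^ 2 / 4 * (n : ℝ) ^ (-w.re) * (1 / n - 1 / ((n + j : ℕ) : ℝ)) := by
  have hn0 : (0 : ℝ) < n := by exact_mod_cast hn
  induction j with
  | zero => simp
  | succ j ih =>
    have hk0 : (0 : ℝ) < (n + j : ℕ) := by positivity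
    have hk1 : (1 : ℝ) ≤ (n + j : ℕ) := by exact_mod_cast (by omega : 1 ≤ n + j)
    have hnk : (n : ℝ) ≤ (n + j : ℕ) := by exact_mod_cast Nat.le_add_right n j
    have h := norm_zetaRegularizedSum_succ_sub_le hw0 hw1 hw (n := n + j) (by omega)
    have hs : ((n + (j + 1) : ℕ) : ℝ) = (n + j : ℕ) + 1 := by push_cast; ring
    rw [hs]
    rw [← add_assoc]
    set k : ℝ := ((n + j : ℕ) : ℝ) with hk
    have h2 : k ^ (-w.re - 2) ≤ (n : ℝ) ^ (-w.re) * (2 * (1 / k - 1 / (k + 1))) := by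
      rw [Real.rpow_sub hk0, div_eq_mul_inv, Real.rpow_two]
      have h3 : (k ^ 2)⁻¹ ≤ 2 * (1 / k - 1 / (k + 1)) := by
        rw [div_sub_div _ _ hk0.ne' (by positivity), inv_eq_one_div, ← mul_div_assoc,
          div_le_div_iff₀ (by positivity) (by positivity)]
        nlinarith
      exact mul_le_mul (Real.rpow_le_rpow_of_nonpos hn0 hnk (by linarith)) h3 (by positivity)
        (by positivity)
    calc ‖zetaRegularizedSum w (n + j + 1) - zetaRegularizedSum w n‖
        = ‖(zetaRegularizedSum w (n + j + 1) - zetaRegularizedSum w (n + j))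
          + (zetaRegularizedSum w (n + j) - zetaRegularizedSum w n)‖ := by ring_nf
      _ ≤ _ := norm_add_le _ _
      _ ≤ (1 + ‖w‖) ^ 2 / 8 * ((n : ℝ) ^ (-w.re) * (2 * (1 / k - 1 / (k + 1))))
          + (1 + ‖w‖) ^ 2 / 4 * (n : ℝ) ^ (-w.re) * (1 / n - 1 / k) := by
        refine add_le_add (h.trans ?_) ih
        gcongr
      _ = _ := by ring

lemma exists_norm_zetaRegularizedSum_sub_le {w : ℂ} (hw0 : w ≠ 0) (hw1 : w ≠ 1) (hw : 0 ≤ w.re) :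
    ∃ c : ℂ, Filter.Tendsto (zetaRegularizedSum w) Filter.atTop (nhds c) ∧
      ∀ n : ℕ, 0 < n → ‖zetaRegularizedSum w n - c‖
        ≤ (1 + ‖w‖) ^ 2 / 4 * (n : ℝ) ^ (-w.re - 1) := by
  have hbd : ∀ n : ℕ, 0 < n → ∀ j : ℕ, ‖zetaRegularizedSum w n - zetaRegularizedSum w (n + j)‖
      ≤ (1 + ‖w‖) ^ 2 / 4 * (n : ℝ) ^ (-w.re - 1) := by
    intro n hn j
    have hn0 : (0 : ℝ) < n := by exact_mod_cast hn
    rw [norm_sub_rev]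
    refine (norm_zetaRegularizedSum_add_sub_le hw0 hw1 hw hn j).trans ?_
    rw [Real.rpow_sub_one hn0.ne', ← mul_div_assoc, div_eq_mul_one_div (_ * _) (n : ℝ)]
    have : (0 : ℝ) ≤ 1 / ((n + j : ℕ) : ℝ) := by positivity
    gcongr
    linarith
  have hC : CauchySeq (fun n : ℕ => zetaRegularizedSum w (n + 1)) := by
    refine cauchySeq_of_le_tendsto_0' (fun n : ℕ => (1 + ‖w‖) ^ 2 / 4 * (1 / ((n : ℝ) + 1)))
      (fun n m hnm => ?_) ?_
    · obtain ⟨j, rfl⟩ := Nat.exists_eq_add_of_le hnm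
      rw [dist_eq_norm, show n + j + 1 = n + 1 + j by ring]
      refine (hbd (n + 1) (Nat.succ_pos n) j).trans ?_
      rw [one_div, ← Real.rpow_neg_one, ← Nat.cast_add_one]
      gcongr
      · exact_mod_cast Nat.le_add_left 1 n
      · linarith
    · simpa using (tendsto_one_div_add_atTop_nhds_zero_nat (𝕜 := ℝ)).const_mul ((1 + ‖w‖) ^ 2 / 4)
  obtain ⟨c, hc⟩ := cauchySeq_tendsto_of_complete hC
  have hc' := (Filter.tendsto_add_atTop_iff_nat 1).mp hc
  refine ⟨c, hc', fun n hn => ?_⟩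
  have h1 : Filter.Tendsto (fun j => zetaRegularizedSum w (n + j)) Filter.atTop (nhds c) := by
    have := (Filter.tendsto_add_atTop_iff_nat n).mpr hc'
    simpa only [add_comm] using this
  exact le_of_tendsto (h1.const_sub (zetaRegularizedSum w n)).norm
    (Filter.Eventually.of_forall fun j => hbd n hn j)

lemma tendsto_natCast_cpow_zero {r : ℂ} (hr : r.re < 0) :
    Filter.Tendsto (fun n : ℕ => (n : ℂ) ^ r) Filter.atTop (nhds 0) := by
  rw [tendsto_zero_iff_norm_tendsto_zero]
  have h := (tendsto_rpow_neg_atTop (neg_pos.mpr hr)).comp tendsto_natCast_atTop_atTop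
  rw [neg_neg] at h
  refine h.congr' ?_
  filter_upwards [Filter.eventually_gt_atTop 0] with n hn
  rw [Function.comp_apply, norm_natCast_cpow_of_pos hn]

lemma norm_zetaRegularizedSum_sub_zeta_le_of_one_lt {w : ℂ} (hw : 1 < w.re) {n : ℕ} (hn : 0 < n) :
    ‖zetaRegularizedSum w n - riemannZeta w‖ ≤ (1 + ‖w‖) ^ 2 / 4 * (n : ℝ) ^ (-w.re - 1) := by
  have hw0 : w ≠ 0 := by rintro rfl; norm_num at hw
  have hw1 : w ≠ 1 := by rintro rfl; norm_num at hw
  obtain ⟨c, hc, h⟩ := exists_norm_zetaRegularizedSum_sub_le hw0 hw1 (by linarith)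
  have hsum : HasSum (fun i : ℕ => ((i + 1 : ℕ) : ℂ) ^ (-w)) (riemannZeta w) := by
    have h1 := ((summable_nat_add_iff 1).mpr (summable_one_div_nat_cpow.mpr hw)).hasSum
    rw [zeta_eq_tsum_one_div_nat_add_one_cpow hw]
    simpa [cpow_neg] using h1
  have h2 : Filter.Tendsto (zetaRegularizedSum w) Filter.atTop (nhds (riemannZeta w)) := by
    have h3 := (hsum.tendsto_sum_nat.sub ((tendsto_natCast_cpow_zero (r := 1 - w)
      (by simpa using hw)).div_const (1 - w))).sub
      ((tendsto_natCast_cpow_zero (r := -w) (by rw [neg_re]; linarith)).div_const 2)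
    rw [zero_div, zero_div, sub_zero, sub_zero] at h3
    exact h3
  rw [tendsto_nhds_unique h2 hc]
  exact h n hn

lemma norm_zetaRegularizedSum_sub_zeta_le {w : ℂ} (hw1 : w ≠ 1) (hw : 1 ≤ w.re) {n : ℕ}
    (hn : 0 < n) :
    ‖zetaRegularizedSum w n - riemannZeta w‖ ≤ (1 + ‖w‖) ^ 2 / 4 * (n : ℝ) ^ (-w.re - 1) := by
  have hn0 : (n : ℂ) ≠ 0 := by exact_mod_cast hn.ne'
  have hn1 : (n : ℝ) ≠ 0 := by exact_mod_cast hn.ne'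
  have hlim : Filter.Tendsto (fun k : ℕ => w + 1 / ((k : ℂ) + 1)) Filter.atTop (nhds w) := by
    simpa using (tendsto_one_div_add_atTop_nhds_zero_nat (𝕜 := ℂ)).const_add w
  have hcont : ContinuousAt (fun z => zetaRegularizedSum z n) w := by
    have hc : ∀ k : ℕ, k ≠ 0 → ∀ f : ℂ → ℂ, ContinuousAt f w →
        ContinuousAt (fun z => (k : ℂ) ^ f z) w := fun k hk f hf =>
      hf.const_cpow (Or.inl (by exact_mod_cast hk))
    unfold zetaRegularizedSum zetaPartialSum
    refine ((tendsto_finsetSum _ fun i _ => hc (i + 1) (Nat.succ_ne_zero i) _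
      (by fun_prop)).sub ((hc n hn.ne' _ (by fun_prop)).div (by fun_prop) ?_)).sub
      ((hc n hn.ne' _ (by fun_prop)).div_const 2)
    exact sub_ne_zero.mpr hw1.symm
  have hL := ((hcont.sub (differentiableAt_riemannZeta hw1).continuousAt).norm.tendsto).comp hlim
  have hR : ContinuousAt (fun z : ℂ => (1 + ‖z‖) ^ 2 / 4 * (n : ℝ) ^ (-z.re - 1)) w := by
    exact ContinuousAt.mul (by fun_prop) ((Real.continuousAt_const_rpow hn1).comp
      ((continuous_re.neg).sub continuous_const).continuousAt)
  refine le_of_tendsto_of_tendsto hL (hR.tendsto.comp hlim) (Filter.Eventually.of_forall fun k => ?_)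
  refine norm_zetaRegularizedSum_sub_zeta_le_of_one_lt ?_ hn
  have : (0 : ℝ) < 1 / ((k : ℝ) + 1) := by positivity
  have e : (w + 1 / ((k : ℂ) + 1)).re = w.re + 1 / ((k : ℝ) + 1) := by
    rw [add_re, show (1 / ((k : ℂ) + 1)) = ((1 / ((k : ℝ) + 1) : ℝ) : ℂ) by push_cast; rfl,
      ofReal_re]
  rw [e]
  linarith

/-- Euler–Maclaurin at a real point, from the estimate at its integer part. -/
lemma norm_zetaPartialSum_floor_sub_le {w c : ℂ} (hw0 : w ≠ 0) (hw1 : w ≠ 1) (hw : 0 ≤ w.re)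
    (hw' : w.re ≤ 2)
    (h : ∀ n : ℕ, 0 < n → ‖zetaRegularizedSum w n - c‖
      ≤ (1 + ‖w‖) ^ 2 / 4 * (n : ℝ) ^ (-w.re - 1)) {u : ℝ} (hu : 1 ≤ u) :
    ‖zetaPartialSum w ⌊u⌋₊ - (u : ℂ) ^ (1 - w) / (1 - w) - c + sawtooth u * (u : ℂ) ^ (-w)‖
      ≤ 4 * (1 + ‖w‖) ^ 2 * u ^ (-w.re - 1) := by
  have hu0 : 0 < u := by linarith
  have hn : 0 < ⌊u⌋₊ := Nat.floor_pos.mpr hu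
  have hfl : (⌊u⌋₊ : ℝ) ≤ u := Nat.floor_le hu0.le
  have hfl' : u < ⌊u⌋₊ + 1 := Nat.lt_floor_add_one u
  have hψ : sawtooth u = u - ⌊u⌋₊ - 1 / 2 := by
    rw [sawtooth, Int.fract, natCast_floor_eq_intCast_floor hu0.le]
  set n := ⌊u⌋₊ with hnn
  have hn0 : (0 : ℝ) < n := by exact_mod_cast hn
  have hn1 : (1 : ℝ) ≤ n := by exact_mod_cast hn
  have hK := norm_eulerMaclaurinKernel_sub_le hw0 hw1 hw hn0 hfl hfl'.le
  have e : zetaPartialSum w n - (u : ℂ) ^ (1 - w) / (1 - w) - c + sawtooth u * (u : ℂ) ^ (-w)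
      = (zetaRegularizedSum w n - c) - (eulerMaclaurinKernel w n u - eulerMaclaurinKernel w n n)
        - w / 2 * ((((u - n) * (u - n - 1) : ℝ) : ℂ)) * (u : ℂ) ^ (-w - 1) := by
    rw [hψ]
    simp only [zetaRegularizedSum, eulerMaclaurinKernel]
    push_cast
    ring
  have h3 : ‖w / 2 * ((((u - n) * (u - n - 1) : ℝ) : ℂ)) * (u : ℂ) ^ (-w - 1)‖
      ≤ (1 + ‖w‖) ^ 2 * u ^ (-w.re - 1) := by
    have h1 : |(u - n) * (u - n - 1)| ≤ 1 := by
      rw [abs_le]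
      constructor <;> nlinarith
    rw [norm_mul, norm_mul, norm_real, Real.norm_eq_abs, norm_div, RCLike.norm_ofNat,
      norm_cpow_eq_rpow_re_of_pos hu0]
    simp only [sub_re, neg_re, one_re]
    have h2 : ‖w‖ / 2 * |(u - n) * (u - n - 1)| ≤ (1 + ‖w‖) ^ 2 := by
      have := norm_nonneg w
      nlinarith [mul_le_mul_of_nonneg_left h1 (by positivity : 0 ≤ ‖w‖ / 2)]
    gcongr
  have h4 : (n : ℝ) ^ (-w.re - 2) ≤ (n : ℝ) ^ (-w.re - 1) :=
    Real.rpow_le_rpow_of_exponent_le hn1 (by linarith)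
  have h5 : (n : ℝ) ^ (-w.re - 1) ≤ 8 * u ^ (-w.re - 1) := by
    calc (n : ℝ) ^ (-w.re - 1) ≤ (u / 2) ^ (-w.re - 1) :=
          Real.rpow_le_rpow_of_nonpos (by positivity) (by linarith) (by linarith)
      _ = (2:ℝ) ^ (w.re + 1) * u ^ (-w.re - 1) := by
          rw [Real.div_rpow hu0.le (by norm_num), show -w.re - 1 = -(w.re + 1) by ring,
            Real.rpow_neg (by norm_num : (0:ℝ) ≤ 2), div_inv_eq_mul, mul_comm]
      _ ≤ (2:ℝ) ^ (3:ℝ) * u ^ (-w.re - 1) := by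
          gcongr
          · norm_num
          · linarith
      _ = _ := by norm_num
  rw [e]
  refine (norm_sub_le _ _).trans ((add_le_add ((norm_sub_le _ _).trans
    (add_le_add (h n hn) hK)) h3).trans ?_)
  calc (1 + ‖w‖) ^ 2 / 4 * (n : ℝ) ^ (-w.re - 1) + (1 + ‖w‖) ^ 2 / 8 * (n : ℝ) ^ (-w.re - 2)
        + (1 + ‖w‖) ^ 2 * u ^ (-w.re - 1)
      ≤ (1 + ‖w‖) ^ 2 / 4 * (8 * u ^ (-w.re - 1)) + (1 + ‖w‖) ^ 2 / 8 * (8 * u ^ (-w.re - 1))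
        + (1 + ‖w‖) ^ 2 * u ^ (-w.re - 1) := by
        gcongr
        exact h4.trans h5
    _ = _ := by ring

lemma sum_Icc_one_eq_sum_range (f : ℕ → ℂ) (n : ℕ) :
    ∑ d ∈ Icc 1 n, f d = ∑ i ∈ range n, f (i + 1) := by
  induction n with
  | zero => simp
  | succ n ih => rw [sum_Icc_succ_top (by omega), ih, sum_range_succ]

/-- Dirichlet's hyperbola method. -/
lemma sum_divisorsAntidiagonal_hyperbola (f g : ℕ → ℂ) {N m : ℕ} (hm : m * m ≤ N)
    (hm' : N < (m + 1) * (m + 1)) :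
    ∑ h ∈ Icc 1 N, ∑ p ∈ h.divisorsAntidiagonal, f p.1 * g p.2
      = ∑ i ∈ range m, f (i + 1) * ∑ j ∈ range (N / (i + 1)), g (j + 1)
        + ∑ i ∈ range m, g (i + 1) * ∑ j ∈ range (N / (i + 1)), f (j + 1)
        - (∑ i ∈ range m, f (i + 1)) * ∑ i ∈ range m, g (i + 1) := by
  set S := (Icc 1 N ×ˢ Icc 1 N).filter (fun p => p.1 * p.2 ≤ N) with hS
  have hmem : ∀ p : ℕ × ℕ, p ∈ S ↔ 1 ≤ p.1 ∧ 1 ≤ p.2 ∧ p.1 * p.2 ≤ N := by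
    intro p
    simp only [hS, mem_filter, mem_product, mem_Icc]
    constructor
    · rintro ⟨⟨⟨h1, _⟩, h2, _⟩, h3⟩
      exact ⟨h1, h2, h3⟩
    · rintro ⟨h1, h2, h3⟩
      exact ⟨⟨⟨h1, by nlinarith⟩, h2, by nlinarith⟩, h3⟩
  have h1 : ∑ h ∈ Icc 1 N, ∑ p ∈ h.divisorsAntidiagonal, f p.1 * g p.2
      = ∑ p ∈ S, f p.1 * g p.2 := by
    rw [← sum_fiberwise_of_maps_to (s := S) (t := Icc 1 N) (g := fun p => p.1 * p.2)]
    · refine sum_congr rfl fun h hh => sum_congr ?_ fun _ _ => rfl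
      ext p
      rw [mem_Icc] at hh
      rw [mem_filter, hmem, Nat.mem_divisorsAntidiagonal]
      constructor
      · rintro ⟨rfl, h0⟩
        have := mul_ne_zero_iff.mp h0
        exact ⟨⟨by omega, by omega, hh.2⟩, rfl⟩
      · rintro ⟨_, rfl⟩
        exact ⟨rfl, by omega⟩
    · intro p hp
      rw [hmem] at hp
      exact mem_Icc.mpr ⟨Nat.mul_pos hp.1 hp.2.1, hp.2.2⟩
  have hunion : S.filter (fun p => p.1 ≤ m) ∪ S.filter (fun p => p.2 ≤ m) = S := by
    rw [← filter_or]
    refine filter_true_of_mem fun p hp => ?_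
    rw [hmem] at hp
    by_contra! hcon
    have : (m + 1) * (m + 1) ≤ p.1 * p.2 :=
      Nat.mul_le_mul (Nat.succ_le_of_lt hcon.1) (Nat.succ_le_of_lt hcon.2)
    omega
  have hinter : S.filter (fun p => p.1 ≤ m) ∩ S.filter (fun p => p.2 ≤ m)
      = Icc 1 m ×ˢ Icc 1 m := by
    ext p
    simp only [mem_inter, mem_filter, hmem, mem_product, mem_Icc]
    constructor
    · rintro ⟨⟨⟨h1, h2, _⟩, h4⟩, _, h5⟩
      exact ⟨⟨h1, h4⟩, h2, h5⟩
    · rintro ⟨⟨h1, h4⟩, h2, h5⟩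
      have : p.1 * p.2 ≤ N := (Nat.mul_le_mul h4 h5).trans hm
      exact ⟨⟨⟨h1, h2, this⟩, h4⟩, ⟨h1, h2, this⟩, h5⟩
  have hA : ∑ p ∈ S.filter (fun p => p.1 ≤ m), f p.1 * g p.2
      = ∑ d ∈ Icc 1 m, ∑ e ∈ Icc 1 (N / d), f d * g e := by
    refine sum_finset_product _ _ _ fun p => ?_
    rw [mem_filter, hmem, mem_Icc, mem_Icc]
    constructor
    · rintro ⟨⟨h1, h2, h3⟩, h4⟩
      exact ⟨⟨h1, h4⟩, h2, (Nat.le_div_iff_mul_le h1).mpr (by rwa [mul_comm])⟩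
    · rintro ⟨⟨h1, h4⟩, h2, h3⟩
      exact ⟨⟨h1, h2, by rw [mul_comm]; exact (Nat.le_div_iff_mul_le h1).mp h3⟩, h4⟩
  have hB : ∑ p ∈ S.filter (fun p => p.2 ≤ m), f p.1 * g p.2
      = ∑ e ∈ Icc 1 m, ∑ d ∈ Icc 1 (N / e), f d * g e := by
    refine sum_finset_product_right _ _ _ fun p => ?_
    rw [mem_filter, hmem, mem_Icc, mem_Icc]
    constructor
    · rintro ⟨⟨h1, h2, h3⟩, h4⟩
      exact ⟨⟨h2, h4⟩, h1, (Nat.le_div_iff_mul_le h2).mpr h3⟩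
    · rintro ⟨⟨h2, h4⟩, h1, h3⟩
      exact ⟨⟨h1, h2, (Nat.le_div_iff_mul_le h2).mp h3⟩, h4⟩
  have hC : ∑ p ∈ Icc 1 m ×ˢ Icc 1 m, f p.1 * g p.2
      = (∑ i ∈ range m, f (i + 1)) * ∑ i ∈ range m, g (i + 1) := by
    rw [sum_product, ← sum_Icc_one_eq_sum_range, ← sum_Icc_one_eq_sum_range, sum_mul_sum]
  have hui := sum_union_inter (s₁ := S.filter (fun p => p.1 ≤ m))
    (s₂ := S.filter (fun p => p.2 ≤ m)) (f := fun p : ℕ × ℕ => f p.1 * g p.2)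
  rw [hunion, hinter, hA, hB, hC] at hui
  simp only [sum_Icc_one_eq_sum_range, ← mul_sum] at hui
  rw [h1, eq_sub_iff_add_eq, hui]
  congr 1
  refine sum_congr rfl fun i _ => ?_
  rw [← sum_mul, mul_comm]

lemma ofReal_div_cpow {x y : ℝ} (hx : 0 < x) (hy : 0 < y) (r : ℂ) :
    ((x / y : ℝ) : ℂ) ^ r = (x : ℂ) ^ r * (y : ℂ) ^ (-r) := by
  have h := mul_cpow_ofReal_nonneg (div_pos hx hy).le hy.le r
  rw [← ofReal_mul, div_mul_cancel₀ x hy.ne'] at h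
  have hy0 : (y : ℂ) ^ r ≠ 0 := by simp [cpow_eq_zero_iff, hy.ne']
  rw [h, cpow_neg, mul_assoc, mul_inv_cancel₀ hy0, mul_one]

lemma one_le_norm_one_sub {a : ℂ} (ha : a.re = 0) : 1 ≤ ‖1 - a‖ := by
  have h := abs_re_le_norm (1 - a)
  rwa [sub_re, ha, one_re, sub_zero, abs_one] at h

/-- One half of the hyperbola sum, evaluated by Euler–Maclaurin. -/
lemma norm_sum_mul_zetaPartialSum_sub_le {a c : ℂ} (ha : a.re = 0) (ha0 : a ≠ 0)
    (hc : ∀ u : ℝ, 1 ≤ u → ‖zetaPartialSum a ⌊u⌋₊ - (u : ℂ) ^ (1 - a) / (1 - a) - c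
      + sawtooth u * (u : ℂ) ^ (-a)‖ ≤ 4 * (1 + ‖a‖) ^ 2 * u ^ (-a.re - 1))
    {x : ℝ} (hx : 1 ≤ x) :
    ‖∑ i ∈ range ⌊√x⌋₊, ((i + 1 : ℕ) : ℂ) ^ a * zetaPartialSum a ⌊x / (i + 1 : ℕ)⌋₊
      - (riemannZeta (1 - 2 * a) * (x : ℂ) ^ (1 - a) / (1 - a) + x / (2 * a * (1 - a))
        - sawtooth √x * (√x : ℝ) / (1 - a) + c * zetaPartialSum (-a) ⌊√x⌋₊)‖
      ≤ 20 * (1 + ‖a‖) ^ 2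
        + ‖∑ i ∈ range ⌊√x⌋₊, ((i + 1 : ℕ) : ℂ) ^ (2 * a) * (sawtooth (x / (i + 1 : ℕ)) : ℂ)‖ := by
  have hx0 : 0 < x := by linarith
  have hxC : (x : ℂ) ≠ 0 := ofReal_ne_zero.mpr hx0.ne'
  have hY1 : 1 ≤ √x := Real.one_le_sqrt.mpr hx
  have hY2 : √x * √x = x := Real.mul_self_sqrt hx0.le
  set Y := √x with hY
  have hY0 : 0 < Y := by linarith
  have hYC : (Y : ℂ) ≠ 0 := ofReal_ne_zero.mpr hY0.ne'
  set m := ⌊Y⌋₊ with hm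
  have hmY : (m : ℝ) ≤ Y := Nat.floor_le hY0.le
  have h1a : 1 - a ≠ 0 := norm_pos_iff.mp (by linarith [one_le_norm_one_sub ha])
  set Ψ : ℂ := ∑ i ∈ range m, ((i + 1 : ℕ) : ℂ) ^ (2 * a) * (sawtooth (x / (i + 1 : ℕ)) : ℂ) with hΨ
  set E : ℕ → ℂ := fun i => ((i + 1 : ℕ) : ℂ) ^ a * (zetaPartialSum a ⌊x / (i + 1 : ℕ)⌋₊
    - ((x / (i + 1 : ℕ) : ℝ) : ℂ) ^ (1 - a) / (1 - a) - c
      + sawtooth (x / (i + 1 : ℕ)) * ((x / (i + 1 : ℕ) : ℝ) : ℂ) ^ (-a)) with hE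
  have hEn : ∀ i ∈ range m, ‖E i‖ ≤ 4 * (1 + ‖a‖) ^ 2 * (Y / x) := by
    intro i hi
    have hi1 : ((i + 1 : ℕ) : ℝ) ≤ Y := by
      refine le_trans ?_ hmY
      exact_mod_cast mem_range.mp hi
    have hd0 : (0 : ℝ) < (i + 1 : ℕ) := by positivity
    have hu : 1 ≤ x / (i + 1 : ℕ) := by
      rw [le_div_iff₀ hd0]
      nlinarith
    rw [hE, norm_mul, norm_natCast_cpow_of_pos (Nat.succ_pos i), ha, Real.rpow_zero, one_mul]
    refine (hc _ hu).trans ?_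
    rw [ha, neg_zero, zero_sub, Real.rpow_neg_one, inv_div]
    gcongr
  have hEs : ‖∑ i ∈ range m, E i‖ ≤ 4 * (1 + ‖a‖) ^ 2 := by
    refine (norm_sum_le_of_le _ hEn).trans ?_
    rw [sum_const, card_range, nsmul_eq_mul]
    have h1 : m * (Y / x) ≤ 1 := by
      rw [← mul_div_assoc, div_le_one hx0]
      nlinarith
    calc (m : ℝ) * (4 * (1 + ‖a‖) ^ 2 * (Y / x)) = 4 * (1 + ‖a‖) ^ 2 * (m * (Y / x)) := by ring
      _ ≤ _ := mul_le_of_le_one_right (by positivity) h1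
  have hterm : ∀ i ∈ range m, ((i + 1 : ℕ) : ℂ) ^ a * zetaPartialSum a ⌊x / (i + 1 : ℕ)⌋₊
      = (x : ℂ) ^ (1 - a) / (1 - a) * ((i + 1 : ℕ) : ℂ) ^ (-(1 - 2 * a))
        + c * ((i + 1 : ℕ) : ℂ) ^ (- -a)
        - (x : ℂ) ^ (-a) * (((i + 1 : ℕ) : ℂ) ^ (2 * a) * (sawtooth (x / (i + 1 : ℕ)) : ℂ))
        + E i := by
    intro i _
    have hd0 : (0 : ℝ) < (i + 1 : ℕ) := by positivity
    have hdC : ((i + 1 : ℕ) : ℂ) ≠ 0 := by exact_mod_cast Nat.succ_ne_zero i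
    have e1 : ((i + 1 : ℕ) : ℂ) ^ (-(1 - 2 * a))
        = ((i + 1 : ℕ) : ℂ) ^ a * ((i + 1 : ℕ) : ℂ) ^ (-(1 - a)) := by
      rw [← cpow_add _ _ hdC]
      ring_nf
    have e2 : ((i + 1 : ℕ) : ℂ) ^ (2 * a)
        = ((i + 1 : ℕ) : ℂ) ^ a * ((i + 1 : ℕ) : ℂ) ^ (- -a) := by
      rw [← cpow_add _ _ hdC]
      ring_nf
    rw [hE]
    simp only [ofReal_div_cpow hx0 hd0, ofReal_natCast]
    rw [e1, e2, neg_neg]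
    ring
  have hsum : ∑ i ∈ range m, ((i + 1 : ℕ) : ℂ) ^ a * zetaPartialSum a ⌊x / (i + 1 : ℕ)⌋₊
      = (x : ℂ) ^ (1 - a) / (1 - a) * zetaPartialSum (1 - 2 * a) m
        + c * zetaPartialSum (-a) m - (x : ℂ) ^ (-a) * Ψ + ∑ i ∈ range m, E i := by
    rw [sum_congr rfl hterm, sum_add_distrib, sum_sub_distrib, sum_add_distrib, ← mul_sum,
      ← mul_sum, ← mul_sum]
    rfl
  have hre : (1 - 2 * a).re = 1 := by simp [ha]
  have hw1 : 1 - 2 * a ≠ 1 := by simpa using ha0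
  have hw0 : 1 - 2 * a ≠ 0 := by
    intro h
    rw [h, zero_re] at hre
    exact zero_ne_one hre
  set F : ℂ := zetaPartialSum (1 - 2 * a) m - (Y : ℂ) ^ (1 - (1 - 2 * a)) / (1 - (1 - 2 * a))
    - riemannZeta (1 - 2 * a) + sawtooth Y * (Y : ℂ) ^ (-(1 - 2 * a)) with hF
  have hFn : ‖F‖ ≤ 16 * (1 + ‖a‖) ^ 2 / x := by
    refine (norm_zetaPartialSum_floor_sub_le hw0 hw1 (by rw [hre]; norm_num)
      (by rw [hre]; norm_num) (fun n hn => norm_zetaRegularizedSum_sub_zeta_le hw1 hre.ge hn)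
      hY1).trans ?_
    have h1 : Y ^ (-(1 - 2 * a).re - 1) = 1 / x := by
      rw [hre, show (-1 - 1 : ℝ) = -2 by norm_num, Real.rpow_neg hY0.le, Real.rpow_two, sq, hY2,
        one_div]
    have h2 : ‖1 - 2 * a‖ ≤ 1 + 2 * ‖a‖ := by
      simpa using norm_sub_le 1 (2 * a)
    rw [h1]
    calc 4 * (1 + ‖1 - 2 * a‖) ^ 2 * (1 / x) ≤ 4 * (1 + (1 + 2 * ‖a‖)) ^ 2 * (1 / x) := by gcongr
      _ = _ := by ring
  have hx1a : (x : ℂ) ^ (1 - a) = x / ((Y : ℂ) ^ a) ^ 2 := by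
    have h := mul_cpow_ofReal_nonneg hY0.le hY0.le a
    rw [← ofReal_mul, hY2] at h
    rw [cpow_sub _ _ hxC, cpow_one, h, sq]
  have hp : (Y : ℂ) ^ a ≠ 0 := by simp [cpow_eq_zero_iff, hY0.ne']
  have hY2a : (Y : ℂ) ^ (1 - (1 - 2 * a)) = ((Y : ℂ) ^ a) ^ 2 := by
    rw [show 1 - (1 - 2 * a) = a + a by ring, cpow_add _ _ hYC, sq]
  have hYm : (Y : ℂ) ^ (-(1 - 2 * a)) = ((Y : ℂ) ^ a) ^ 2 / Y := by
    rw [show -(1 - 2 * a) = a + a - 1 by ring, cpow_sub _ _ hYC, cpow_add _ _ hYC, cpow_one, sq]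
  have hYx : (x : ℂ) = Y * Y := by rw [← ofReal_mul, hY2]
  have hid : ∑ i ∈ range m, ((i + 1 : ℕ) : ℂ) ^ a * zetaPartialSum a ⌊x / (i + 1 : ℕ)⌋₊
      - (riemannZeta (1 - 2 * a) * (x : ℂ) ^ (1 - a) / (1 - a) + x / (2 * a * (1 - a))
        - sawtooth Y * (Y : ℂ) / (1 - a) + c * zetaPartialSum (-a) m)
      = (x : ℂ) ^ (1 - a) / (1 - a) * F - (x : ℂ) ^ (-a) * Ψ + ∑ i ∈ range m, E i := by
    have e1 : (x : ℂ) ^ (1 - a) / (1 - a) * ((Y : ℂ) ^ (1 - (1 - 2 * a)) / (1 - (1 - 2 * a)))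
        = x / (2 * a * (1 - a)) := by
      rw [hx1a, hY2a, show 1 - (1 - 2 * a) = 2 * a by ring]
      field_simp
    have e2 : (x : ℂ) ^ (1 - a) / (1 - a) * (sawtooth Y * (Y : ℂ) ^ (-(1 - 2 * a)))
        = sawtooth Y * (Y : ℂ) / (1 - a) := by
      rw [hx1a, hYm, hYx]
      field_simp
    rw [hsum, ← e1, ← e2, hF]
    ring
  have hn1 : ‖(x : ℂ) ^ (1 - a) / (1 - a) * F‖ ≤ 16 * (1 + ‖a‖) ^ 2 := by
    rw [norm_mul, norm_div, norm_cpow_eq_rpow_re_of_pos hx0, sub_re, ha, one_re, sub_zero,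
      Real.rpow_one]
    calc x / ‖1 - a‖ * ‖F‖ ≤ x / 1 * (16 * (1 + ‖a‖) ^ 2 / x) := by
          gcongr
          exact one_le_norm_one_sub ha
      _ = _ := by field_simp
  have hn2 : ‖(x : ℂ) ^ (-a) * Ψ‖ = ‖Ψ‖ := by
    rw [norm_mul, norm_cpow_eq_rpow_re_of_pos hx0, neg_re, ha, neg_zero, Real.rpow_zero, one_mul]
  rw [hid]
  refine (norm_add_le _ _).trans ((add_le_add (norm_sub_le _ _) le_rfl).trans ?_)
  rw [hn2]
  linarith

lemma norm_eulerMaclaurin_const_le {a c : ℂ} (ha : a.re = 0)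
    (hc : ∀ u : ℝ, 1 ≤ u → ‖zetaPartialSum a ⌊u⌋₊ - (u : ℂ) ^ (1 - a) / (1 - a) - c
      + sawtooth u * (u : ℂ) ^ (-a)‖ ≤ 4 * (1 + ‖a‖) ^ 2 * u ^ (-a.re - 1)) :
    ‖c‖ ≤ 7 * (1 + ‖a‖) ^ 2 := by
  have h := hc 1 le_rfl
  rw [Nat.floor_one, Real.one_rpow, mul_one] at h
  set Q := zetaPartialSum a 1 - ((1 : ℝ) : ℂ) ^ (1 - a) / (1 - a) - c
    + sawtooth 1 * ((1 : ℝ) : ℂ) ^ (-a) with hQ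
  have e : c = 1 - 1 / (1 - a) + sawtooth 1 - Q := by
    simp only [hQ, zetaPartialSum, ofReal_one, one_cpow]
    simp
  have h1 : ‖1 / (1 - a)‖ ≤ 1 := by
    rw [norm_div, norm_one]
    exact div_le_one_of_le₀ (one_le_norm_one_sub ha) (norm_nonneg _)
  have h2 : ‖(sawtooth 1 : ℂ)‖ ≤ 1 / 2 := by
    rw [norm_real]
    exact abs_sawtooth_le 1
  have h3 : ‖c‖ ≤ 1 + ‖1 / (1 - a)‖ + ‖(sawtooth 1 : ℂ)‖ + ‖Q‖ := by
    conv_lhs => rw [e]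
    refine (norm_sub_le _ _).trans (add_le_add ((norm_add_le _ _).trans
      (add_le_add ((norm_sub_le _ _).trans ?_) le_rfl)) le_rfl)
    rw [norm_one]
  nlinarith [norm_nonneg a]

/-- The second-order terms of the hyperbola method: after the main terms cancel, a bounded
quantity remains. -/
lemma norm_hyperbola_remainder_le {a c c' : ℂ} (ha : a.re = 0) (ha0 : a ≠ 0)
    (hc : ∀ u : ℝ, 1 ≤ u → ‖zetaPartialSum a ⌊u⌋₊ - (u : ℂ) ^ (1 - a) / (1 - a) - c
      + sawtooth u * (u : ℂ) ^ (-a)‖ ≤ 4 * (1 + ‖a‖) ^ 2 * u ^ (-a.re - 1))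
    (hc' : ∀ u : ℝ, 1 ≤ u → ‖zetaPartialSum (-a) ⌊u⌋₊ - (u : ℂ) ^ (1 - -a) / (1 - -a) - c'
      + sawtooth u * (u : ℂ) ^ (- -a)‖ ≤ 4 * (1 + ‖-a‖) ^ 2 * u ^ (-(-a).re - 1))
    {x : ℝ} (hx : 1 ≤ x) :
    ‖(x : ℂ) / (2 * a * (1 - a)) - sawtooth √x * (√x : ℝ) / (1 - a)
        + c * zetaPartialSum (-a) ⌊√x⌋₊
      + ((x : ℂ) / (2 * -a * (1 - -a)) - sawtooth √x * (√x : ℝ) / (1 - -a)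
        + c' * zetaPartialSum (- -a) ⌊√x⌋₊)
      - zetaPartialSum (-a) ⌊√x⌋₊ * zetaPartialSum a ⌊√x⌋₊‖ ≤ 82 * (1 + ‖a‖) ^ 4 := by
  have hx0 : 0 < x := by linarith
  have ha' : (-a).re = 0 := by rw [neg_re, ha, neg_zero]
  have hY1 : 1 ≤ √x := Real.one_le_sqrt.mpr hx
  have hY2 : √x * √x = x := Real.mul_self_sqrt hx0.le
  have hcn := norm_eulerMaclaurin_const_le ha hc
  have hcn' := norm_eulerMaclaurin_const_le ha' hc'
  have hR := hc _ hY1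
  have hR' := hc' _ hY1
  have hb1 := one_le_norm_one_sub ha
  have hb2 := one_le_norm_one_sub ha'
  set Y := √x with hY
  have hY0 : 0 < Y := by linarith
  have hYC : (Y : ℂ) ≠ 0 := ofReal_ne_zero.mpr hY0.ne'
  have hYx : (x : ℂ) = Y * Y := by rw [← ofReal_mul, hY2]
  have h1a : 1 - a ≠ 0 := norm_pos_iff.mp (by linarith)
  have h1a' : 1 - -a ≠ 0 := norm_pos_iff.mp (by linarith)
  rw [neg_neg] at hR' ⊢
  rw [norm_neg] at hR' hcn'
  rw [ha, neg_zero, zero_sub, Real.rpow_neg_one] at hR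
  rw [ha', neg_zero, zero_sub, Real.rpow_neg_one] at hR'
  set Z := zetaPartialSum a ⌊Y⌋₊
  set Z' := zetaPartialSum (-a) ⌊Y⌋₊
  set R := Z - (Y : ℂ) ^ (1 - a) / (1 - a) - c + sawtooth Y * (Y : ℂ) ^ (-a) with hRd
  set R' := Z' - (Y : ℂ) ^ (1 - -a) / (1 - -a) - c' + sawtooth Y * (Y : ℂ) ^ a with hRd'
  set P := (Y : ℂ) ^ (1 - a) / (1 - a) - sawtooth Y * (Y : ℂ) ^ (-a) with hP
  set P' := (Y : ℂ) ^ (1 - -a) / (1 - -a) - sawtooth Y * (Y : ℂ) ^ a with hP'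
  have hψ : ‖(sawtooth Y : ℂ)‖ ≤ 1 / 2 := by
    rw [norm_real]
    exact abs_sawtooth_le Y
  have hPn : ‖P‖ ≤ 2 * Y := by
    have h1 : ‖(Y : ℂ) ^ (1 - a) / (1 - a)‖ ≤ Y := by
      rw [norm_div, norm_cpow_eq_rpow_re_of_pos hY0, sub_re, ha, one_re, sub_zero, Real.rpow_one]
      exact div_le_self hY0.le hb1
    have h2 : ‖sawtooth Y * (Y : ℂ) ^ (-a)‖ ≤ 1 / 2 := by
      rwa [norm_mul, norm_cpow_eq_rpow_re_of_pos hY0, ha', Real.rpow_zero, mul_one]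
    linarith [norm_sub_le ((Y : ℂ) ^ (1 - a) / (1 - a)) (sawtooth Y * (Y : ℂ) ^ (-a))]
  have hPn' : ‖P'‖ ≤ 2 * Y := by
    have h1 : ‖(Y : ℂ) ^ (1 - -a) / (1 - -a)‖ ≤ Y := by
      rw [norm_div, norm_cpow_eq_rpow_re_of_pos hY0, sub_re, ha', one_re, sub_zero, Real.rpow_one]
      exact div_le_self hY0.le hb2
    have h2 : ‖sawtooth Y * (Y : ℂ) ^ a‖ ≤ 1 / 2 := by
      rwa [norm_mul, norm_cpow_eq_rpow_re_of_pos hY0, ha, Real.rpow_zero, mul_one]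
    linarith [norm_sub_le ((Y : ℂ) ^ (1 - -a) / (1 - -a)) (sawtooth Y * (Y : ℂ) ^ a)]
  have hp : (Y : ℂ) ^ a ≠ 0 := by simp [cpow_eq_zero_iff, hY0.ne']
  have hPP : P * P' = x / (2 * a * (1 - a)) + x / (2 * -a * (1 - -a))
      - sawtooth Y * (Y : ℂ) / (1 - a) - sawtooth Y * (Y : ℂ) / (1 - -a)
      + (sawtooth Y : ℂ) ^ 2 := by
    rw [hP, hP', cpow_sub _ _ hYC, cpow_sub _ _ hYC, cpow_neg, cpow_one, hYx]
    rw [sub_neg_eq_add] at h1a' ⊢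
    field_simp
    ring
  have hid : (x : ℂ) / (2 * a * (1 - a)) - sawtooth Y * (Y : ℂ) / (1 - a) + c * Z'
      + ((x : ℂ) / (2 * -a * (1 - -a)) - sawtooth Y * (Y : ℂ) / (1 - -a) + c' * Z) - Z' * Z
      = c * c' - (sawtooth Y : ℂ) ^ 2 - (P * R' + R * P' + R * R') := by
    have e1 : Z = c + P + R := by
      rw [hRd, hP]
      ring
    have e2 : Z' = c' + P' + R' := by
      rw [hRd', hP']
      ring
    rw [e1, e2]
    linear_combination -hPP
  have hτ : 1 ≤ 1 + ‖a‖ := by linarith [norm_nonneg a]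
  set τ := 1 + ‖a‖
  have hτ24 : τ ^ 2 ≤ τ ^ 4 := pow_le_pow_right₀ hτ (by norm_num)
  have hτ4 : 1 ≤ τ ^ 4 := one_le_pow₀ hτ
  have k1 : ‖c * c'‖ ≤ 49 * τ ^ 4 := by
    rw [norm_mul]
    calc ‖c‖ * ‖c'‖ ≤ (7 * τ ^ 2) * (7 * τ ^ 2) := by gcongr
      _ = _ := by ring
  have k2 : ‖(sawtooth Y : ℂ) ^ 2‖ ≤ 1 := by
    rw [norm_pow]
    nlinarith [norm_nonneg (sawtooth Y : ℂ)]
  have k3 : ‖P * R'‖ ≤ 8 * τ ^ 2 := by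
    rw [norm_mul]
    calc ‖P‖ * ‖R'‖ ≤ (2 * Y) * (4 * τ ^ 2 * Y⁻¹) := by gcongr
      _ = _ := by field_simp; norm_num
  have k4 : ‖R * P'‖ ≤ 8 * τ ^ 2 := by
    rw [norm_mul]
    calc ‖R‖ * ‖P'‖ ≤ (4 * τ ^ 2 * Y⁻¹) * (2 * Y) := by gcongr
      _ = _ := by field_simp; norm_num
  have k5 : ‖R * R'‖ ≤ 16 * τ ^ 4 := by
    have hYi : Y⁻¹ ≤ 1 := inv_le_one_of_one_le₀ hY1
    rw [norm_mul]
    calc ‖R‖ * ‖R'‖ ≤ (4 * τ ^ 2 * 1) * (4 * τ ^ 2 * 1) := by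
          gcongr
          · exact hR.trans (by gcongr)
          · exact hR'.trans (by gcongr)
      _ = _ := by ring
  rw [hid]
  have h1 := norm_sub_le (c * c' - (sawtooth Y : ℂ) ^ 2) (P * R' + R * P' + R * R')
  have h2 := norm_sub_le (c * c') ((sawtooth Y : ℂ) ^ 2)
  have h3 := norm_add_le (P * R' + R * P') (R * R')
  have h4 := norm_add_le (P * R') (R * P')
  linarith

lemma sum_cpow_mul_sum_divisors_eq {a : ℂ} {x : ℝ} (hx : 1 ≤ x) :
    ∑ h ∈ Icc 1 ⌊x⌋₊, (h : ℂ) ^ (-a) * ∑ d ∈ h.divisors, (d : ℂ) ^ (2 * a)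
      = ∑ i ∈ range ⌊√x⌋₊, ((i + 1 : ℕ) : ℂ) ^ a * zetaPartialSum a ⌊x / (i + 1 : ℕ)⌋₊
        + ∑ i ∈ range ⌊√x⌋₊, ((i + 1 : ℕ) : ℂ) ^ (-a) * zetaPartialSum (-a) ⌊x / (i + 1 : ℕ)⌋₊
        - zetaPartialSum (-a) ⌊√x⌋₊ * zetaPartialSum a ⌊√x⌋₊ := by
  have hx0 : 0 ≤ x := by linarith
  have hm : ⌊√x⌋₊ * ⌊√x⌋₊ ≤ ⌊x⌋₊ := by
    refine Nat.le_floor ?_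
    have := Nat.floor_le (Real.sqrt_nonneg x)
    rw [Nat.cast_mul]
    calc (⌊√x⌋₊ : ℝ) * ⌊√x⌋₊ ≤ √x * √x := by gcongr
      _ = x := Real.mul_self_sqrt hx0
  have hm' : ⌊x⌋₊ < (⌊√x⌋₊ + 1) * (⌊√x⌋₊ + 1) := by
    rw [Nat.floor_lt hx0, Nat.cast_mul, Nat.cast_add_one]
    have := Nat.lt_floor_add_one √x
    calc x = √x * √x := (Real.mul_self_sqrt hx0).symm
      _ < _ := by gcongr
  have hyp := sum_divisorsAntidiagonal_hyperbola (fun d : ℕ => (d : ℂ) ^ a)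
    (fun e : ℕ => (e : ℂ) ^ (-a)) hm hm'
  have hL : ∑ h ∈ Icc 1 ⌊x⌋₊, (h : ℂ) ^ (-a) * ∑ d ∈ h.divisors, (d : ℂ) ^ (2 * a)
      = ∑ h ∈ Icc 1 ⌊x⌋₊, ∑ p ∈ h.divisorsAntidiagonal, (p.1 : ℂ) ^ a * (p.2 : ℂ) ^ (-a) := by
    refine sum_congr rfl fun h _ => ?_
    rw [← Nat.sum_divisorsAntidiagonal (fun u _ : ℕ => (u : ℂ) ^ (2 * a)), mul_sum]
    refine sum_congr rfl fun p hp => ?_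
    rw [Nat.mem_divisorsAntidiagonal] at hp
    obtain ⟨rfl, h0⟩ := hp
    have hp1 : (p.1 : ℂ) ≠ 0 := by exact_mod_cast (mul_ne_zero_iff.mp h0).1
    rw [Nat.cast_mul, natCast_mul_natCast_cpow, mul_right_comm, ← cpow_add _ _ hp1]
    ring_nf
  rw [hL, hyp]
  simp only [← Nat.floor_div_natCast, zetaPartialSum, neg_neg]

/-- The divisor-sum asymptotic in terms of a purely imaginary twist. -/
lemma exists_norm_sum_sub_le {η : ℝ} (hη : 0 < η) (hη' : η ≤ 1 / 4) :
    ∃ C : ℝ, 0 < C ∧ ∀ t : ℝ, t ≠ 0 → ∀ x : ℝ, 1 ≤ x →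
      ‖∑ h ∈ Icc 1 ⌊x⌋₊, (h : ℂ) ^ (-(t * I)) * ∑ d ∈ h.divisors, (d : ℂ) ^ (2 * (t * I))
        - riemannZeta (1 - 2 * -(t * I)) * (x : ℂ) ^ (1 - -(t * I)) / (1 - -(t * I))
        - riemannZeta (1 - 2 * (t * I)) * (x : ℂ) ^ (1 - t * I) / (1 - t * I)‖
      ≤ C * (1 + |t|) ^ 4 * x ^ ((27:ℝ) / 82 + 4 * η) := by
  obtain ⟨C, hC, h⟩ := exists_norm_sum_cpow_mul_sawtooth_le hη hη'
  refine ⟨122 + 2 * C, by positivity, fun t ht x hx => ?_⟩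
  have hx0 : 0 < x := by linarith
  have hm : ((⌊√x⌋₊ : ℕ) : ℝ) ^ 2 ≤ x := by
    calc ((⌊√x⌋₊ : ℕ) : ℝ) ^ 2 ≤ √x ^ 2 := by
          gcongr
          exact Nat.floor_le (Real.sqrt_nonneg x)
      _ = x := Real.sq_sqrt hx0.le
  have hs1 := h x hx _ hm t
  have hs2 := h x hx _ hm (-t)
  have ha : (t * I : ℂ).re = 0 := by simp
  have ha0 : (t * I : ℂ) ≠ 0 := mul_ne_zero (ofReal_ne_zero.mpr ht) I_ne_zero
  have hn : ‖(t * I : ℂ)‖ = |t| := by simp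
  rw [abs_neg, ofReal_neg, mul_assoc, neg_mul] at hs2
  rw [mul_assoc] at hs1
  rw [← hn] at hs1 hs2 ⊢
  generalize (t * I : ℂ) = a at *
  have ha' : (-a).re = 0 := by rw [neg_re, ha, neg_zero]
  have ha0' : -a ≠ 0 := neg_ne_zero.mpr ha0
  have em : ∀ b : ℂ, b.re = 0 → b ≠ 0 → ∃ c : ℂ, ∀ u : ℝ, 1 ≤ u →
      ‖zetaPartialSum b ⌊u⌋₊ - (u : ℂ) ^ (1 - b) / (1 - b) - c + sawtooth u * (u : ℂ) ^ (-b)‖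
        ≤ 4 * (1 + ‖b‖) ^ 2 * u ^ (-b.re - 1) := by
    intro b hb hb0
    have hb1 : b ≠ 1 := by
      rintro rfl
      norm_num at hb
    obtain ⟨c, -, hc⟩ := exists_norm_zetaRegularizedSum_sub_le hb0 hb1 hb.ge
    exact ⟨c, fun u hu =>
      norm_zetaPartialSum_floor_sub_le hb0 hb1 hb.ge (by rw [hb]; norm_num) hc hu⟩
  obtain ⟨c, hc⟩ := em a ha ha0
  obtain ⟨c', hc'⟩ := em (-a) ha' ha0'
  have h1 := norm_sum_mul_zetaPartialSum_sub_le ha ha0 hc hx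
  have h2 := norm_sum_mul_zetaPartialSum_sub_le ha' ha0' hc' hx
  have h3 := norm_hyperbola_remainder_le ha ha0 hc hc' hx
  rw [sum_cpow_mul_sum_divisors_eq hx]
  rw [norm_neg] at h2
  have hX : 1 ≤ x ^ ((27:ℝ) / 82 + 4 * η) := Real.one_le_rpow hx (by positivity)
  set X := x ^ ((27:ℝ) / 82 + 4 * η)
  have hτ : 1 ≤ 1 + ‖a‖ := by linarith [norm_nonneg a]
  set τ := 1 + ‖a‖
  have hτ24 : τ ^ 2 ≤ τ ^ 4 := pow_le_pow_right₀ hτ (by norm_num)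
  have hτ14 : τ ≤ τ ^ 4 := le_self_pow₀ hτ (by norm_num)
  have hfin : 20 * τ ^ 2 + C * τ * X + (20 * τ ^ 2 + C * τ * X) + 82 * τ ^ 4
      ≤ (122 + 2 * C) * τ ^ 4 * X := by
    have k1 : C * τ * X ≤ C * τ ^ 4 * X := by gcongr
    have k2 : τ ^ 4 ≤ τ ^ 4 * X := le_mul_of_one_le_right (by positivity) hX
    linarith
  refine le_trans ?_ hfin
  refine le_trans (le_of_eq ?_) ((norm_add_le _ _).trans (add_le_add ((norm_add_le _ _).trans
    (add_le_add (h1.trans (add_le_add le_rfl hs1)) (h2.trans (add_le_add le_rfl hs2)))) h3))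
  congr 1
  ring

/-- Van der Corput-type asymptotic for
`∑_{h ≤ x} ∑_{ab = h} (a/b)^(s-1/2) = ∑_{h ≤ x} h^(1/2-s) σ_{2s-1}(h)`
on the critical line `s = 1/2 + it`, `|t| ≥ 1`, with error
`O_ε((1+|t|)^A x^(27/82+ε))`. -/
theorem vanDerCorput_divisor_sum :
    ∀ ε : ℝ, 0 < ε → ∃ C > (0:ℝ), ∃ A > (0:ℝ), ∀ t : ℝ, 1 ≤ |t| → ∀ x : ℝ, 2 ≤ x →
      ∀ s : ℂ, s = 1/2 + t * Complex.I →
      ‖(∑ h ∈ Finset.Icc 1 ⌊x⌋₊,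
            (h : ℂ) ^ ((1:ℂ)/2 - s) * ∑ d ∈ (h : ℕ).divisors, (d : ℂ) ^ (2*s - 1))
          - riemannZeta (2*s) * (x : ℂ) ^ (s + 1/2) / (s + 1/2)
          - riemannZeta (2 - 2*s) * (x : ℂ) ^ (3/2 - s) / (3/2 - s)‖
        ≤ C * (1 + |t|) ^ A * x ^ ((27:ℝ)/82 + ε) := by
  intro ε hε
  set η := min (ε / 4) (1 / 4) with hη
  have hη0 : 0 < η := lt_min (by linarith) (by norm_num)
  have hηε : 4 * η ≤ ε := by linarith [min_le_left (ε / 4) (1 / 4 : ℝ)]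
  obtain ⟨C, hC, h⟩ := exists_norm_sum_sub_le hη0 (min_le_right _ _)
  refine ⟨C, hC, 4, by norm_num, fun t ht x hx s hs => ?_⟩
  have ht0 : t ≠ 0 := by
    rintro rfl
    norm_num at ht
  have hx1 : 1 ≤ x := by linarith
  have key := h t ht0 x hx1
  have e1 : (1:ℂ) / 2 - s = -(t * I) := by rw [hs]; ring
  have e2 : 2 * s - 1 = 2 * (t * I) := by rw [hs]; ring
  have e3 : 2 * s = 1 - 2 * -(t * I) := by rw [hs]; ring
  have e4 : s + 1 / 2 = 1 - -(t * I) := by rw [hs]; ring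
  have e5 : 2 - 2 * s = 1 - 2 * (t * I) := by rw [hs]; ring
  have e6 : 3 / 2 - s = 1 - t * I := by rw [hs]; ring
  rw [e1, e2, e5, e3, e4, e6]
  refine key.trans ?_
  rw [Real.rpow_ofNat]
  gcongr
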